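/- arXiv:math/0606159 — 2 statements merged into one kernel-verified Lean document; each statement's English description precedes it below -/
import Mathlib

section
/- Let G = G_1 * G_2 * ... * G_n be a free product in which each factor G_i is either a finitely generated nilpotent group or a finite group. If φ is any endomorphism of G, then the fixed subgroup Fix(φ) = {g ∈ G : φ(g) = g} has Kurosh rank at most n with respect to this free product decomposition of G. -/
universe u

open Monoid

instance sumElimGroup {α β : Type*} (A : α → Type u) (B : β → Type u)
    [∀ a, Group (A a)] [∀ b, Group (B b)] (x : α ⊕ β) : Group (Sum.elim A B x) :=
  match x with
  | .inl a => inferInstanceAs (Group (A a))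
  | .inr b => inferInstanceAs (Group (B b))

/-- The free factor `G_i` of a free product, viewed as a subgroup. -/
def factorSubgroup {ι : Type*} {M : ι → Type*} [∀ i, Group (M i)] (i : ι) :
    Subgroup (CoprodI M) := (CoprodI.of (i := i)).range

/-- The conjugate `g S g⁻¹` of a subgroup `S`. -/
def conjSubgroup {G : Type*} [Group G] (g : G) (S : Subgroup G) : Subgroup G :=
  S.map (MulAut.conj g).toMonoidHom

/-- The `n`-th iterate of an endomorphism. -/
def iterHom {G : Type*} [Group G] (φ : G →* G) : ℕ → (G →* G)
  | 0 => MonoidHom.id G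
  | n + 1 => φ.comp (iterHom φ n)

/-- The stable image `φ^∞(G) = ⋂ₙ φⁿ(G)`. -/
def stableImage {G : Type*} [Group G] (φ : G →* G) : Subgroup G :=
  ⨅ n : ℕ, (iterHom φ (n + 1)).range

/-- The fixed subgroup of an endomorphism. -/
def fixedSubgroup {G : Type*} [Group G] (φ : G →* G) : Subgroup G where
  carrier := {g | φ g = g}
  one_mem' := by simp
  mul_mem' := by intro a b ha hb; simp only [Set.mem_setOf_eq, map_mul] at *; rw [ha, hb]
  inv_mem' := by intro a ha; simp only [Set.mem_setOf_eq, map_inv] at *; rw [ha]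

/-- `H` has Kurosh rank at most `k` with respect to the given splitting. -/
def HasKuroshRankLE {ι : Type} {M : ι → Type} [∀ i, Group (M i)]
    (H : Subgroup (CoprodI M)) (k : ℕ) : Prop :=
  ∃ (m r : ℕ) (J : Fin m → ι) (g : Fin m → CoprodI M)
    (e : H ≃* CoprodI (Sum.elim
      (fun i : Fin m => ↥(conjSubgroup (g i) (factorSubgroup (J i)) ⊓ H))
      (fun _ : Fin r => Multiplicative ℤ))),
    m + r ≤ k ∧
    (∀ i : Fin m, Nontrivial ↥(conjSubgroup (g i) (factorSubgroup (J i)) ⊓ H)) ∧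
    ∀ (i : Fin m) (x : ↥(conjSubgroup (g i) (factorSubgroup (J i)) ⊓ H)),
      ((e.symm (CoprodI.of (i := Sum.inl i) x) : H) : CoprodI M) = (x : CoprodI M)

/-- A tree with an action of `G`, free on edges and at the root: edges are indexed by `G × I`, the
edge `(g, i)` joining `g • root` to `g • tip i`, and `path w` is the signed chain of edges
from the root to `w`. -/
structure FreeTree (G W I : Type) [Group G] [MulAction G W] where
  root : W
  tip : I → W
  path : W → (G × I →₀ ℤ)
  path_root : path root = 0
  path_smul : ∀ (g : G) (w : W) (u : G) (i : I),
    path (g • w) (u, i) = path (g • root) (u, i) + path w (g⁻¹ * u, i)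
  path_tip : ∀ i, path (tip i) = Finsupp.single (1, i) 1
  connected : ∀ S : Set W, root ∈ S → (∀ (g : G) (i : I), g • root ∈ S ↔ g • tip i ∈ S) →
    ∀ w, w ∈ S
  root_free : ∀ g : G, g • root = root → g = 1

namespace FreeTree

variable {G W I : Type} [Group G] [MulAction G W] (τ : FreeTree G W I)

/-- The initial vertex of an edge. -/
def init (e : G × I) : W := e.1 • τ.root

/-- The terminal vertex of an edge. -/
def term (e : G × I) : W := e.1 • τ.tip e.2

/-- The action of `G` on edges. -/
def act (g : G) (e : G × I) : G × I := (g * e.1, e.2)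

@[simp] lemma act_one (e : G × I) : act (1 : G) e = e := by simp [act]

@[simp] lemma act_act (g h : G) (e : G × I) : act g (act h e) = act (g * h) e := by
  simp [act, mul_assoc]

lemma eq_one_of_act_eq {g : G} {e : G × I} (h : act g e = e) : g = 1 := by
  have := congrArg Prod.fst h
  simpa [act] using this

lemma init_act (g : G) (e : G × I) : τ.init (act g e) = g • τ.init e := by
  simp [init, act, mul_smul]

lemma term_act (g : G) (e : G × I) : τ.term (act g e) = g • τ.term e := by
  simp [term, act, mul_smul]

lemma path_smul_apply (g : G) (w : W) (e : G × I) :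
    τ.path (g • w) e = τ.path (g • τ.root) e + τ.path w (act g⁻¹ e) :=
  τ.path_smul g w e.1 e.2

lemma path_sub_smul (g : G) (w r : W) (e : G × I) :
    τ.path (g • w) e - τ.path (g • r) e = τ.path w (act g⁻¹ e) - τ.path r (act g⁻¹ e) := by
  rw [τ.path_smul_apply g w, τ.path_smul_apply g r]; ring

lemma path_term (e : G × I) : τ.path (τ.term e) = τ.path (τ.init e) + Finsupp.single e 1 := by
  classical
  ext ⟨u, i⟩
  obtain ⟨g, j⟩ := e
  rw [term, init, τ.path_smul, τ.path_tip]
  simp only [Finsupp.add_apply, Finsupp.single_apply, Prod.mk.injEq, add_right_inj]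
  have : (1 = g⁻¹ * u) ↔ (g = u) := by rw [eq_inv_mul_iff_mul_eq, mul_one]
  simp only [this]

lemma induction_edges (r : W) (p : W → Prop) (h0 : p r)
    (he : ∀ e, p (τ.init e) ↔ p (τ.term e)) (w : W) : p w := by
  by_cases hr : p τ.root
  · exact τ.connected {w | p w} hr (fun g i => he (g, i)) w
  · exact absurd h0 (τ.connected {w | ¬ p w} hr (fun g i => not_congr (he (g, i))) r)

/-- `e` joins `w` and `w'`. -/
def Joins (e : G × I) (w w' : W) : Prop :=
  (τ.init e = w ∧ τ.term e = w') ∨ (τ.term e = w ∧ τ.init e = w')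

variable {τ} in
lemma Joins.symm {e : G × I} {w w' : W} (h : τ.Joins e w w') : τ.Joins e w' w := by
  rcases h with ⟨a, b⟩ | ⟨a, b⟩
  · exact .inr ⟨b, a⟩
  · exact .inl ⟨b, a⟩

variable {τ} in
lemma Joins.act {e : G × I} {w w' : W} (h : τ.Joins e w w') (g : G) :
    τ.Joins (act g e) (g • w) (g • w') := by
  rcases h with ⟨a, b⟩ | ⟨a, b⟩
  · exact .inl ⟨by rw [init_act, a], by rw [term_act, b]⟩
  · exact .inr ⟨by rw [term_act, a], by rw [init_act, b]⟩

variable {τ} in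
lemma Joins.path_eq {e f : G × I} {w w' : W} (h : τ.Joins e w w') (hf : f ≠ e) :
    τ.path w f = τ.path w' f := by
  classical
  have := congrArg (fun m => m f) (τ.path_term e)
  simp only [Finsupp.add_apply, Finsupp.single_apply, if_neg hf.symm, add_zero] at this
  rcases h with ⟨rfl, rfl⟩ | ⟨rfl, rfl⟩
  · exact this.symm
  · exact this

variable {τ} in
lemma Joins.path_sub {e : G × I} {w w' : W} (h : τ.Joins e w w') :
    τ.path w e - τ.path w' e = 1 ∨ τ.path w e - τ.path w' e = -1 := by
  have := congrArg (fun m => m e) (τ.path_term e)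
  simp only [Finsupp.add_apply, Finsupp.single_eq_same] at this
  rcases h with ⟨rfl, rfl⟩ | ⟨rfl, rfl⟩
  · right; rw [this]; ring
  · left; rw [this]; ring

/-- The vertices reachable from `r` along at most `n` edges. -/
def Reach (r : W) : ℕ → W → Prop
  | 0, w => w = r
  | n + 1, w => Reach r n w ∨ ∃ e w', τ.Joins e w' w ∧ Reach r n w'

lemma exists_reach (r w : W) : ∃ n, τ.Reach r n w := by
  refine τ.induction_edges r (fun w => ∃ n, τ.Reach r n w) ⟨0, rfl⟩ (fun e => ⟨?_, ?_⟩) w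
  · rintro ⟨n, hn⟩; exact ⟨n + 1, .inr ⟨e, _, .inl ⟨rfl, rfl⟩, hn⟩⟩
  · rintro ⟨n, hn⟩; exact ⟨n + 1, .inr ⟨e, _, .inr ⟨rfl, rfl⟩, hn⟩⟩

open Classical in
/-- The distance from `r` to `w`. -/
noncomputable def depth (r w : W) : ℕ := Nat.find (τ.exists_reach r w)

lemma depth_le {r w : W} {n : ℕ} (h : τ.Reach r n w) : τ.depth r w ≤ n := by
  classical exact Nat.find_min' _ h

lemma exists_parent {r w : W} (h : w ≠ r) :
    ∃ (e : G × I) (w' : W), τ.Joins e w' w ∧ τ.depth r w' < τ.depth r w := by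
  classical
  have hs : τ.Reach r (τ.depth r w) w := Nat.find_spec (τ.exists_reach r w)
  rcases hd : τ.depth r w with _ | n
  · rw [hd] at hs; exact absurd hs h
  · rw [hd] at hs
    rcases hs with hs | ⟨e, w', hj, hr⟩
    · have := τ.depth_le hs; omega
    · exact ⟨e, w', hj, by have := τ.depth_le hr; omega⟩

open Classical in
/-- The first edge from `w ≠ r` towards `r`. -/
noncomputable def parEdge (r : W) {w : W} (h : w ≠ r) : G × I := (τ.exists_parent h).choose

/-- The neighbour of `w ≠ r` closer to `r`. -/
noncomputable def par (r : W) {w : W} (h : w ≠ r) : W := (τ.exists_parent h).choose_spec.choose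

lemma joins_parEdge {r w : W} (h : w ≠ r) : τ.Joins (τ.parEdge r h) (τ.par r h) w :=
  (τ.exists_parent h).choose_spec.choose_spec.1

lemma depth_par_lt {r w : W} (h : w ≠ r) : τ.depth r (τ.par r h) < τ.depth r w :=
  (τ.exists_parent h).choose_spec.choose_spec.2

lemma par_ne {r w : W} (h : w ≠ r) : τ.par r h ≠ w := by
  intro h'; have := τ.depth_par_lt h; rw [h'] at this; omega

lemma depth_le_of_mem_path {r w : W} {e : G × I} (h : τ.path w e ≠ τ.path r e) :
    τ.depth r (τ.init e) ≤ τ.depth r w ∧ τ.depth r (τ.term e) ≤ τ.depth r w := by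
  induction hn : τ.depth r w using Nat.strong_induction_on generalizing w with
  | _ n ih =>
    have hw : w ≠ r := by rintro rfl; exact h rfl
    have hj := τ.joins_parEdge hw
    have hd := τ.depth_par_lt hw
    by_cases he : e = τ.parEdge r hw
    · subst hn
      rcases hj with ⟨a, b⟩ | ⟨a, b⟩ <;> rw [← he] at a b <;> rw [a, b] <;> omega
    · have := ih _ (by omega) (w := τ.par r hw) (by rwa [hj.path_eq he]) rfl
      omega

lemma path_par_parEdge {r w : W} (h : w ≠ r) :
    τ.path (τ.par r h) (τ.parEdge r h) = τ.path r (τ.parEdge r h) := by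
  by_contra hc
  have h1 := τ.depth_le_of_mem_path hc
  have h2 := τ.depth_par_lt h
  rcases τ.joins_parEdge h with ⟨a, b⟩ | ⟨a, b⟩ <;> rw [a, b] at h1 <;> omega

lemma path_parEdge {r w : W} (h : w ≠ r) :
    τ.path w (τ.parEdge r h) - τ.path r (τ.parEdge r h) = 1 ∨
    τ.path w (τ.parEdge r h) - τ.path r (τ.parEdge r h) = -1 := by
  rw [← τ.path_par_parEdge h]
  exact (τ.joins_parEdge h).symm.path_sub

lemma path_parEdge_ne {r w : W} (h : w ≠ r) :
    τ.path w (τ.parEdge r h) ≠ τ.path r (τ.parEdge r h) := by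
  intro hc
  rcases τ.path_parEdge h with h' | h' <;> rw [hc, sub_self] at h' <;> simp at h'

/-- The only edge at `w` on the way from `r` to `w` is the parent edge. -/
lemma eq_parEdge {r w v : W} {e : G × I} (hj : τ.Joins e v w) (h : τ.path w e ≠ τ.path r e) :
    ∃ hw : w ≠ r, e = τ.parEdge r hw ∧ v = τ.par r hw := by
  have hw : w ≠ r := by rintro rfl; exact h rfl
  have hp := τ.joins_parEdge hw
  have hd := τ.depth_par_lt hw
  have he : e = τ.parEdge r hw := by
    by_contra he
    rw [← hp.path_eq he] at h
    have h1 := τ.depth_le_of_mem_path h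
    rcases hj with ⟨a, b⟩ | ⟨a, b⟩ <;> rw [a, b] at h1 <;> omega
  refine ⟨hw, he, ?_⟩
  have hne := τ.par_ne hw
  subst he
  rcases hj with ⟨a, b⟩ | ⟨a, b⟩ <;> rcases hp with ⟨c, d⟩ | ⟨c, d⟩
  · rw [← a, ← c]
  · exact absurd (c.symm.trans b) hne
  · exact absurd (c.symm.trans b) hne
  · rw [← a, ← c]

lemma edge_cases (r : W) (e : G × I) :
    (∃ h : τ.term e ≠ r, e = τ.parEdge r h ∧ τ.init e = τ.par r h) ∨
    (∃ h : τ.init e ≠ r, e = τ.parEdge r h ∧ τ.term e = τ.par r h) := by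
  by_cases h : τ.path (τ.term e) e = τ.path r e
  · right
    refine τ.eq_parEdge (.inr ⟨rfl, rfl⟩) ?_
    intro h'
    have := congrArg (fun m => m e) (τ.path_term e)
    simp [h, h'] at this
  · left
    exact τ.eq_parEdge (.inl ⟨rfl, rfl⟩) h

lemma unique_fix (τ : FreeTree G W I) {g : G} {w w' : W} (h : w ≠ w') (hw : g • w = w) (hw' : g • w' = w') :
    g = 1 := by
  have hne := τ.path_parEdge_ne h
  have hj := (τ.joins_parEdge h).act g
  rw [hw] at hj
  have := τ.path_sub_smul g w w' (act g (τ.parEdge w' h))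
  rw [hw, hw'] at this
  simp only [act_act, inv_mul_cancel, act_one] at this
  obtain ⟨_, h1, _⟩ := τ.eq_parEdge (r := w') hj (fun h' => hne (by
    rw [h', sub_self] at this; omega))
  exact eq_one_of_act_eq h1

end FreeTree

/-- `G` is the free product of the subgroups `A i` and of the free group on the `x j`. -/
structure IsDecomp {G ι κ : Type} [Group G] (A : ι → Subgroup G) (x : κ → G) : Prop where
  gen : ∀ K : Subgroup G, (∀ i, A i ≤ K) → (∀ j, x j ∈ K) → K = ⊤
  lift : ∀ (L : Type) [Group L] (f : ∀ i, A i →* L) (y : κ → L),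
    ∃ F : G →* L, (∀ i (q : A i), F q = f i q) ∧ ∀ j, F (x j) = y j

namespace FreeTree

variable {G W I : Type} [Group G] [MulAction G W] (τ : FreeTree G W I)

lemma exists_recursion {X : Type*} (r : W) (base : X) (step : ∀ w : W, w ≠ r → X → X) :
    ∃ l : W → X, l r = base ∧ ∀ (w : W) (h : w ≠ r), l w = step w h (l (τ.par r h)) := by
  classical
  have wf : WellFounded (fun a b : W => τ.depth r a < τ.depth r b) :=
    InvImage.wf (τ.depth r) Nat.lt_wfRel.wf
  let Fx : ∀ w : W, (∀ v : W, τ.depth r v < τ.depth r w → X) → X := fun w ih =>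
    if h : w = r then base else step w h (ih (τ.par r h) (τ.depth_par_lt h))
  refine ⟨wf.fix Fx, ?_, fun w h => ?_⟩
  · rw [wf.fix_eq]; simp [Fx]
  · rw [wf.fix_eq]; simp [Fx, h]

/-- A choice of orbit representatives for the action of `H` on vertices and edges, together with
the elements of `H` comparing them. -/
structure OrbitFrame (H : Subgroup G) where
  rep : W → W
  rep_smul : ∀ (h : H) w, rep ((h : G) • w) = rep w
  exists_smul_rep : ∀ w, ∃ h : H, (h : G) • rep w = w
  rep_root : rep τ.root = τ.root
  edgeElt : G × I → H
  edgeElt_act : ∀ (h : H) e, edgeElt (act (h : G) e) = h * edgeElt e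
  twist : G × I → H
  twist_act : ∀ (h : H) e, twist (act (h : G) e) = twist e
  edgeElt_smul : ∀ e, (edgeElt e : G) • rep (τ.init e) = τ.init e
  edgeElt_twist_smul : ∀ e, ((edgeElt e * twist e : H) : G) • rep (τ.term e) = τ.term e

namespace OrbitFrame

variable {τ} {H : Subgroup G} (o : τ.OrbitFrame H) {L : Type} [Group L]

/-- A multivalued development of the tree in the group `L`. -/
structure IsDev (f : W → H → L) (y : G × I → L) (l : W → H → L) : Prop where
  mul_stab : ∀ (w : W) (h a : H), (h : G) • o.rep w = w → (a : G) • o.rep w = o.rep w →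
    l w (h * a) = l w h * f (o.rep w) a
  edge : ∀ e, l (τ.term e) (o.edgeElt e * o.twist e) = l (τ.init e) (o.edgeElt e) * y e
  root : l τ.root 1 = 1

lemma smul_rep_unique {w : W} {h h' : H} (hh : (h : G) • o.rep w = w)
    (hh' : (h' : G) • o.rep w = w) : ((h⁻¹ * h' : H) : G) • o.rep w = o.rep w := by
  push_cast
  rw [mul_smul, hh', inv_smul_eq_iff, hh]

lemma exists_dev (f : W → H → L)
    (hf : ∀ w (a b : H), (a : G) • w = w → (b : G) • w = w → f w (a * b) = f w a * f w b)
    (y : G × I → L) : ∃ l, o.IsDev f y l := by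
  classical
  have f1 : ∀ w, f w 1 = 1 := fun w => by
    have := hf w 1 1 (by simp) (by simp)
    simpa using this
  obtain ⟨l, h0, hs⟩ := τ.exists_recursion (X := H → L) τ.root (fun h => f τ.root h)
    (fun w hw p h => if τ.init (τ.parEdge τ.root hw) = τ.par τ.root hw then
      p (o.edgeElt (τ.parEdge τ.root hw)) * y (τ.parEdge τ.root hw) *
        f (o.rep w) ((o.edgeElt (τ.parEdge τ.root hw) * o.twist (τ.parEdge τ.root hw))⁻¹ * h)
      else p (o.edgeElt (τ.parEdge τ.root hw) * o.twist (τ.parEdge τ.root hw)) *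
        (y (τ.parEdge τ.root hw))⁻¹ *
        f (o.rep w) ((o.edgeElt (τ.parEdge τ.root hw))⁻¹ * h))
  refine ⟨l, ?_, ?_, ?_⟩
  · intro w h a hh ha
    by_cases hw : w = τ.root
    · subst hw
      rw [o.rep_root] at *
      simp only [h0]
      exact hf _ _ _ hh ha
    · simp only [hs w hw]
      have hj := τ.joins_parEdge hw
      set e := τ.parEdge τ.root hw
      split_ifs with hi
      · have ht : τ.term e = w := by
          rcases hj with ⟨_, b⟩ | ⟨b, c⟩
          · exact b
          · exact absurd (hi.symm.trans c) (τ.par_ne hw)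
        have h1 := o.edgeElt_twist_smul e
        rw [ht] at h1
        rw [← mul_assoc, hf _ _ _ (o.smul_rep_unique h1 hh) ha, mul_assoc, mul_assoc, mul_assoc]
      · have ht : τ.init e = w := by
          rcases hj with ⟨a, b⟩ | ⟨b, c⟩
          · exact absurd a hi
          · exact c
        have h1 := o.edgeElt_smul e
        rw [ht] at h1
        rw [← mul_assoc, hf _ _ _ (o.smul_rep_unique h1 hh) ha, mul_assoc, mul_assoc, mul_assoc]
  · intro e
    rcases τ.edge_cases τ.root e with ⟨h, he, hp⟩ | ⟨h, he, hp⟩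
    · rw [hs _ h, ← he]
      beta_reduce
      rw [if_pos hp, ← hp, inv_mul_cancel, f1, mul_one]
    · have hn : τ.init e ≠ τ.par τ.root h := (τ.par_ne h).symm
      rw [hs _ h, ← he]
      beta_reduce
      rw [if_neg hn, ← hp, inv_mul_cancel, f1]
      simp
  · rw [h0]; exact f1 _

variable {o} in
lemma IsDev.unique {f : W → H → L} {y : G × I → L} {l l' : W → H → L} (hl : o.IsDev f y l)
    (hl' : o.IsDev f y l') (w : W) : ∀ h : H, (h : G) • o.rep w = w → l w h = l' w h := by
  have key : ∀ (w : W) (h₁ : H), (h₁ : G) • o.rep w = w → l w h₁ = l' w h₁ →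
      ∀ h : H, (h : G) • o.rep w = w → l w h = l' w h := by
    intro w h₁ hh₁ heq h hh
    have ha := o.smul_rep_unique hh₁ hh
    have e1 := hl.mul_stab w h₁ _ hh₁ ha
    have e2 := hl'.mul_stab w h₁ _ hh₁ ha
    rw [mul_inv_cancel_left] at e1 e2
    rw [e1, e2, heq]
  refine τ.induction_edges τ.root (fun w => ∀ h : H, (h : G) • o.rep w = w → l w h = l' w h)
    ?_ ?_ w
  · exact key _ 1 (by rw [o.rep_root]; simp) (by rw [hl.root, hl'.root])
  · intro e
    have hb : l (τ.term e) (o.edgeElt e * o.twist e) = l' (τ.term e) (o.edgeElt e * o.twist e) ↔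
        l (τ.init e) (o.edgeElt e) = l' (τ.init e) (o.edgeElt e) := by
      rw [hl.edge, hl'.edge, mul_left_inj]
    constructor
    · intro h
      exact key _ _ (o.edgeElt_twist_smul e) (hb.2 (h _ (o.edgeElt_smul e)))
    · intro h
      exact key _ _ (o.edgeElt_smul e) (hb.1 (h _ (o.edgeElt_twist_smul e)))

variable {o} in
lemma IsDev.smul {f : W → H → L} {y : G × I → L} (hy : ∀ (h : H) e, y (act (h : G) e) = y e)
    {l : W → H → L} (hl : o.IsDev f y l) (g : H) (w : W) (h : H) (hh : (h : G) • o.rep w = w) :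
    l ((g : G) • w) (g * h) = l ((g : G) • τ.root) g * l w h := by
  have : o.IsDev f y (fun w h => (l ((g : G) • τ.root) g)⁻¹ * l ((g : G) • w) (g * h)) := by
    refine ⟨?_, ?_, ?_⟩
    · intro w h a hh ha
      rw [← mul_assoc, hl.mul_stab _ (g * h) a ?_ ?_, o.rep_smul, mul_assoc]
      · rw [o.rep_smul]; push_cast; rw [mul_smul, hh]
      · rw [o.rep_smul, ha]
    · intro e
      have := hl.edge (act (g : G) e)
      rw [o.edgeElt_act, o.twist_act, hy, term_act, init_act] at this
      rw [← mul_assoc g, this, mul_assoc]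
    · simp
  have := this.unique hl w h hh
  rw [← this, mul_inv_cancel_left]

variable {o} in
/-- The homomorphism obtained from a development. -/
def IsDev.hom {f : W → H → L} {y : G × I → L} (hy : ∀ (h : H) e, y (act (h : G) e) = y e)
    {l : W → H → L} (hl : o.IsDev f y l) : H →* L :=
  MonoidHom.mk' (fun h => l ((h : G) • τ.root) h) (fun g h => by
    have := hl.smul hy g ((h : G) • τ.root) h (by rw [o.rep_smul, o.rep_root])
    rw [← mul_smul] at this
    exact this)

end OrbitFrame
end FreeTree

namespace FreeTree

variable {G W I : Type} [Group G] [MulAction G W] (τ : FreeTree G W I)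

lemma exists_transversal (H : Subgroup G) : ∃ S : Set W, τ.root ∈ S ∧
    (∀ s ∈ S, ∀ h : s ≠ τ.root, τ.par τ.root h ∈ S) ∧
    (∀ s ∈ S, ∀ s' ∈ S, ∀ h : H, (h : G) • s = s' → s = s') ∧
    ∀ w, ∃ h : H, ∃ s ∈ S, (h : G) • s = w := by
  let F : Set (Set W) := {S | τ.root ∈ S ∧ (∀ s ∈ S, ∀ h : s ≠ τ.root, τ.par τ.root h ∈ S) ∧
    (∀ s ∈ S, ∀ s' ∈ S, ∀ h : H, (h : G) • s = s' → s = s')}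
  obtain ⟨S, -, hS⟩ := zorn_subset_nonempty F (by
    intro c hc hch hne
    refine ⟨⋃₀ c, ⟨?_, ?_, ?_⟩, fun s hs => Set.subset_sUnion_of_mem hs⟩
    · obtain ⟨t, ht⟩ := hne
      exact ⟨t, ht, (hc ht).1⟩
    · rintro s ⟨t, ht, hst⟩ h
      exact ⟨t, ht, (hc ht).2.1 s hst h⟩
    · rintro s ⟨t, ht, hst⟩ s' ⟨t', ht', hst'⟩ h hh
      rcases hch.total ht ht' with hle | hle
      · exact (hc ht').2.2 s (hle hst) s' hst' h hh
      · exact (hc ht).2.2 s hst s' (hle hst') h hh) {τ.root}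
    ⟨rfl, by rintro s rfl h; exact absurd rfl h, by rintro s rfl s' rfl h _; rfl⟩
  obtain ⟨h1, h2, h3⟩ := hS.1
  refine ⟨S, h1, h2, h3, ?_⟩
  have extend : ∀ (t : W) (ht : t ≠ τ.root), τ.par τ.root ht ∈ S →
      ∃ h : H, ∃ s ∈ S, (h : G) • s = t := by
    intro t ht hp
    by_contra hc
    have hmem : insert t S ∈ F := by
      refine ⟨Or.inr h1, ?_, ?_⟩
      · rintro s (rfl | hs) h
        · exact Or.inr hp
        · exact Or.inr (h2 s hs h)
      · rintro s (rfl | hs) s' (rfl | hs') h hh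
        · rfl
        · exact absurd ⟨h⁻¹, s', hs', by rw [← hh]; simp⟩ hc
        · exact absurd ⟨h, s, hs, hh⟩ hc
        · exact h3 s hs s' hs' h hh
    have := hS.2 hmem (Set.subset_insert t S) (Set.mem_insert t S)
    exact hc ⟨1, t, this, by simp⟩
  have smul_mem : ∀ (g : H) (t : W), (∃ h : H, ∃ s ∈ S, (h : G) • s = t) →
      ∃ h : H, ∃ s ∈ S, (h : G) • s = (g : G) • t := by
    rintro g t ⟨h, s, hs, rfl⟩
    exact ⟨g * h, s, hs, by push_cast; rw [mul_smul]⟩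
  refine τ.induction_edges τ.root _ ⟨1, _, h1, by simp⟩ (fun e => ⟨?_, ?_⟩)
  · rintro ⟨h, s, hs, hh⟩
    have hi : τ.init (act ((h⁻¹ : H) : G) e) = s := by
      rw [init_act, ← hh]; simp
    have ht : τ.term e = (h : G) • τ.term (act ((h⁻¹ : H) : G) e) := by
      rw [term_act]; simp
    rw [ht]
    apply smul_mem
    rcases τ.edge_cases τ.root (act ((h⁻¹ : H) : G) e) with ⟨a, _, c⟩ | ⟨a, _, c⟩
    · exact extend _ a (by rw [← c, hi]; exact hs)
    · rw [c]
      refine ⟨1, _, h2 _ (by rw [hi]; exact hs) a, by simp⟩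
  · rintro ⟨h, s, hs, hh⟩
    have hi : τ.term (act ((h⁻¹ : H) : G) e) = s := by
      rw [term_act, ← hh]; simp
    have ht : τ.init e = (h : G) • τ.init (act ((h⁻¹ : H) : G) e) := by
      rw [init_act]; simp
    rw [ht]
    apply smul_mem
    rcases τ.edge_cases τ.root (act ((h⁻¹ : H) : G) e) with ⟨a, _, c⟩ | ⟨a, _, c⟩
    · rw [c]
      refine ⟨1, _, h2 _ (by rw [hi]; exact hs) a, by simp⟩
    · exact extend _ a (by rw [← c, hi]; exact hs)

lemma exists_orbitFrame (H : Subgroup G) : ∃ (o : τ.OrbitFrame H) (S : Set W) (Q : Type)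
    (cls : G × I → Q) (er : Q → G × I), τ.root ∈ S ∧
    (∀ s ∈ S, ∀ h : s ≠ τ.root, τ.par τ.root h ∈ S) ∧
    (∀ s ∈ S, o.rep s = s) ∧ (∀ w, o.rep w ∈ S) ∧
    (∀ e, act (o.edgeElt e : G) (er (cls e)) = e) ∧
    (∀ (h : H) e, cls (act (h : G) e) = cls e) ∧ (∀ q, cls (er q) = q) ∧
    (∀ q, τ.init (er q) ∈ S) ∧
    (∀ s ∈ S, ∀ h : s ≠ τ.root, er (cls (τ.parEdge τ.root h)) = τ.parEdge τ.root h ∧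
      o.twist (τ.parEdge τ.root h) = 1) ∧
    (∀ s ∈ S, ∀ h : s ≠ τ.root, ∀ s' ∈ S, ∀ h' : s' ≠ τ.root,
      cls (τ.parEdge τ.root h) = cls (τ.parEdge τ.root h') → s = s') := by
  obtain ⟨S, h1, h2, h3, h4⟩ := τ.exists_transversal H
  choose hw rep hrep hsmul using h4
  have rep_mem_eq : ∀ s ∈ S, rep s = s := fun s hs => h3 _ (hrep s) s hs _ (hsmul s)
  have rep_smul : ∀ (h : H) w, rep ((h : G) • w) = rep w := by
    intro h w
    refine h3 _ (hrep _) _ (hrep w) ((hw w)⁻¹ * h⁻¹ * hw ((h : G) • w)) ?_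
    push_cast
    rw [mul_smul, hsmul, mul_smul, inv_smul_smul, inv_smul_eq_iff, hsmul]
  let r : Setoid (G × I) := ⟨fun e e' => ∃ h : H, act (h : G) e = e', ⟨fun e => ⟨1, by simp⟩, by
    rintro e _ ⟨h, rfl⟩; exact ⟨h⁻¹, by simp⟩, by
    rintro e _ _ ⟨h, rfl⟩ ⟨h', rfl⟩; exact ⟨h' * h, by simp⟩⟩⟩
  let T : G × I → Prop := fun e => ∃ s ∈ S, ∃ h : s ≠ τ.root, e = τ.parEdge τ.root h
  have init_T : ∀ e, T e → τ.init e ∈ S ∧ τ.term e ∈ S := by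
    rintro e ⟨s, hs, h, rfl⟩
    have hp := h2 s hs h
    rcases τ.joins_parEdge h with ⟨a, b⟩ | ⟨a, b⟩ <;> rw [a, b] <;> exact ⟨by assumption, by assumption⟩
  have T_inj : ∀ s ∈ S, ∀ h : s ≠ τ.root, ∀ s' ∈ S, ∀ h' : s' ≠ τ.root, ∀ g : H,
      act (g : G) (τ.parEdge τ.root h) = τ.parEdge τ.root h' → s = s' := by
    intro s hs h s' hs' h' g hg
    have hp := h2 s hs h
    have hp' := h2 s' hs' h'
    have j1 := (τ.joins_parEdge h).act (g : G)
    have j2 := τ.joins_parEdge h'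
    rw [hg] at j1
    have d1 := τ.depth_par_lt h
    have d2 := τ.depth_par_lt h'
    rcases j1 with ⟨a, b⟩ | ⟨a, b⟩ <;> rcases j2 with ⟨c, d⟩ | ⟨c, d⟩
    · exact h3 _ hs _ hs' g (b.symm.trans d)
    · have e1 := h3 _ hp _ hs' g (a.symm.trans d)
      have e2 := h3 _ hs _ hp' g (b.symm.trans c)
      rw [e1] at d1; rw [← e2] at d2; omega
    · have e1 := h3 _ hp _ hs' g (a.symm.trans d)
      have e2 := h3 _ hs _ hp' g (b.symm.trans c)
      rw [e1] at d1; rw [← e2] at d2; omega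
    · exact h3 _ hs _ hs' g (b.symm.trans d)
  have her : ∀ q : Quotient r, ∃ e, Quotient.mk r e = q ∧ τ.init e ∈ S ∧
      ∀ e', T e' → Quotient.mk r e' = q → T e := by
    intro q
    by_cases hq : ∃ e', T e' ∧ Quotient.mk r e' = q
    · obtain ⟨e', hT, hq⟩ := hq
      exact ⟨e', hq, (init_T _ hT).1, fun _ _ _ => hT⟩
    · obtain ⟨e, rfl⟩ := Quotient.exists_rep q
      refine ⟨act (((hw (τ.init e))⁻¹ : H) : G) e, ?_, ?_, fun e' h h' => absurd ⟨e', h, h'⟩ hq⟩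
      · exact Quotient.sound ⟨hw (τ.init e), by simp⟩
      · rw [init_act]
        have := hsmul (τ.init e)
        have h5 : rep (τ.init e) = (((hw (τ.init e))⁻¹ : H) : G) • τ.init e := by
          push_cast
          rw [eq_inv_smul_iff, this]
        rw [← h5]; exact hrep _
  choose er er_mk er_init er_T using her
  have helt : ∀ e, ∃ h : H, act (h : G) (er (Quotient.mk r e)) = e := fun e =>
    Quotient.exact (er_mk (Quotient.mk r e))
  choose elt helt using helt
  have hk : ∀ q, ∃ k : H, (k : G) • rep (τ.term (er q)) = τ.term (er q) ∧ (T (er q) → k = 1) := by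
    intro q
    by_cases hT : T (er q)
    · exact ⟨1, by rw [rep_mem_eq _ (init_T _ hT).2]; simp, fun _ => rfl⟩
    · exact ⟨_, hsmul _, fun h => absurd h hT⟩
  choose k hk kT using hk
  have mk_act : ∀ (h : H) e, Quotient.mk r (act (h : G) e) = Quotient.mk r e := fun h e =>
    Quotient.sound ⟨h⁻¹, by simp⟩
  have er_par : ∀ s ∈ S, ∀ h : s ≠ τ.root,
      er (Quotient.mk r (τ.parEdge τ.root h)) = τ.parEdge τ.root h := by
    intro s hs h
    obtain ⟨s', hs', h', he⟩ := er_T (Quotient.mk r (τ.parEdge τ.root h)) _ ⟨s, hs, h, rfl⟩ rfl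
    obtain ⟨g, hg⟩ := Quotient.exact (er_mk (Quotient.mk r (τ.parEdge τ.root h)))
    rw [he] at hg
    have := T_inj _ hs' h' _ hs h g hg
    subst this
    exact he
  refine ⟨⟨rep, rep_smul, fun w => ⟨_, hsmul w⟩, rep_mem_eq _ h1, elt, ?_, fun e => k (Quotient.mk r e),
    ?_, ?_, ?_⟩, S, Quotient r, Quotient.mk r, er, h1, h2, rep_mem_eq, hrep, helt, mk_act, er_mk,
    er_init, ?_, ?_⟩
  · intro h e
    have a1 := helt (act (h : G) e)
    have a2 := congrArg (act (h : G)) (helt e)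
    rw [mk_act] at a1
    rw [act_act] at a2
    have := congrArg Prod.fst (a1.trans a2.symm)
    exact Subtype.ext (mul_right_cancel this)
  · intro h e
    rw [mk_act]
  · intro e
    conv_lhs => rw [← helt e, init_act]
    have : (elt (act (elt e : G) (er (Quotient.mk r e)))) = elt e := by rw [helt]
    rw [this, rep_smul, rep_mem_eq _ (er_init _), ← init_act, helt]
  · intro e
    have h5 : τ.term e = (elt e : G) • τ.term (er (Quotient.mk r e)) := by rw [← term_act, helt]
    push_cast
    rw [h5, rep_smul, mul_smul, hk]
  · intro s hs h
    exact ⟨er_par s hs h, kT _ (by rw [er_par s hs h]; exact ⟨s, hs, h, rfl⟩)⟩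
  · intro s hs h s' hs' h' hq
    obtain ⟨g, hg⟩ := Quotient.exact hq
    exact T_inj s hs h s' hs' h' g hg
end FreeTree

namespace FreeTree

variable {G W I : Type} [Group G] [MulAction G W] (τ : FreeTree G W I)

lemma path_support_of_parentClosed {S : Set W}
    (hS : ∀ s ∈ S, ∀ h : s ≠ τ.root, τ.par τ.root h ∈ S) (s : W) (hs : s ∈ S) (e : G × I)
    (he : τ.path s e ≠ 0) : ∃ t ∈ S, ∃ h : t ≠ τ.root, e = τ.parEdge τ.root h ∧
      (t = s ∨ τ.depth τ.root t < τ.depth τ.root s) := by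
  induction hn : τ.depth τ.root s using Nat.strong_induction_on generalizing s with
  | _ n ih =>
    have h : s ≠ τ.root := by rintro rfl; exact he (by rw [τ.path_root]; rfl)
    by_cases hp : e = τ.parEdge τ.root h
    · exact ⟨s, hs, h, hp, .inl rfl⟩
    · have hd := τ.depth_par_lt h
      obtain ⟨t, ht, h', he', hlt⟩ := ih _ (by omega) _ (hS s hs h)
        (by rwa [(τ.joins_parEdge h).path_eq hp]) rfl
      refine ⟨t, ht, h', he', .inr ?_⟩
      rcases hlt with rfl | hlt <;> omega

/-- The Kurosh subgroup theorem: a subgroup `H` is the free product of vertex stabilizers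
and a free group; the corresponding chains are unitriangular with respect to suitable edges. -/
theorem kurosh (H : Subgroup G) : ∃ (σ l : Type) (s : σ → W) (k : l → H)
    (E : σ ⊕ l → G × I) (rank : σ ⊕ l → ℕ∞),
    IsDecomp (fun a => (MulAction.stabilizer G (s a)).subgroupOf H) k ∧
    (∀ a, ∃ h ∈ H, h ≠ 1 ∧ h • s a = s a) ∧
    (∀ j j' (h : H), τ.path (Sum.elim s (fun q => (k q : G) • τ.root) j) (act (h : G) (E j')) ≠ 0 →
      rank j ≤ rank j' → j = j' ∧ h = 1) ∧
    ∀ j, τ.path (Sum.elim s (fun q => (k q : G) • τ.root) j) (E j) = 1 ∨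
      τ.path (Sum.elim s (fun q => (k q : G) • τ.root) j) (E j) = -1 := by
  classical
  obtain ⟨o, S, Q, cls, er, hroot, hpar, hrepS, hrepmem, helt, hcls, hclser, hinit, hpe, hinj⟩ :=
    τ.exists_orbitFrame H
  have elt_er : ∀ q, o.edgeElt (er q) = 1 := fun q => by
    have := helt (er q)
    rw [hclser] at this
    exact Subtype.ext (eq_one_of_act_eq this)
  have elt_pe : ∀ s ∈ S, ∀ h : s ≠ τ.root, o.edgeElt (τ.parEdge τ.root h) = 1 := fun s hs h => by
    have := helt (τ.parEdge τ.root h)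
    rw [(hpe s hs h).1] at this
    exact Subtype.ext (eq_one_of_act_eq this)
  let σ := {s : W // s ∈ S ∧ ∃ h ∈ H, h ≠ 1 ∧ h • s = s}
  let l := {q : Q // ∀ s ∈ S, ∀ h : s ≠ τ.root, cls (τ.parEdge τ.root h) ≠ q}
  have hσ : ∀ a : σ, a.1 ≠ τ.root := by
    rintro ⟨a, ha, h, hh, h1, h2⟩ (rfl : a = τ.root)
    exact h1 (τ.root_free h h2)
  have path_l : ∀ (q : l) e, τ.path ((o.twist (er q.1) : G) • τ.root) e =
      τ.path (τ.init (er q.1)) e + Finsupp.single (er q.1) 1 e -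
        τ.path (o.rep (τ.term (er q.1))) (act (o.twist (er q.1) : G)⁻¹ e) := by
    intro q e
    have h1 := o.edgeElt_twist_smul (er q.1)
    rw [elt_er, one_mul] at h1
    have h2 := τ.path_smul_apply (o.twist (er q.1) : G) (o.rep (τ.term (er q.1))) e
    rw [h1, τ.path_term, Finsupp.add_apply] at h2
    rw [h2]; ring
  have supp : ∀ s ∈ S, ∀ (h : H) (q : l), τ.path s (act (h : G) (er q.1)) = 0 := by
    intro s hs h q
    by_contra hc
    obtain ⟨t, ht, h', he', _⟩ := τ.path_support_of_parentClosed hpar s hs _ hc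
    refine q.2 t ht h' ?_
    rw [← he', hcls, hclser]
  refine ⟨σ, l, Subtype.val, fun q => o.twist (er q.1),
    Sum.elim (fun a => τ.parEdge τ.root (hσ a)) (fun q => er q.1),
    Sum.elim (fun a => (τ.depth τ.root a.1 : ℕ∞)) (fun _ => ⊤), ⟨?_, ?_⟩, fun a => a.2.2, ?_, ?_⟩
  · intro K hA hx
    have stab : ∀ s ∈ S, ∀ h : H, (h : G) • s = s → h ∈ K := by
      intro s hs h hh
      by_cases h1 : h = 1
      · rw [h1]; exact K.one_mem
      · exact hA ⟨s, hs, h, h.2, fun h' => h1 (Subtype.ext h'), hh⟩ hh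
    have key : ∀ (w : W) (h₁ : H), (h₁ : G) • o.rep w = w → h₁ ∈ K →
        ∀ h : H, (h : G) • o.rep w = w → h ∈ K := by
      intro w h₁ hh₁ hm h hh
      have := K.mul_mem hm (stab _ (hrepmem w) _ (o.smul_rep_unique hh₁ hh))
      rwa [mul_inv_cancel_left] at this
    have twist_mem : ∀ e, o.twist e ∈ K := by
      intro e
      have : o.twist e = o.twist (er (cls e)) := by
        conv_lhs => rw [← helt e]
        rw [o.twist_act]
      rw [this]
      by_cases hq : ∀ s ∈ S, ∀ h : s ≠ τ.root, cls (τ.parEdge τ.root h) ≠ cls e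
      · exact hx ⟨cls e, hq⟩
      · push Not at hq
        obtain ⟨s, hs, h, hh⟩ := hq
        rw [← hh, (hpe s hs h).1, (hpe s hs h).2]
        exact K.one_mem
    have main := τ.induction_edges τ.root (fun w => ∀ h : H, (h : G) • o.rep w = w → h ∈ K)
      (key _ 1 (by rw [o.rep_root]; simp) K.one_mem) (fun e => ⟨fun h => ?_, fun h => ?_⟩)
    · refine eq_top_iff.2 fun h _ => main ((h : G) • τ.root) h ?_
      rw [o.rep_smul, o.rep_root]
    · exact key _ _ (o.edgeElt_twist_smul e) (K.mul_mem (h _ (o.edgeElt_smul e)) (twist_mem e))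
    · refine key _ _ (o.edgeElt_smul e) ?_
      have := h _ (o.edgeElt_twist_smul e)
      rwa [K.mul_mem_cancel_right (twist_mem e)] at this
  · intro L _ f y
    let f' : W → H → L := fun w h => if hw : w ∈ S ∧ ∃ h ∈ H, h ≠ 1 ∧ h • w = w then
      (if hh : (h : G) • w = w then f ⟨w, hw⟩ ⟨h, hh⟩ else 1) else 1
    let y' : G × I → L := fun e =>
      if hq : ∀ s ∈ S, ∀ h : s ≠ τ.root, cls (τ.parEdge τ.root h) ≠ cls e then y ⟨cls e, hq⟩ else 1
    have hy' : ∀ (h : H) e, y' (act (h : G) e) = y' e := by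
      intro h e
      simp only [y', hcls]
    obtain ⟨d, hd⟩ := o.exists_dev f' (by
      intro w a b ha hb
      have hab : ((a * b : H) : G) • w = w := by push_cast; rw [mul_smul, hb, ha]
      simp only [f']
      by_cases hw : w ∈ S ∧ ∃ h ∈ H, h ≠ 1 ∧ h • w = w
      · rw [dif_pos hw, dif_pos hw, dif_pos hw, dif_pos hab, dif_pos ha, dif_pos hb, ← map_mul]
        rfl
      · rw [dif_neg hw, dif_neg hw, dif_neg hw, one_mul]) y'
    have d1 : ∀ s ∈ S, d s 1 = 1 := by
      intro s hs
      induction hn : τ.depth τ.root s using Nat.strong_induction_on generalizing s with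
      | _ n ih =>
        by_cases h : s = τ.root
        · rw [h]; exact hd.root
        · have h1 := ih _ (by rw [← hn]; exact τ.depth_par_lt h) _ (hpar s hs h) rfl
          have h2 := hd.edge (τ.parEdge τ.root h)
          have h3 : y' (τ.parEdge τ.root h) = 1 := by
            simp only [y']
            rw [dif_neg]
            intro hc
            exact hc s hs h rfl
          rw [elt_pe s hs h, (hpe s hs h).2, h3, one_mul, mul_one] at h2
          rcases τ.joins_parEdge h with ⟨a, b⟩ | ⟨a, b⟩
          · rw [← b, h2, a, h1]
          · rw [← b, ← h2, a, h1]
    have dF : ∀ s ∈ S, ∀ g : H, d ((g : G) • s) g = hd.hom hy' g := by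
      intro s hs g
      have := hd.smul hy' g s 1 (by rw [hrepS s hs]; simp)
      rw [mul_one, d1 s hs, mul_one] at this
      exact this
    refine ⟨hd.hom hy', ?_, ?_⟩
    · rintro ⟨s, hs⟩ ⟨q, hq⟩
      have hq' : (q : G) • s = s := hq
      have h1 := dF s hs.1 q
      rw [hq'] at h1
      have h2 := hd.mul_stab s 1 q (by rw [hrepS s hs.1]; simp) (by rw [hrepS s hs.1]; exact hq')
      rw [one_mul, d1 s hs.1, one_mul, hrepS s hs.1] at h2
      simp only
      rw [← h1, h2]
      simp only [f']
      rw [dif_pos hs, dif_pos hq']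
    · intro q
      have h1 := hd.edge (er q.1)
      rw [elt_er, one_mul, d1 _ (hinit _), one_mul] at h1
      have h2 := o.edgeElt_twist_smul (er q.1)
      rw [elt_er, one_mul] at h2
      rw [← dF _ (hrepmem (τ.term (er q.1))), h2, h1]
      simp only [y']
      have : ∀ s ∈ S, ∀ h : s ≠ τ.root, cls (τ.parEdge τ.root h) ≠ cls (er q.1) := by
        rw [hclser]; exact q.2
      rw [dif_pos this]
      congr 1
      exact Subtype.ext (hclser _)
  · rintro (a | q) (a' | q') h hne hr
    · simp only [Sum.elim_inl] at hne hr
      obtain ⟨t, ht, h', he', hlt⟩ := τ.path_support_of_parentClosed hpar a.1 a.2.1 _ hne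
      have h1 : a'.1 = t := hinj _ a'.2.1 (hσ a') t ht h' (by rw [← he', hcls])
      subst h1
      have hr' : τ.depth τ.root a.1 ≤ τ.depth τ.root a'.1 := by exact_mod_cast hr
      rcases hlt with h2 | h2
      · exact ⟨congrArg _ (Subtype.ext h2.symm), Subtype.ext (eq_one_of_act_eq he')⟩
      · omega
    · exact absurd (supp _ a.2.1 h q') hne
    · simp at hr
    · simp only [Sum.elim_inr] at hne
      have s2 := supp _ (hrepmem (τ.term (er q.1))) ((o.twist (er q.1))⁻¹ * h) q'
      push_cast at s2
      rw [← act_act] at s2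
      rw [path_l, supp _ (hinit _), s2, zero_add, sub_zero, Finsupp.single_apply] at hne
      have h1 : er q.1 = act (h : G) (er q'.1) := by
        by_contra hc; rw [if_neg hc] at hne; exact hne rfl
      have h2 : q = q' := by
        apply Subtype.ext
        have := congrArg cls h1
        rwa [hcls, hclser, hclser] at this
      subst h2
      exact ⟨rfl, Subtype.ext (eq_one_of_act_eq h1.symm)⟩
  · rintro (a | q)
    · have := τ.path_parEdge (hσ a)
      rw [τ.path_root] at this
      simpa using this
    · left
      simp only [Sum.elim_inr]
      have s1 := supp _ (hinit q.1) 1 q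
      have s2 := supp _ (hrepmem (τ.term (er q.1))) ((o.twist (er q.1))⁻¹) q
      push_cast at s2 s1
      rw [act_one] at s1
      rw [path_l, s1, s2]
      simp
end FreeTree

namespace FreeTree
variable {G W I : Type} [Group G]

/-- Left translation of edges as an equivalence. -/
def actEquiv (g : G) : G × I ≃ G × I where
  toFun := act g
  invFun := act g⁻¹
  left_inv e := by simp
  right_inv e := by simp

/-- The action of `G` on chains. -/
noncomputable def chainAct (g : G) : (G × I →₀ ℤ) ≃+ (G × I →₀ ℤ) :=
  Finsupp.domCongr (actEquiv g)

lemma chainAct_apply (g : G) (m : G × I →₀ ℤ) (e : G × I) :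
    chainAct g m e = m (act g⁻¹ e) := rfl

lemma chainAct_one (m : G × I →₀ ℤ) : chainAct 1 m = m := by
  ext e; simp [chainAct_apply]

lemma chainAct_mul (g h : G) (m : G × I →₀ ℤ) :
    chainAct (g * h) m = chainAct g (chainAct h m) := by
  ext e; simp [chainAct_apply]

lemma chainAct_single (g : G) (e : G × I) (n : ℤ) :
    chainAct g (Finsupp.single e n) = Finsupp.single (act g e) n := by
  change Finsupp.equivMapDomain _ _ = _
  rw [Finsupp.equivMapDomain_single]; rfl

/-- The action of `G` on the multiplicative group of chains. -/
noncomputable def chainMulAut : G →* MulAut (Multiplicative (G × I →₀ ℤ)) :=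
  MonoidHom.mk' (fun g => AddEquiv.toMultiplicative (chainAct g)) (fun g h => by
    ext m : 1
    exact congrArg Multiplicative.ofAdd (chainAct_mul g h m.toAdd))

end FreeTree

namespace IsDecomp
open FreeTree
variable {G ι κ : Type} [Group G] {A : ι → Subgroup G} {x : κ → G}

lemma hom_ext (hA : IsDecomp A x) {L : Type} [Group L] {F F' : G →* L}
    (h1 : ∀ i, ∀ q ∈ A i, F q = F' q) (h2 : ∀ j, F (x j) = F' (x j)) : F = F' := by
  have := hA.gen (F.eqLocus F') (fun i q hq => h1 i q hq) h2
  ext g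
  have hg : g ∈ F.eqLocus F' := by rw [this]; trivial
  exact hg

lemma exists_derivation (hA : IsDecomp A x) : ∃ δ : G → (G × (ι ⊕ κ) →₀ ℤ),
    (∀ g h, δ (g * h) = δ g + chainAct g (δ h)) ∧
    (∀ i, ∀ q ∈ A i, δ q + chainAct q (Finsupp.single (1, .inl i) 1) =
      Finsupp.single (1, .inl i) 1) ∧
    ∀ j, δ (x j) = Finsupp.single (1, .inr j) 1 := by
  let e : ι ⊕ κ → (G × (ι ⊕ κ) →₀ ℤ) := fun i => Finsupp.single (1, i) 1
  let Γ := Multiplicative (G × (ι ⊕ κ) →₀ ℤ) ⋊[chainMulAut] G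
  obtain ⟨F, h1, h2⟩ := hA.lift Γ
    (fun i => (MulAut.conj (SemidirectProduct.inl (Multiplicative.ofAdd (e (.inl i))) : Γ)).toMonoidHom.comp
      (SemidirectProduct.inr.comp (A i).subtype))
    (fun j => ⟨Multiplicative.ofAdd (e (.inr j)), x j⟩)
  have hr : SemidirectProduct.rightHom.comp F = MonoidHom.id G := by
    apply hA.hom_ext
    · intro i q hq
      have := h1 i ⟨q, hq⟩
      simp only at this
      simp [this]
    · intro j
      simp [h2]
  have hr' : ∀ g, (F g).right = g := fun g => DFunLike.congr_fun hr g
  refine ⟨fun g => (F g).left.toAdd, ?_, ?_, ?_⟩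
  · intro g h
    beta_reduce
    rw [map_mul, SemidirectProduct.mul_left, hr']
    rfl
  · intro i q hq
    have := h1 i ⟨q, hq⟩
    simp only at this
    beta_reduce
    rw [this]
    simp only [MonoidHom.comp_apply, MulEquiv.coe_toMonoidHom, MulAut.conj_apply,
      SemidirectProduct.mul_left, SemidirectProduct.mul_right, SemidirectProduct.left_inl,
      SemidirectProduct.right_inl, SemidirectProduct.left_inr, SemidirectProduct.right_inr,
      SemidirectProduct.inv_left, map_one, mul_one, one_mul,
      inv_one, Subgroup.coe_subtype, toAdd_mul, MulAut.one_apply]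
    have : ((chainMulAut q) (Multiplicative.ofAdd (e (.inl i)))⁻¹).toAdd =
      - chainAct q (e (.inl i)) := (chainAct q).map_neg _
    rw [this]
    simp [e]
  · intro j
    simp [h2, e]

/-- The vertices of the Bass-Serre tree of a free product decomposition. -/
abbrev Vertex {G ι : Type} [Group G] (A : ι → Subgroup G) : Type := G ⊕ Σ i : ι, G ⧸ A i

lemma smul_inr (g h : G) (i : ι) :
    g • (Sum.inr ⟨i, (h : G ⧸ A i)⟩ : Vertex A) = Sum.inr ⟨i, ((g * h : G) : G ⧸ A i)⟩ := rfl

lemma smul_inl (g h : G) : g • (Sum.inl h : Vertex A) = Sum.inl (g * h) := rfl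

/-- The Bass-Serre tree of a free product decomposition. -/
noncomputable def tree (hA : IsDecomp A x) : FreeTree G (Vertex A) (ι ⊕ κ) :=
  let δ := hA.exists_derivation.choose
  have hδ : (∀ g h, δ (g * h) = δ g + chainAct g (δ h)) ∧
      (∀ i, ∀ q ∈ A i, δ q + chainAct q (Finsupp.single (1, .inl i) 1) =
        Finsupp.single (1, .inl i) 1) ∧
      ∀ j, δ (x j) = Finsupp.single (1, .inr j) 1 := hA.exists_derivation.choose_spec
  have h1 : δ 1 = 0 := by
    have := hδ.1 1 1
    rw [mul_one, chainAct_one] at this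
    simpa using this
  have hc : ∀ (g : G) (i : ι), δ (g : G ⧸ A i).out +
      chainAct (g : G ⧸ A i).out (Finsupp.single (1, .inl i) 1) =
        δ g + chainAct g (Finsupp.single (1, .inl i) 1) := by
    intro g i
    obtain ⟨q, hq⟩ := QuotientGroup.mk_out_eq_mul (A i) g
    rw [hq, hδ.1, chainAct_mul, add_assoc, ← map_add, hδ.2.1 i q q.2]
  { root := Sum.inl 1
    tip := Sum.elim (fun i => Sum.inr ⟨i, ((1 : G) : G ⧸ A i)⟩) (fun j => Sum.inl (x j))
    path := Sum.elim δ (fun c => δ c.2.out + chainAct c.2.out (Finsupp.single (1, .inl c.1) 1))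
    path_root := h1
    path_smul := by
      rintro g (h | ⟨i, c⟩) u j
      · rw [smul_inl, smul_inl]
        simp only [Sum.elim_inl, mul_one]
        rw [hδ.1]; rfl
      · obtain ⟨h, rfl⟩ := QuotientGroup.mk_surjective c
        rw [smul_inl, smul_inr]
        simp only [Sum.elim_inl, Sum.elim_inr, mul_one]
        rw [hc, hc, hδ.1, chainAct_mul, add_assoc, ← map_add]; rfl
    path_tip := by
      rintro (i | j)
      · simp only [Sum.elim_inl, Sum.elim_inr]
        rw [hc, h1, chainAct_one, zero_add]
      · exact hδ.2.2 j
    connected := by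
      intro S h0 hS
      have hK : ∀ k g : G, Sum.inl g ∈ S ↔ Sum.inl (g * k) ∈ S := by
        let K : Subgroup G :=
          { carrier := {k | ∀ g : G, Sum.inl g ∈ S ↔ Sum.inl (g * k) ∈ S}
            one_mem' := fun g => by rw [mul_one]
            mul_mem' := fun {a b} ha hb g => by rw [ha g, hb (g * a), mul_assoc]
            inv_mem' := fun {a} ha g => by
              rw [ha (g * a⁻¹), inv_mul_cancel_right] }
        have hK : K = ⊤ := by
          refine hA.gen K (fun i q hq g => ?_) (fun j g => ?_)
          · have e1 := hS g (.inl i)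
            have e2 := hS (g * q) (.inl i)
            simp only [Sum.elim_inl, smul_inl, smul_inr, mul_one] at e1 e2
            rw [e1, e2]
            have : ((g * q : G) : G ⧸ A i) = g := by
              rw [QuotientGroup.eq]; simpa using hq
            rw [this]
          · have e1 := hS g (.inr j)
            simpa only [Sum.elim_inr, smul_inl, mul_one] using e1
        intro k
        have : k ∈ K := by rw [hK]; trivial
        exact this
      have hl : ∀ g : G, Sum.inl g ∈ S := fun g => by
        have := hK g 1
        rw [one_mul] at this
        exact this.1 h0
      rintro (g | ⟨i, c⟩)
      · exact hl g
      · obtain ⟨h, rfl⟩ := QuotientGroup.mk_surjective c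
        have := hS h (.inl i)
        simp only [Sum.elim_inl, smul_inl, smul_inr, mul_one] at this
        exact this.1 (hl h)
    root_free := fun g hg => by
      rw [smul_inl, mul_one] at hg
      exact Sum.inl_injective hg }

@[simp] lemma tree_root (hA : IsDecomp A x) : hA.tree.root = Sum.inl 1 := rfl

@[simp] lemma tree_tip_inl (hA : IsDecomp A x) (i : ι) :
    hA.tree.tip (.inl i) = Sum.inr ⟨i, ((1 : G) : G ⧸ A i)⟩ := rfl

@[simp] lemma tree_tip_inr (hA : IsDecomp A x) (j : κ) :
    hA.tree.tip (.inr j) = Sum.inl (x j) := rfl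

lemma smul_inr_eq_iff (g h : G) (i : ι) :
    g • (Sum.inr ⟨i, (h : G ⧸ A i)⟩ : Vertex A) = Sum.inr ⟨i, (h : G ⧸ A i)⟩ ↔
      h⁻¹ * g * h ∈ A i := by
  rw [smul_inr]
  simp only [Sum.inr.injEq, Sigma.mk.injEq, heq_eq_eq, true_and]
  rw [eq_comm, QuotientGroup.eq, mul_assoc]

end IsDecomp

section Slender

open scoped commutatorElement

/-- Every subgroup of the group is finitely generated. -/
def IsSlender (G : Type*) [Group G] : Prop := ∀ K : Subgroup G, K.FG

lemma IsSlender.of_fg_comm {G : Type*} [CommGroup G] [Group.FG G] : IsSlender G := by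
  intro K
  have : Module.Finite ℤ (Additive G) := Module.Finite.iff_addGroup_fg.2 inferInstance
  have : IsNoetherian ℤ (Additive G) := isNoetherian_of_isNoetherianRing_of_finite ℤ _
  rw [Subgroup.fg_iff_add_fg]
  have := (IsNoetherian.noetherian (AddSubgroup.toIntSubmodule K.toAddSubgroup))
  rw [Submodule.fg_iff_addSubgroup_fg] at this
  simpa using this

lemma IsSlender.of_surjective {G H : Type*} [Group G] [Group H] (hG : IsSlender G) (f : G →* H)
    (hf : Function.Surjective f) : IsSlender H := by
  classical
  intro K
  obtain ⟨S, hS⟩ := hG (K.comap f)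
  refine ⟨S.image f, ?_⟩
  rw [Finset.coe_image, ← MonoidHom.map_closure, hS, Subgroup.map_comap_eq_self_of_surjective hf]

lemma IsSlender.of_injective {G H : Type*} [Group G] [Group H] (hG : IsSlender G) (f : H →* G)
    (hf : Function.Injective f) : IsSlender H := by
  intro K
  have h1 : Group.FG (K.map f) := (Group.fg_iff_subgroup_fg _).2 (hG (K.map f))
  have e := K.equivMapOfInjective f hf
  exact (Group.fg_iff_subgroup_fg K).1 (Group.fg_of_surjective (f := e.symm.toMonoidHom) e.symm.surjective)

/-- Finite generation of a subgroup from that of its kernel part and of its image. -/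
lemma Subgroup.fg_of_map_of_inf_ker {G H : Type*} [Group G] [Group H] (f : G →* H) (K : Subgroup G)
    (h1 : (K.map f).FG) (h2 : (K ⊓ f.ker).FG) : K.FG := by
  classical
  obtain ⟨S, hS⟩ := h1
  obtain ⟨T, hT⟩ := h2
  have hS' : ∀ s ∈ S, ∃ k ∈ K, f k = s := fun s hs => by
    have : s ∈ K.map f := by rw [← hS]; exact Subgroup.subset_closure hs
    exact this
  choose! g hgK hg using hS'
  have hTK : ∀ t ∈ T, t ∈ K ⊓ f.ker := fun t ht => by
    rw [← hT]; exact Subgroup.subset_closure ht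
  refine ⟨S.image g ∪ T, le_antisymm ?_ ?_⟩
  · rw [Subgroup.closure_le]
    intro x hx
    simp only [Finset.coe_union, Finset.coe_image, Set.mem_union, Set.mem_image, Finset.mem_coe] at hx
    rcases hx with ⟨s, hs, rfl⟩ | hx
    · exact hgK s hs
    · exact (hTK x hx).1
  · set C := Subgroup.closure (↑(S.image g ∪ T) : Set G)
    have hker : K ⊓ f.ker ≤ C := by
      rw [← hT, Subgroup.closure_le]
      intro t ht
      exact Subgroup.subset_closure (by simp; exact .inr ht)
    have himg : K.map f ≤ C.map f := by
      rw [← hS, Subgroup.closure_le]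
      intro s hs
      exact ⟨g s, Subgroup.subset_closure (by simp; exact .inl ⟨s, hs, rfl⟩), hg s hs⟩
    have hCK : C ≤ K := by
      rw [Subgroup.closure_le]
      intro x hx
      simp only [Finset.coe_union, Finset.coe_image, Set.mem_union, Set.mem_image, Finset.mem_coe] at hx
      rcases hx with ⟨s, hs, rfl⟩ | hx
      · exact hgK s hs
      · exact (hTK x hx).1
    intro k hk
    obtain ⟨c, hc, hck⟩ := himg ⟨k, hk, rfl⟩
    have : c⁻¹ * k ∈ C := hker ⟨K.mul_mem (K.inv_mem (hCK hc)) hk, by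
      change f _ = 1
      rw [map_mul, map_inv, hck, inv_mul_cancel]⟩
    have := C.mul_mem hc this
    rwa [mul_inv_cancel_left] at this

/-- If `⁅M, ⊤⁆` is central and `M` is finitely generated modulo `⁅M, ⊤⁆`, then `⁅M, ⊤⁆`
is finitely generated. -/
lemma Subgroup.commutator_top_fg {G : Type*} [Group G] [Group.FG G] (M N : Subgroup G) [N.Normal]
    (hN : ⁅M, (⊤ : Subgroup G)⁆ = N) (hc : N ≤ Subgroup.center G)
    (hM : (M.map (QuotientGroup.mk' N)).FG) : N.FG := by
  classical
  obtain ⟨T, hT⟩ := Group.fg_def.1 (inferInstance : Group.FG G)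
  obtain ⟨S, hS⟩ := hM
  have hS' : ∀ s ∈ S, ∃ k ∈ M, QuotientGroup.mk' N k = s := fun s hs => by
    have : s ∈ M.map (QuotientGroup.mk' N) := by rw [← hS]; exact Subgroup.subset_closure hs
    exact this
  choose! a haM ha using hS'
  have hcomm : ∀ m ∈ M, ∀ g : G, ⁅m, g⁆ ∈ N := fun m hm g => by
    rw [← hN]; exact Subgroup.commutator_mem_commutator hm trivial
  have hcen : ∀ m ∈ M, ∀ g h : G, h * ⁅m, g⁆ = ⁅m, g⁆ * h := fun m hm g h =>
    (Subgroup.mem_center_iff.1 (hc (hcomm m hm g)) h)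
  let U : Finset G := (S ×ˢ T).image (fun p => ⁅a p.1, p.2⁆)
  let C := Subgroup.closure (U : Set G)
  have hCN : C ≤ N := by
    rw [Subgroup.closure_le]
    intro x hx
    simp only [U, Finset.coe_image, Set.mem_image, Finset.mem_coe, Finset.mem_product] at hx
    obtain ⟨p, hp, rfl⟩ := hx
    exact hcomm _ (haM _ hp.1) _
  have hcomm : ∀ s ∈ S, ∀ g : G, ⁅a s, g⁆ ∈ C := by
    intro s hs g
    have hg : g ∈ Subgroup.closure (T : Set G) := by rw [hT]; trivial
    induction hg using Subgroup.closure_induction with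
    | mem x hx =>
      exact Subgroup.subset_closure (by simp only [U, Finset.coe_image]; exact ⟨(s, x), by simpa using ⟨hs, hx⟩, rfl⟩)
    | one => simp
    | mul x y _ _ hx hy =>
      have h2 : ⁅a s, x * y⁆ = ⁅a s, x⁆ * ⁅a s, y⁆ := by
        have e : ⁅a s, x * y⁆ = ⁅a s, x⁆ * (x * ⁅a s, y⁆ * x⁻¹) := by
          simp only [commutatorElement_def]; group
        rw [e, hcen _ (haM s hs) y x, mul_inv_cancel_right]
      rw [h2]; exact C.mul_mem hx hy
    | inv x _ hx =>
      have h2 : ⁅a s, x⁻¹⁆ = ⁅a s, x⁆⁻¹ := by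
        have e : ⁅a s, x⁻¹⁆ = x⁻¹ * ⁅a s, x⁆⁻¹ * x := by
          simp only [commutatorElement_def]; group
        have h3 := hcen _ (haM s hs) x x
        rw [e, mul_assoc, inv_mul_eq_iff_eq_mul]
        rw [inv_mul_eq_iff_eq_mul, ← mul_assoc, ← h3, mul_inv_cancel_right]
      rw [h2]; exact C.inv_mem hx
  have hM' : M ≤ Subgroup.closure (↑(S.image a) : Set G) ⊔ N := by
    have h1 : M.map (QuotientGroup.mk' N) ≤ (Subgroup.closure (↑(S.image a) : Set G)).map (QuotientGroup.mk' N) := by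
      rw [← hS, Subgroup.closure_le]
      intro s hs
      exact ⟨a s, Subgroup.subset_closure (by simp; exact ⟨s, hs, rfl⟩), ha s hs⟩
    have := Subgroup.map_le_iff_le_comap.1 h1
    rw [Subgroup.comap_map_eq, QuotientGroup.ker_mk'] at this
    exact this
  let D : Subgroup G :=
    { carrier := {m | (∀ g : G, ⁅m, g⁆ ∈ C)}
      one_mem' := fun g => by rw [commutatorElement_one_left]; exact C.one_mem
      mul_mem' := fun {x y} hx hy g => by
        have e : ⁅x * y, g⁆ = x * ⁅y, g⁆ * x⁻¹ * ⁅x, g⁆ := by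
          simp only [commutatorElement_def]; group
        have h3 : x * ⁅y, g⁆ = ⁅y, g⁆ * x := Subgroup.mem_center_iff.1 (hc (hCN (hy g))) x
        rw [e, h3, mul_inv_cancel_right]
        exact C.mul_mem (hy g) (hx g)
      inv_mem' := fun {x} hx g => by
        have e : ⁅x⁻¹, g⁆ = x⁻¹ * ⁅x, g⁆⁻¹ * x := by
          simp only [commutatorElement_def]; group
        have h3 : x * ⁅x, g⁆ = ⁅x, g⁆ * x := Subgroup.mem_center_iff.1 (hc (hCN (hx g))) x
        have e2 : x⁻¹ * ⁅x, g⁆⁻¹ * x = ⁅x, g⁆⁻¹ := by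
          rw [mul_assoc, inv_mul_eq_iff_eq_mul]
          rw [inv_mul_eq_iff_eq_mul, ← mul_assoc, ← h3, mul_inv_cancel_right]
        rw [e, e2]; exact C.inv_mem (hx g) }
  have hD : M ≤ D := by
    refine hM'.trans (sup_le ?_ ?_)
    · rw [Subgroup.closure_le]
      intro x hx
      simp only [Finset.coe_image, Set.mem_image, Finset.mem_coe] at hx
      obtain ⟨s, hs, rfl⟩ := hx
      exact hcomm s hs
    · intro x hx g
      have h3 : g * x = x * g := Subgroup.mem_center_iff.1 (hc hx) g
      have : ⁅x, g⁆ = 1 := by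
        rw [commutatorElement_def, ← h3]; group
      rw [this]; exact C.one_mem
  refine ⟨U, le_antisymm hCN ?_⟩
  rw [← hN, Subgroup.commutator_le]
  intro m hm g _
  exact hD hm g

lemma IsSlender.of_fg_nilpotent {G : Type*} [Group G] [hfg : Group.FG G]
    (hn : Group.IsNilpotent G) : IsSlender G := by
  rw [Subgroup.nilpotent_iff_lowerCentralSeries] at hn
  obtain ⟨c, hc⟩ := hn
  induction c generalizing G with
  | zero =>
    intro K
    have : K = ⊥ := by
      rw [eq_bot_iff, ← hc]; exact le_top
    rw [this]; exact Subgroup.FG.bot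
  | succ c ih =>
    set N := (⊤ : Subgroup G).lowerCentralSeries c with hN
    have hNc : N ≤ Subgroup.center G := by
      intro x hx
      rw [Subgroup.mem_center_iff]
      intro g
      have : ⁅x, g⁆ ∈ (⊤ : Subgroup G).lowerCentralSeries (c + 1) := by
        rw [Subgroup.lowerCentralSeries_succ]
        exact Subgroup.commutator_mem_commutator hx trivial
      rw [hc, Subgroup.mem_bot, commutatorElement_eq_one_iff_mul_comm] at this
      exact this.symm
    have hQ : IsSlender (G ⧸ N) := by
      apply ih
      have h1 := (Subgroup.map_lowerCentralSeries (S := (⊤ : Subgroup G)) (QuotientGroup.mk' N) c)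
      rw [Subgroup.map_top_of_surjective _ (QuotientGroup.mk'_surjective N)] at h1
      rw [← h1, ← hN]
      simp
    have hNfg : N.FG := by
      cases c with
      | zero =>
        rw [hN, Subgroup.lowerCentralSeries_zero]
        exact Group.fg_def.1 hfg
      | succ c =>
        exact Subgroup.commutator_top_fg ((⊤ : Subgroup G).lowerCentralSeries c) N
          (by rw [hN, Subgroup.lowerCentralSeries_succ]) hNc (hQ _)
    intro K
    apply Subgroup.fg_of_map_of_inf_ker (QuotientGroup.mk' N) K (hQ _)
    rw [QuotientGroup.ker_mk']
    let : CommGroup N := { (inferInstance : Group N) with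
      mul_comm := fun a b => Subtype.ext (Subgroup.mem_center_iff.1 (hNc b.2) a) }
    have : Group.FG N := (Group.fg_iff_subgroup_fg N).2 hNfg
    have h1 : IsSlender N := IsSlender.of_fg_comm
    have h2 : ((K ⊓ N).subgroupOf N).FG := h1 _
    rw [← Group.fg_iff_subgroup_fg] at h2 ⊢
    exact Group.fg_of_surjective (f := (Subgroup.subgroupOfEquivOfLe (inf_le_right : K ⊓ N ≤ N)).toMonoidHom)
      (Subgroup.subgroupOfEquivOfLe (inf_le_right : K ⊓ N ≤ N)).surjective

end Slender

/-- The group is finite, or nilpotent and slender. -/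
def IsNilpotentOrFinite (Q : Type*) [Group Q] : Prop :=
  Finite Q ∨ (Group.IsNilpotent Q ∧ IsSlender Q)

namespace IsNilpotentOrFinite

lemma of_fg {Q : Type*} [Group Q] (h : (Group.FG Q ∧ Group.IsNilpotent Q) ∨ Finite Q) :
    IsNilpotentOrFinite Q := by
  rcases h with ⟨h1, h2⟩ | h
  · exact .inr ⟨h2, IsSlender.of_fg_nilpotent h2⟩
  · exact .inl h

lemma isSlender {Q : Type*} [Group Q] (h : IsNilpotentOrFinite Q) : IsSlender Q := by
  rcases h with h | h
  · intro K
    exact (Group.fg_iff_subgroup_fg K).1 inferInstance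
  · exact h.2

lemma of_surjective {G H : Type*} [Group G] [Group H] (hG : IsNilpotentOrFinite G) (f : G →* H)
    (hf : Function.Surjective f) : IsNilpotentOrFinite H := by
  rcases hG with h | ⟨h1, h2⟩
  · exact .inl (Finite.of_surjective f hf)
  · exact .inr ⟨Group.nilpotent_of_surjective f hf, h2.of_surjective f hf⟩

lemma of_injective {G H : Type*} [Group G] [Group H] (hG : IsNilpotentOrFinite G) (f : H →* G)
    (hf : Function.Injective f) : IsNilpotentOrFinite H := by
  rcases hG with h | ⟨h1, h2⟩
  · exact .inl (Finite.of_injective f hf)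
  · refine .inr ⟨?_, h2.of_injective f hf⟩
    have := MonoidHom.ofInjective hf
    exact Group.nilpotent_of_mulEquiv this.symm

end IsNilpotentOrFinite

namespace IsDecomp
open FreeTree
variable {G ι κ : Type} [Group G] {A : ι → Subgroup G} {x : κ → G}

lemma zpowers (hA : IsDecomp A x) :
    IsDecomp (Sum.elim A (fun j => Subgroup.zpowers (x j))) (Empty.elim : Empty → G) where
  gen K hK _ := hA.gen K (fun i => hK (.inl i))
    (fun j => hK (.inr j) (Subgroup.mem_zpowers (x j)))
  lift L _ f y := by
    obtain ⟨F, h1, h2⟩ := hA.lift L (fun i => f (.inl i))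
      (fun j => f (.inr j) ⟨x j, Subgroup.mem_zpowers (x j)⟩)
    refine ⟨F, ?_, fun j => j.elim⟩
    rintro (i | j) q
    · exact h1 i q
    · obtain ⟨q, n, rfl⟩ := q
      have h3 := h2 j
      have : (⟨x j ^ n, n, rfl⟩ : Subgroup.zpowers (x j)) = ⟨x j, Subgroup.mem_zpowers (x j)⟩ ^ n :=
        Subtype.ext rfl
      change F (x j ^ n) = f (.inr j) _
      rw [map_zpow, h3, ← map_zpow]
      exact congrArg _ this.symm

lemma zpow_injective (hA : IsDecomp A x) (j : κ) :
    Function.Injective (fun n : ℤ => x j ^ n) := by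
  obtain ⟨F, -, h2⟩ := hA.lift (Multiplicative ℤ) (fun _ => 1) (fun _ => Multiplicative.ofAdd 1)
  intro m n h
  have := congrArg F h
  simp only [map_zpow, h2] at this
  rw [← ofAdd_zsmul, ← ofAdd_zsmul] at this
  simpa using this

lemma infinite_zpowers (hA : IsDecomp A x) (j : κ) : Infinite (Subgroup.zpowers (x j)) :=
  Infinite.of_injective (fun n : ℤ => (⟨x j ^ n, n, rfl⟩ : Subgroup.zpowers (x j)))
    (fun _ _ h => hA.zpow_injective j (congrArg Subtype.val h))

lemma mem_smul_inr_one (i : ι) (g : G) :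
    g • (Sum.inr ⟨i, ((1 : G) : G ⧸ A i)⟩ : Vertex A) = Sum.inr ⟨i, ((1 : G) : G ⧸ A i)⟩ ↔
      g ∈ A i := by
  rw [smul_inr_eq_iff]; simp

/-- Distinct free factors intersect trivially. -/
lemma eq_of_mem (hA : IsDecomp A x) {i j : ι} {g : G} (hi : g ∈ A i) (hj : g ∈ A j)
    (hg : g ≠ 1) : i = j := by
  by_contra hne
  refine hg (hA.tree.unique_fix (w := Sum.inr ⟨i, ((1 : G) : G ⧸ A i)⟩)
    (w' := Sum.inr ⟨j, ((1 : G) : G ⧸ A j)⟩) ?_ ((mem_smul_inr_one i g).2 hi)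
    ((mem_smul_inr_one j g).2 hj))
  simp only [ne_eq, Sum.inr.injEq, Sigma.mk.injEq, not_and]
  exact fun h => absurd h hne

/-- Finite or nilpotent groups are freely indecomposable. -/
lemma subsingleton_of_isNilpotentOrFinite (hA : IsDecomp A x) (hG : IsNilpotentOrFinite G)
    (hne : ∀ i, A i ≠ ⊥) : Subsingleton ι := by
  refine ⟨fun i j => ?_⟩
  by_contra hij
  have hex : ∀ i, ∃ b ∈ A i, b ≠ 1 := fun i => (Subgroup.ne_bot_iff_exists_ne_one.1 (hne i)).elim
    (fun b hb => ⟨b, b.2, fun h => hb (Subtype.ext h)⟩)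
  choose b hb hb1 using hex
  rcases hG with hfin | ⟨hnil, -⟩
  · have hι : Finite ι := Finite.of_injective b (fun i j h =>
      hA.eq_of_mem (hb i) (by rw [h]; exact hb j) (hb1 i))
    have : ∀ i, Finite (G ⧸ A i) := fun i => inferInstance
    have hW : Finite (Vertex A) := inferInstance
    obtain ⟨w, hw⟩ := Finite.exists_max (fun w : Vertex A => hA.tree.depth hA.tree.root w)
    have uniq : ∀ e e', hA.tree.init e = w ∨ hA.tree.term e = w →
        hA.tree.init e' = w ∨ hA.tree.term e' = w → e = e' := by
      have key : ∀ e, hA.tree.init e = w ∨ hA.tree.term e = w →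
          ∃ h : w ≠ hA.tree.root, e = hA.tree.parEdge hA.tree.root h := by
        intro e he
        rcases hA.tree.edge_cases hA.tree.root e with ⟨h, h1, h2⟩ | ⟨h, h1, h2⟩
        · have hd := hA.tree.depth_par_lt h
          rcases he with rfl | rfl
          · rw [← h2] at hd
            have := hw (hA.tree.term e)
            omega
          · exact ⟨h, h1⟩
        · have hd := hA.tree.depth_par_lt h
          rcases he with rfl | rfl
          · exact ⟨h, h1⟩
          · rw [← h2] at hd
            have := hw (hA.tree.init e)
            omega
      intro e e' he he'
      obtain ⟨h, h1⟩ := key e he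
      obtain ⟨_, h2⟩ := key e' he'
      rw [h1, h2]
    rcases w with g | ⟨k, c⟩
    · have := uniq (g, .inl i) (g, .inl j)
        (.inl (by simp [init])) (.inl (by simp [init]))
      simp at this
      exact hij this
    · obtain ⟨g, rfl⟩ := QuotientGroup.mk_surjective c
      have := uniq (g, .inl k) (g * b k, .inl k) (.inr (by simp [term]))
        (.inr (by
          simp only [term, tree_tip_inl, smul_inr, mul_one]
          have : ((g * b k : G) : G ⧸ A k) = g := by
            rw [QuotientGroup.eq]; simpa using hb k
          rw [this]))
      simp at this
      exact hb1 k this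
  · have : Nontrivial G := ⟨b i, 1, hb1 i⟩
    obtain ⟨z, hz⟩ := Subgroup.ne_bot_iff_exists_ne_one.1 (Group.IsNilpotent.center_ne_bot (G := G))
    have hzc := Subgroup.mem_center_iff.1 z.2
    have hfix : ∀ i, (z : G) ∈ A i := by
      intro i
      rw [← mem_smul_inr_one]
      by_contra hc
      refine hb1 i (hA.tree.unique_fix hc ?_ ((mem_smul_inr_one i (b i)).2 (hb i)))
      rw [← mul_smul, hzc, mul_smul, (mem_smul_inr_one i (b i)).2 (hb i)]
    exact hij (hA.eq_of_mem (hfix i) (hfix j) (fun h => hz (Subtype.ext h)))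

lemma eq_top_or_trivial (hA : IsDecomp A x) (hG : IsNilpotentOrFinite G)
    (hG' : ¬ (IsCyclic G ∧ Infinite G)) (hne : ∀ i, A i ≠ ⊥) :
    (∃ i, A i = ⊤) ∨ ∀ g : G, g = 1 := by
  have hs := hA.zpowers.subsingleton_of_isNilpotentOrFinite hG (by
    rintro (i | j)
    · exact hne i
    · intro h
      have h1 := hA.infinite_zpowers j
      simp only [Sum.elim_inr] at h
      rw [h] at h1
      exact not_finite (⊥ : Subgroup G))
  by_cases hi : Nonempty ι
  · obtain ⟨i⟩ := hi
    left
    refine ⟨i, hA.zpowers.gen _ ?_ (fun j => j.elim)⟩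
    intro k
    rw [Subsingleton.elim k (.inl i)]
    exact le_rfl
  · by_cases hj : Nonempty κ
    · obtain ⟨j⟩ := hj
      exfalso
      have htop : Subgroup.zpowers (x j) = ⊤ := by
        refine hA.zpowers.gen _ ?_ (fun j => j.elim)
        intro k
        rw [Subsingleton.elim k (.inr j)]
        exact le_rfl
      have h1 := hA.infinite_zpowers j
      refine hG' ⟨⟨x j, fun g => ?_⟩, ?_⟩
      · have hg : g ∈ Subgroup.zpowers (x j) := by rw [htop]; trivial
        exact hg
      · rw [htop] at h1
        exact Infinite.of_injective _ (Subtype.val_injective (p := fun g => g ∈ (⊤ : Subgroup G)))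
    · right
      have := hA.gen ⊥ (fun i => absurd ⟨i⟩ hi) (fun j => absurd ⟨j⟩ hj)
      intro g
      have hg : g ∈ (⊥ : Subgroup G) := by rw [this]; trivial
      exact hg

end IsDecomp

namespace FreeTree
variable {G W I : Type} [Group G] [MulAction G W]

lemma exists_fixed_vertex (τ : FreeTree G W I) (Q : Subgroup G) (hQ : IsNilpotentOrFinite Q)
    (hQ' : ¬ (IsCyclic Q ∧ Infinite Q)) : ∃ w : W, ∀ q ∈ Q, q • w = w := by
  obtain ⟨σ, l, s, k, -, -, hdec, hne, -⟩ := τ.kurosh Q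
  rcases hdec.eq_top_or_trivial hQ hQ' (by
    intro a h
    obtain ⟨g, hg, hg1, hgs⟩ := hne a
    have : (⟨g, hg⟩ : Q) ∈ (MulAction.stabilizer G (s a)).subgroupOf Q := hgs
    rw [h] at this
    exact hg1 (congrArg Subtype.val (Subgroup.mem_bot.1 this))) with ⟨a, ha⟩ | h
  · refine ⟨s a, fun q hq => ?_⟩
    have : (⟨q, hq⟩ : Q) ∈ (MulAction.stabilizer G (s a)).subgroupOf Q := by rw [ha]; trivial
    exact this
  · refine ⟨τ.root, fun q hq => ?_⟩
    have := congrArg Subtype.val (h ⟨q, hq⟩)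
    simp only [OneMemClass.coe_one] at this
    rw [this, one_smul]

end FreeTree

namespace FreeTree
variable {G W I : Type} [Group G] [MulAction G W]

lemma path_smul_eq (τ : FreeTree G W I) (g : G) (w : W) :
    τ.path (g • w) = τ.path (g • τ.root) + chainAct g (τ.path w) := by
  ext ⟨u, i⟩
  exact τ.path_smul g w u i

/-- A map of the vertices of the tree fixing the root and compatible with an endomorphism. -/
structure Equivariant (τ : FreeTree G W I) (φ : G →* G) (Φ : W → W) : Prop where
  root : Φ τ.root = τ.root
  smul : ∀ g w, Φ (g • w) = φ g • Φ w

namespace Equivariant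
variable {τ : FreeTree G W I} {φ ψ : G →* G} {Φ Ψ : W → W}

lemma refl : τ.Equivariant (MonoidHom.id G) id := ⟨rfl, fun _ _ => rfl⟩

lemma comp (h : τ.Equivariant φ Φ) (h' : τ.Equivariant ψ Ψ) :
    τ.Equivariant (φ.comp ψ) (Φ ∘ Ψ) where
  root := by rw [Function.comp_apply, h'.root, h.root]
  smul g w := by simp only [Function.comp_apply, h'.smul, h.smul, MonoidHom.comp_apply]

lemma iterate (h : τ.Equivariant φ Φ) : ∀ n : ℕ, τ.Equivariant (iterHom φ n) (Φ^[n])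
  | 0 => refl
  | n + 1 => by
    rw [Function.iterate_succ']
    exact h.comp (h.iterate n)

/-- The image of a chain under an equivariant map. -/
lemma path_eq (h : τ.Equivariant φ Φ) (w : W) : τ.path (Φ w) =
    (τ.path w).sum fun e n => n • chainAct (φ e.1) (τ.path (Φ (τ.tip e.2))) := by
  refine τ.induction_edges τ.root (fun w => τ.path (Φ w) =
    (τ.path w).sum fun e n => n • chainAct (φ e.1) (τ.path (Φ (τ.tip e.2)))) ?_ (fun e => ?_) w
  · rw [h.root, τ.path_root, Finsupp.sum_zero_index]
  · rw [τ.path_term, Finsupp.sum_add_index' (by simp) (by intros; rw [add_smul]),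
      Finsupp.sum_single_index (by simp), one_smul, term, init, h.smul, h.smul, h.root,
      τ.path_smul_eq (φ e.1) (Φ _), add_left_inj]

lemma fixed (h : τ.Equivariant φ Φ) {p : G} (hp : φ p = p) (hp1 : p ≠ 1) {w : W}
    (hw : p • w = w) : Φ w = w := by
  by_contra hne
  refine hp1 (τ.unique_fix hne ?_ hw)
  have := h.smul p w
  rw [hw, hp] at this
  exact this.symm

lemma fixed_smul_root (h : τ.Equivariant φ Φ) {p : G} (hp : φ p = p) :
    Φ (p • τ.root) = p • τ.root := by
  rw [h.smul, h.root, hp]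

end Equivariant
end FreeTree

namespace IsDecomp
open FreeTree
variable {G ι κ : Type} [Group G] {A : ι → Subgroup G} {x : κ → G}

lemma exists_equivariant (hA : IsDecomp A x) (φ : G →* G)
    (hφ : ∀ i, ∃ w : Vertex A, ∀ q ∈ A i, φ q • w = w) :
    ∃ Φ, hA.tree.Equivariant φ Φ := by
  choose w hw using hφ
  have key : ∀ i (g h : G), (g : G ⧸ A i) = h → φ g • w i = φ h • w i := by
    intro i g h hgh
    have := hw i _ (QuotientGroup.eq.1 hgh)
    rw [map_mul, map_inv, mul_smul, inv_smul_eq_iff] at this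
    exact this.symm
  refine ⟨Sum.elim (fun g => Sum.inl (φ g)) (fun c => φ c.2.out • w c.1), ?_, ?_⟩
  · simp
  · rintro g (u | ⟨i, c⟩)
    · simp
    · obtain ⟨h, rfl⟩ := QuotientGroup.mk_surjective c
      rw [smul_inr]
      simp only [Sum.elim_inr]
      rw [key i _ _ (QuotientGroup.out_eq' ((g * h : G) : G ⧸ A i)),
        key i _ _ (QuotientGroup.out_eq' (h : G ⧸ A i)), map_mul, mul_smul]

lemma exists_equivariant_of_injOn (hA : IsDecomp A x) (φ : G →* G)
    (hN : ∀ i, IsNilpotentOrFinite (A i)) (hC : ∀ i, ¬ (IsCyclic (A i) ∧ Infinite (A i)))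
    (hφ : ∀ i, ∀ q ∈ A i, φ q = 1 → q = 1) : ∃ Φ, hA.tree.Equivariant φ Φ := by
  refine hA.exists_equivariant φ (fun i => ?_)
  have hinj : Function.Injective (φ.subgroupMap (A i)) := by
    rw [injective_iff_map_eq_one]
    intro q hq
    exact Subtype.ext (hφ i q q.2 (congrArg Subtype.val hq))
  let e : A i ≃* (A i).map φ :=
    MulEquiv.ofBijective _ ⟨hinj, φ.subgroupMap_surjective (A i)⟩
  obtain ⟨w, hw⟩ := hA.tree.exists_fixed_vertex ((A i).map φ)
    ((hN i).of_surjective e.toMonoidHom e.surjective) (by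
      rintro ⟨h1, h2⟩
      exact hC i ⟨isCyclic_of_injective e.toMonoidHom e.injective,
        Infinite.of_injective e.symm e.symm.injective⟩)
  exact ⟨w, fun q hq => hw _ ⟨q, hq, rfl⟩⟩

end IsDecomp

/-- `G` is a free product of at most `n` groups, each infinite cyclic, finite or slender
nilpotent. -/
def HasDecompLE (n : ℕ) (G : Type) [Group G] : Prop :=
  ∃ (ι κ : Type) (_ : Finite ι) (_ : Finite κ) (A : ι → Subgroup G) (x : κ → G),
    IsDecomp A x ∧ (∀ i, IsNilpotentOrFinite (A i)) ∧
    (∀ i, ¬ (IsCyclic (A i) ∧ Infinite (A i))) ∧ (∀ i, A i ≠ ⊥) ∧ Nat.card ι + Nat.card κ ≤ n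

namespace IsDecomp
variable {G ι κ : Type} [Group G] {A : ι → Subgroup G} {x : κ → G}

lemma map_equiv (hA : IsDecomp A x) {G' : Type} [Group G'] (e : G ≃* G') :
    IsDecomp (fun i => (A i).map e.toMonoidHom) (fun j => e (x j)) where
  gen K hK hx := by
    have := hA.gen (K.comap e.toMonoidHom) (fun i => Subgroup.map_le_iff_le_comap.1 (hK i)) hx
    rw [eq_top_iff]
    intro g _
    have hg : e.symm g ∈ K.comap e.toMonoidHom := by rw [this]; trivial
    simpa using hg
  lift L _ f y := by
    obtain ⟨F, h1, h2⟩ := hA.lift L (fun i => (f i).comp (e.toMonoidHom.subgroupMap (A i))) y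
    refine ⟨F.comp e.symm.toMonoidHom, ?_, fun j => by simp [h2]⟩
    rintro i ⟨_, q, hq, rfl⟩
    have := h1 i ⟨q, hq⟩
    simp only [MonoidHom.comp_apply] at this
    simp only [MonoidHom.comp_apply]
    rw [show e.symm.toMonoidHom (e.toMonoidHom q) = q from e.symm_apply_apply q, this]
    rfl

/-- Infinite cyclic factors may be moved to the free part and trivial factors dropped. -/
lemma hasDecompLE (hA : IsDecomp A x) [Finite ι] [Finite κ] (hN : ∀ i, IsNilpotentOrFinite (A i)) :
    HasDecompLE (Nat.card ι + Nat.card κ) G := by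
  classical
  let p : ι → Prop := fun i => IsCyclic (A i) ∧ Infinite (A i)
  have hg : ∀ i : {i // p i}, ∃ g : A i, (∀ a : A i, a ∈ Subgroup.zpowers g) ∧
      ∀ (L : Type) [Group L] (y : L), ∃ F : A i →* L, F g = y := by
    rintro ⟨i, hc, hi⟩
    let e := intCyclicMulEquiv (G := A i)
    have he : ∀ a : A i, a = (e (Multiplicative.ofAdd 1)) ^ (e.symm a).toAdd := by
      intro a
      rw [← map_zpow, ← ofAdd_zsmul, smul_eq_mul, mul_one]
      exact (e.apply_symm_apply a).symm
    refine ⟨e (Multiplicative.ofAdd 1), fun a => ⟨_, (he a).symm⟩, fun L _ y =>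
      ⟨(zpowersHom L y).comp e.symm.toMonoidHom, ?_⟩⟩
    simp
  choose g hg hgL using hg
  refine ⟨{i // ¬ p i ∧ A i ≠ ⊥}, {i // p i} ⊕ κ, inferInstance, inferInstance,
    fun i => A i, Sum.elim (fun i => (g i : G)) x, ⟨?_, ?_⟩, fun i => hN i, fun i => i.2.1,
    fun i => i.2.2, ?_⟩
  · intro K hK hx
    refine hA.gen K (fun i => ?_) (fun j => hx (.inr j))
    by_cases hi : p i
    · intro q hq
      obtain ⟨n, hn⟩ := hg ⟨i, hi⟩ ⟨q, hq⟩
      have : q = (g ⟨i, hi⟩ : G) ^ n := (congrArg Subtype.val hn).symm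
      rw [this]
      exact K.zpow_mem (hx (.inl ⟨i, hi⟩)) n
    · by_cases hb : A i = ⊥
      · rw [hb]; exact bot_le
      · exact hK ⟨i, hi, hb⟩
  · intro L _ f y
    choose F0 hF0 using fun i => hgL i L (y (.inl i))
    obtain ⟨F, h1, h2⟩ := hA.lift L (fun i => if h : p i then F0 ⟨i, h⟩ else
      if h' : A i ≠ ⊥ then f ⟨i, h, h'⟩ else 1) (fun j => y (.inr j))
    refine ⟨F, ?_, ?_⟩
    · rintro ⟨i, hi, hb⟩ q
      have := h1 i q
      rw [dif_neg hi, dif_pos hb] at this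
      exact this
    · rintro (⟨i, hi⟩ | j)
      · have := h1 i (g ⟨i, hi⟩)
        rw [dif_pos hi, hF0] at this
        exact this
      · exact h2 j
  · rw [Nat.card_sum]
    have h1 : Nat.card {i // p i} + Nat.card {i // ¬ p i ∧ A i ≠ ⊥} ≤ Nat.card ι := by
      rw [← Nat.card_sum]
      refine Nat.card_le_card_of_injective (Sum.elim Subtype.val Subtype.val) ?_
      rintro (⟨a, ha⟩ | ⟨a, ha⟩) (⟨b, hb⟩ | ⟨b, hb⟩) h <;> simp only [Sum.elim_inl, Sum.elim_inr] at h <;>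
        subst h
      · rfl
      · exact absurd ha hb.1
      · exact absurd hb ha.1
      · rfl
    omega

end IsDecomp

namespace HasDecompLE
variable {G : Type} [Group G]

lemma mono {m n : ℕ} (hmn : m ≤ n) (h : HasDecompLE m G) : HasDecompLE n G := by
  obtain ⟨ι, κ, h1, h2, A, x, hA, hN, hC, hb, hc⟩ := h
  exact ⟨ι, κ, h1, h2, A, x, hA, hN, hC, hb, hc.trans hmn⟩

lemma of_equiv {n : ℕ} {G' : Type} [Group G'] (e : G ≃* G') (h : HasDecompLE n G) :
    HasDecompLE n G' := by
  obtain ⟨ι, κ, h1, h2, A, x, hA, hN, hC, hb, hc⟩ := h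
  exact ((hA.map_equiv e).hasDecompLE (fun i => (hN i).of_surjective _
    (e.toMonoidHom.subgroupMap_surjective (A i)))).mono hc

end HasDecompLE

namespace FreeTree
variable {G W I : Type} [Group G] [MulAction G W]

/-- Vertices `w j` together with edges `E j` on the way to them, triangular with respect to the
action of the subgroup `H`. -/
structure IsTriangular (τ : FreeTree G W I) (H : Subgroup G) {J : Type} (w : J → W)
    (E : J → G × I) (rank : J → ℕ∞) : Prop where
  tri : ∀ (j j' : J) (h : H), τ.path (w j) (act (h : G) (E j')) ≠ 0 → rank j ≤ rank j' →
    j = j' ∧ h = 1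
  diag : ∀ j, τ.path (w j) (E j) = 1 ∨ τ.path (w j) (E j) = -1

namespace IsTriangular
variable {τ : FreeTree G W I} {H : Subgroup G} {J : Type} {w : J → W} {E : J → G × I}
  {rank : J → ℕ∞}

lemma comp (h : τ.IsTriangular H w E rank) {J' : Type} (f : J' → J) (hf : Function.Injective f) :
    τ.IsTriangular H (w ∘ f) (E ∘ f) (rank ∘ f) where
  tri _ _ q h1 h2 := (h.tri _ _ q h1 h2).imp (fun h => hf h) id
  diag j := h.diag (f j)

/-- The chains of a triangular family are independent over the group ring of `H`, even for infinite
combinations. -/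
lemma eq_zero (h : τ.IsTriangular H w E rank) [Fintype J] {R : Type*} [CommRing R] [Nontrivial R]
    (c : J → H → R) (hc : ∀ e, ∑ j, ∑ᶠ q : H, c j q * (τ.path (w j) (act (q⁻¹ : G) e) : R) = 0) :
    c = 0 := by
  classical
  by_contra hne
  have : (Finset.univ.filter (fun j => c j ≠ 0)).Nonempty := by
    obtain ⟨j, hj⟩ := Function.ne_iff.1 hne
    exact ⟨j, by simpa using hj⟩
  obtain ⟨j, hj, hmax⟩ := Finset.exists_max_image _ rank this
  obtain ⟨q, hq⟩ := Function.ne_iff.1 (Finset.mem_filter.1 hj).2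
  have hz := hc (act (q : G) (E j))
  have key : ∀ j' (q' : H), c j' q' * (τ.path (w j') (act (q'⁻¹ : G) (act (q : G) (E j))) : R) ≠ 0 →
      j' = j ∧ q' = q := by
    intro j' q' hne
    have h1 : c j' ≠ 0 := by rintro h; simp [h] at hne
    have h2 : τ.path (w j') (act (q'⁻¹ * q : H) (E j)) ≠ 0 := by
      intro h
      rw [act_act] at hne
      push_cast at h
      simp [h] at hne
    obtain ⟨h3, h4⟩ := h.tri _ _ _ h2 (hmax j' (by simpa using h1))
    exact ⟨h3, inv_mul_eq_one.1 h4⟩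
  rw [Finset.sum_eq_single j, finsum_eq_single _ q] at hz
  · simp only [act_act, inv_mul_cancel, act_one] at hz
    rcases h.diag j with h' | h' <;> rw [h'] at hz <;> simp at hz <;> exact hq hz
  · intro q' hq'
    by_contra hne
    exact hq' (key j q' hne).2
  · intro j' _ hj'
    rw [← finsum_zero (α := H)]
    congr 1
    funext q'
    by_contra hne
    exact hj' (key j' q' hne).1
  · simp

end IsTriangular
end FreeTree

lemma finite_and_card_le {J : Type} {n : ℕ} (h : ∀ f : Fin (n + 1) → J, ¬ Function.Injective f) :
    Finite J ∧ Nat.card J ≤ n := by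
  have hJ : Finite J := by
    by_contra hc
    have : Infinite J := not_finite_iff_infinite.1 hc
    exact h (fun i => Infinite.natEmbedding J i) (fun a b hab => by simpa [Fin.ext_iff] using hab)
  refine ⟨hJ, ?_⟩
  by_contra hc
  push Not at hc
  let e := Finite.equivFin J
  exact h (fun i => e.symm (Fin.castLE hc i)) (e.symm.injective.comp (Fin.castLE_injective hc))

namespace IsDecomp
open FreeTree
variable {G ι κ : Type} [Group G] {A : ι → Subgroup G} {x : κ → G}

lemma isNilpotentOrFinite_stabilizer (hN : ∀ i, IsNilpotentOrFinite (A i)) (w : Vertex A) :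
    IsNilpotentOrFinite (MulAction.stabilizer G w) := by
  rcases w with g | ⟨i, c⟩
  · have : MulAction.stabilizer G (Sum.inl g : Vertex A) = ⊥ := by
      rw [eq_bot_iff]
      intro h hh
      rw [MulAction.mem_stabilizer_iff, smul_inl] at hh
      simpa using hh
    rw [this]
    exact .inl inferInstance
  · obtain ⟨g, rfl⟩ := QuotientGroup.mk_surjective c
    refine (hN i).of_injective (((MulAut.conj g⁻¹).toMonoidHom.comp (Subgroup.subtype _)).codRestrict
      (A i) ?_) ?_
    · rintro ⟨h, hh⟩
      rw [MulAction.mem_stabilizer_iff, smul_inr_eq_iff] at hh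
      simpa using hh
    · intro a b hab
      exact Subtype.ext ((MulAut.conj g⁻¹).injective (congrArg Subtype.val hab))

lemma exists_triangular (hA : IsDecomp A x) (hN : ∀ i, IsNilpotentOrFinite (A i))
    (H : Subgroup G) : ∃ (J : Type) (w : J → Vertex A) (E : J → G × (ι ⊕ κ)) (rank : J → ℕ∞),
      hA.tree.IsTriangular H w E rank ∧
      (∀ j, ∃ h ∈ H, (h ≠ 1 ∧ h • w j = w j) ∨ w j = h • hA.tree.root) ∧
      ∀ n, Finite J → Nat.card J ≤ n → HasDecompLE n H := by
  obtain ⟨σ, l, s, k, E, rank, hdec, hne, htri, hdiag⟩ := hA.tree.kurosh H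
  refine ⟨σ ⊕ l, _, E, rank, ⟨htri, hdiag⟩, ?_, ?_⟩
  · rintro (a | q)
    · obtain ⟨h, hH, h1, h2⟩ := hne a
      exact ⟨h, hH, .inl ⟨h1, h2⟩⟩
    · exact ⟨k q, (k q).2, .inr rfl⟩
  · intro n hJ hn
    have : Finite σ := Finite.sum_left l
    have : Finite l := Finite.sum_right σ
    rw [Nat.card_sum] at hn
    refine (hdec.hasDecompLE (fun a => ?_)).mono hn
    exact (isNilpotentOrFinite_stabilizer hN (s a)).of_injective
      ((H.subtype.comp (Subgroup.subtype _)).codRestrict _ (fun h => h.2))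
      (fun u v huv => by
        have huv' := congrArg Subtype.val huv
        exact Subtype.ext (Subtype.ext huv'))

end IsDecomp

/-- Modulo a prime `p`, a sum of values of a function invariant under a map of order `p` reduces to
the fixed points. -/
lemma finsum_eq_finsum_fixed {p : ℕ} [Fact p.Prime] {X : Type} (α : X → X) (hα : α^[p] = id)
    (F : X → ZMod p) (hF : ∀ v, F (α v) = F v) (hfin : F.support.Finite) :
    ∑ᶠ v, F v = ∑ᶠ v ∈ {v | α v = v}, F v := by
  classical
  have h2 : ∑ᶠ v ∈ {v | α v = v}, F v = ∑ v ∈ hfin.toFinset, if α v = v then F v else 0 := by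
    rw [← finsum_eq_sum_of_support_subset]
    · refine finsum_congr (fun v => ?_)
      rw [finsum_eq_if]
      rfl
    · intro v hv
      simp only [Function.mem_support, ne_eq, ite_eq_right_iff, Classical.not_imp] at hv
      simpa using hv.2
  rw [h2, finsum_eq_sum_of_support_subset (s := hfin.toFinset) F (by simp),
    ← Finset.sum_fiberwise (s := hfin.toFinset) (g := F),
    ← Finset.sum_fiberwise (s := hfin.toFinset) (g := F) (f := fun v => if α v = v then F v else 0)]
  refine Finset.sum_congr rfl (fun c _ => ?_)
  by_cases hc : c = 0
  · subst hc
    rw [Finset.sum_eq_zero, Finset.sum_eq_zero]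
    · intro v hv
      rw [(Finset.mem_filter.1 hv).2, ite_self]
    · intro v hv
      exact (Finset.mem_filter.1 hv).2
  have e1 : ∑ v ∈ hfin.toFinset with F v = c, F v =
      ((hfin.toFinset.filter (fun v => F v = c)).card : ZMod p) * c := by
    rw [Finset.sum_congr rfl (fun v hv => (Finset.mem_filter.1 hv).2), Finset.sum_const, nsmul_eq_mul]
  have e2 : (∑ v ∈ hfin.toFinset with F v = c, if α v = v then F v else 0) =
      ((hfin.toFinset.filter (fun v => F v = c)).filter (fun v => α v = v)).card * c := by
    rw [← Finset.sum_filter, Finset.sum_congr rfl (fun v hv =>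
      (Finset.mem_filter.1 (Finset.mem_filter.1 hv).1).2), Finset.sum_const, nsmul_eq_mul]
  rw [e1, e2]
  congr 1
  set S := hfin.toFinset.filter (fun v => F v = c) with hS
  have hmem : ∀ v, v ∈ S ↔ F v = c := by
    intro v
    simp only [hS, Finset.mem_filter, Set.Finite.mem_toFinset, Function.mem_support, and_iff_right_iff_imp]
    rintro h; rw [h]; exact hc
  let β : Function.End S := fun v => ⟨α v, by rw [hmem, hF, ← hmem]; exact v.2⟩
  have hβ : β ^ p ^ 1 = 1 := by
    have : ∀ (n : ℕ) (v : S), (((β ^ n : Function.End S) v : S) : X) = α^[n] v := by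
      intro n
      induction n with
      | zero => intro v; rfl
      | succ n ih =>
        intro v
        rw [pow_succ', Function.iterate_succ_apply', ← ih]
        rfl
    funext v
    refine Subtype.ext ?_
    rw [pow_one, this, hα]
    rfl
  have := Equiv.Perm.card_fixedPoints_modEq hβ
  rw [← ZMod.natCast_eq_natCast_iff, Fintype.card_coe] at this
  rw [this]
  congr 1
  rw [← Fintype.card_coe]
  refine Fintype.card_congr ⟨fun v => ⟨v.1, Finset.mem_filter.2 ⟨v.1.2, congrArg Subtype.val v.2⟩⟩,
    fun v => ⟨⟨v.1, (Finset.mem_filter.1 v.2).1⟩, Subtype.ext (Finset.mem_filter.1 v.2).2⟩,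
    fun _ => rfl, fun _ => rfl⟩

lemma iterHom_eq_iterate {G : Type*} [Group G] (φ : G →* G) (n : ℕ) :
    (iterHom φ n : G → G) = φ^[n] := by
  induction n with
  | zero => rfl
  | succ n ih =>
    rw [Function.iterate_succ', ← ih]
    rfl

lemma Finset.prod_range_add_one_of_eq {M : Type*} [CommMonoid M] (u : ℕ → M) {p : ℕ}
    (h : u p = u 0) : ∏ j ∈ Finset.range p, u (j + 1) = ∏ j ∈ Finset.range p, u j := by
  rcases p with _ | k
  · rfl
  · rw [Finset.prod_range_succ, Finset.prod_range_succ' u, h]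

namespace FreeTree.Equivariant
variable {G W I : Type} [Group G] [MulAction G W] {τ : FreeTree G W I} {φ : G →* G} {Φ : W → W}

lemma iterate_smul (h : τ.Equivariant φ Φ) (n : ℕ) (g : G) (w : W) :
    Φ^[n] (g • w) = φ^[n] g • Φ^[n] w := by
  rw [(h.iterate n).smul, iterHom_eq_iterate]

open Classical in
/-- An averaging argument: for an automorphism of prime order `p`, a cycle modulo `p` of the
quotient by `G` built from fixed vertices remains a cycle in the quotient by the fixed subgroup. -/
lemma exists_cocycle (h : τ.Equivariant φ Φ) {p : ℕ} [Fact p.Prime] (hp : φ^[p] = id)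
    (e : G × I) : ∃ c : I → ZMod p, ∀ w, Φ w = w →
      ∑ᶠ q : fixedSubgroup φ, (τ.path w (act (q⁻¹ : G) e) : ZMod p) =
        (τ.path w).sum fun e n => (n : ZMod p) * c e.2 := by
  obtain ⟨g₀, i⟩ := e
  have hinj : ∀ j, j < p → Function.Injective φ^[j] := by
    intro j hj
    refine Function.Injective.of_comp (f := φ^[p - j]) ?_
    rw [← Function.iterate_add, Nat.sub_add_cancel hj.le, hp]
    exact Function.injective_id
  let b : W → ZMod p := fun w => (τ.path (g₀⁻¹ • w) (1, i) : ℤ)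
  let f : W → ZMod p := fun w => ∏ j ∈ Finset.range p, b (Φ^[j] w)
  have hb : ∀ (v : G) (w : W), b (v • w) - b (v • τ.root) = (τ.path w (act v⁻¹ (g₀, i)) : ℤ) := by
    intro v w
    have := τ.path_sub_smul (g₀⁻¹ * v) w τ.root (1, i)
    simp only [τ.path_root, Finsupp.coe_zero, Pi.zero_apply, sub_zero] at this
    simp only [b, ← mul_smul]
    rw [← Int.cast_sub, this]
    simp [act]
  have hΦr : ∀ j, Φ^[j] τ.root = τ.root := fun j => (h.iterate j).root
  have hfin : ∀ w, (Function.support fun v : G => f (v • w) - f (v • τ.root)).Finite := by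
    intro w
    refine Set.Finite.subset (s := ⋃ j ∈ Finset.range p,
      (fun v => (act (φ^[j] v)⁻¹ (g₀, i))) ⁻¹' ((τ.path (Φ^[j] w)).support : Set (G × I))) ?_ ?_
    · refine Set.Finite.biUnion (Finset.finite_toSet _) (fun j hj => ?_)
      refine Set.Finite.preimage (Function.Injective.injOn ?_) (Finset.finite_toSet _)
      intro u v huv
      have := congrArg Prod.fst huv
      simp only [act, mul_left_inj, inv_inj] at this
      exact hinj j (Finset.mem_range.1 hj) this
    · intro v hv
      by_contra hc
      refine hv (sub_eq_zero.2 (Finset.prod_congr rfl (fun j hj => ?_)))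
      rw [h.iterate_smul, h.iterate_smul, hΦr, ← sub_eq_zero, hb]
      by_contra hne
      refine hc (Set.mem_biUnion hj ?_)
      simp only [Set.mem_preimage, Finset.mem_coe, Finsupp.mem_support_iff]
      intro h0
      rw [h0, Int.cast_zero] at hne
      exact hne rfl
  let l : W → ZMod p := fun w => ∑ᶠ v : G, (f (v • w) - f (v • τ.root))
  have hl0 : l τ.root = 0 := by simp [l]
  have hl : ∀ (g : G) (w : W), l (g • w) - l (g • τ.root) = l w := by
    intro g w
    simp only [l]
    rw [← finsum_sub_distrib (hfin _) (hfin _),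
      ← finsum_comp_equiv (Equiv.mulRight g) (f := fun v : G => f (v • w) - f (v • τ.root))]
    refine finsum_congr (fun v => ?_)
    simp only [Equiv.coe_mulRight, mul_smul]
    ring
  have hlp : ∀ w, l w = (τ.path w).sum fun e n => (n : ZMod p) * l (τ.tip e.2) := by
    intro w
    refine τ.induction_edges τ.root (fun w => l w =
      (τ.path w).sum fun e n => (n : ZMod p) * l (τ.tip e.2)) ?_ (fun e => ?_) w
    · rw [hl0, τ.path_root, Finsupp.sum_zero_index]
    · rw [τ.path_term, Finsupp.sum_add_index' (by simp) (by intros; push_cast; ring),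
        Finsupp.sum_single_index (by simp), term, init, Int.cast_one, one_mul, ← hl e.1 (τ.tip e.2)]
      constructor <;> intro h' <;> linear_combination h'
  refine ⟨fun i => l (τ.tip i), fun w hw => ?_⟩
  rw [← hlp]
  have hΦw : ∀ j, Φ^[j] w = w := fun j => Function.iterate_fixed hw j
  have hfv : ∀ (w : W), Φ w = w → ∀ v : G, f (φ v • w) = f (v • w) := by
    intro w hw v
    have hΦw : ∀ j, Φ^[j] w = w := fun j => Function.iterate_fixed hw j
    have e1 : f (φ v • w) = ∏ j ∈ Finset.range p, b (φ^[j + 1] v • w) := by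
      refine Finset.prod_congr rfl (fun j _ => ?_)
      rw [h.iterate_smul, hΦw, Function.iterate_succ_apply]
    have e2 : f (v • w) = ∏ j ∈ Finset.range p, b (φ^[j] v • w) := by
      refine Finset.prod_congr rfl (fun j _ => ?_)
      rw [h.iterate_smul, hΦw]
    rw [e1, e2]
    exact Finset.prod_range_add_one_of_eq (fun j => b (φ^[j] v • w)) (by rw [hp]; rfl)
  have hfp : ∀ (w : W), Φ w = w → ∀ v : G, φ v = v → f (v • w) = b (v • w) := by
    intro w hw v hv
    have : f (v • w) = ∏ j ∈ Finset.range p, b (v • w) := by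
      refine Finset.prod_congr rfl (fun j _ => ?_)
      rw [Function.iterate_fixed]
      rw [h.smul, hw, hv]
    rw [this, Finset.prod_const, Finset.card_range, ZMod.pow_card]
  simp only [l]
  rw [finsum_eq_finsum_fixed φ hp _ (fun v => by rw [hfv w hw, hfv τ.root h.root]) (hfin w)]
  rw [← finsum_set_coe_eq_finsum_mem {v | φ v = v}]
  change _ = ∑ᶠ q : fixedSubgroup φ, (f ((q : G) • w) - f ((q : G) • τ.root))
  refine finsum_congr (fun q => ?_)
  rw [hfp w hw q q.2, hfp τ.root h.root q q.2, hb]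

end FreeTree.Equivariant

namespace HasDecompLE
open FreeTree
variable {G : Type} [Group G]

lemma fixedSubgroup_of_prime {n p : ℕ} [Fact p.Prime] (hG : HasDecompLE n G) (α : G →* G)
    (hα : α^[p] = id) : HasDecompLE n (fixedSubgroup α) := by
  classical
  obtain ⟨ι, κ, _, _, A, x, hA, hN, hC, -, hc⟩ := hG
  have hinj : Function.Injective α := by
    have hp := (Fact.out : p.Prime).pos
    refine Function.Injective.of_comp (f := α^[p - 1]) ?_
    rw [← Function.iterate_succ, Nat.succ_eq_add_one, Nat.sub_add_cancel hp, hα]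
    exact Function.injective_id
  obtain ⟨Φ, hΦ⟩ := hA.exists_equivariant_of_injOn α hN hC
    (fun i q _ hq => hinj (hq.trans (map_one α).symm))
  obtain ⟨J, w, E, rank, ht, hw, hJ⟩ := hA.exists_triangular hN (fixedSubgroup α)
  have hfix : ∀ j, Φ (w j) = w j := by
    intro j
    obtain ⟨q, hq, ⟨h1, h2⟩ | h1⟩ := hw j
    · exact hΦ.fixed hq h1 h2
    · rw [h1]; exact hΦ.fixed_smul_root hq
  obtain ⟨hfin, hcard⟩ : Finite J ∧ Nat.card J ≤ n := by
    refine finite_and_card_le (fun f hf => ?_)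
    have := Fintype.ofFinite (ι ⊕ κ)
    let σ : (Fin (n + 1) → ZMod p) →ₗ[ZMod p] (ι ⊕ κ → ZMod p) :=
      LinearMap.pi fun i => ∑ j, (LinearMap.proj j).smulRight
        ((hA.tree.path (w (f j))).sum fun e n => if e.2 = i then (n : ZMod p) else 0)
    have hker : LinearMap.ker σ ≠ ⊥ := by
      refine LinearMap.ker_ne_bot_of_finrank_lt ?_
      rw [Module.finrank_fintype_fun_eq_card, Module.finrank_fintype_fun_eq_card, Fintype.card_fin,
        ← Nat.card_eq_fintype_card, Nat.card_sum]
      omega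
    obtain ⟨a, ha, ha0⟩ := (Submodule.ne_bot_iff _).1 hker
    refine ha0 ?_
    have hz := (ht.comp f hf).eq_zero (fun j _ => a j) (fun e => ?_)
    · funext j
      exact congrFun (congrFun hz j) 1
    · obtain ⟨c, hc⟩ := hΦ.exists_cocycle hα e
      simp only [Function.comp_apply]
      have : ∀ j, ∑ᶠ q : fixedSubgroup α, a j * (hA.tree.path (w (f j)) (act (q⁻¹ : G) e) : ZMod p) =
          ∑ i, a j * ((hA.tree.path (w (f j))).sum fun e n =>
            if e.2 = i then (n : ZMod p) else 0) * c i := by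
        intro j
        rw [← mul_finsum, hc _ (hfix _)]
        simp only [Finsupp.sum, Finset.mul_sum, Finset.sum_mul]
        rw [Finset.sum_comm]
        refine Finset.sum_congr rfl (fun e _ => ?_)
        rw [Finset.sum_eq_single e.2]
        · simp [mul_assoc]
        · intro i _ hi
          simp [Ne.symm hi]
        · simp
      simp only [this]
      rw [Finset.sum_comm]
      refine Finset.sum_eq_zero (fun i _ => ?_)
      rw [← Finset.sum_mul]
      have := congrFun (LinearMap.mem_ker.1 ha) i
      simp only [σ, LinearMap.pi_apply, LinearMap.sum_apply, LinearMap.smulRight_apply,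
        LinearMap.proj_apply, smul_eq_mul, Pi.zero_apply] at this
      rw [this, zero_mul]
  exact hJ n hfin hcard

end HasDecompLE

/-- The restriction of an endomorphism to an invariant subgroup. -/
def MonoidHom.restrictEnd {G : Type} [Group G] (φ : G →* G) (K : Subgroup G)
    (hK : ∀ g ∈ K, φ g ∈ K) : K →* K :=
  (φ.comp K.subtype).codRestrict K (fun g => hK g g.2)

lemma MonoidHom.coe_iterate_restrictEnd {G : Type} [Group G] (φ : G →* G) (K : Subgroup G)
    (hK : ∀ g ∈ K, φ g ∈ K) (n : ℕ) (g : K) :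
    (((φ.restrictEnd K hK)^[n] g : K) : G) = φ^[n] g := by
  induction n with
  | zero => rfl
  | succ n ih => rw [Function.iterate_succ_apply', Function.iterate_succ_apply', ← ih]; rfl

namespace HasDecompLE
variable {G : Type} [Group G] {n : ℕ}

lemma of_restrictEnd {φ : G →* G} {K : Subgroup G} {hK : ∀ g ∈ K, φ g ∈ K}
    (hle : fixedSubgroup φ ≤ K) (h : HasDecompLE n (fixedSubgroup (φ.restrictEnd K hK))) :
    HasDecompLE n (fixedSubgroup φ) := by
  have : fixedSubgroup (φ.restrictEnd K hK) = (fixedSubgroup φ).subgroupOf K := by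
    ext g
    exact Subtype.ext_iff
  rw [this] at h
  exact h.of_equiv (Subgroup.subgroupOfEquivOfLe hle)

/-- The fixed subgroup of an automorphism of finite order. -/
lemma fixedSubgroup_of_finite_order {M : ℕ} (hM : 0 < M) (hG : HasDecompLE n G) (α : G →* G)
    (hα : α^[M] = id) : HasDecompLE n (fixedSubgroup α) := by
  induction M using Nat.strong_induction_on generalizing G with
  | _ M ih =>
  by_cases h1 : M = 1
  · subst h1
    have : fixedSubgroup α = ⊤ := by
      ext g
      exact iff_of_true (congrFun hα g) trivial
    rw [this]
    exact hG.of_equiv Subgroup.topEquiv.symm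
  · obtain ⟨p, hp, M', rfl⟩ := Nat.exists_prime_and_dvd h1
    have hM' : 0 < M' := Nat.pos_of_mul_pos_left hM
    have : Fact p.Prime := ⟨hp⟩
    have hK := hG.fixedSubgroup_of_prime (iterHom α M') (p := p) (by
      rw [iterHom_eq_iterate, ← Function.iterate_mul, mul_comm, hα])
    have hmem : ∀ g, g ∈ fixedSubgroup (iterHom α M') ↔ α^[M'] g = g := fun g => by
      rw [← iterHom_eq_iterate]; rfl
    have hinv : ∀ g ∈ fixedSubgroup (iterHom α M'), α g ∈ fixedSubgroup (iterHom α M') := by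
      intro g hg
      rw [hmem] at hg ⊢
      rw [← Function.iterate_succ_apply, Function.iterate_succ_apply', hg]
    refine of_restrictEnd (K := fixedSubgroup (iterHom α M')) (hK := hinv) ?_ ?_
    · intro g hg
      rw [hmem]
      exact Function.iterate_fixed hg M'
    · refine ih M' ?_ hM' hK _ ?_
      · have := hp.two_le
        nlinarith
      · funext g
        refine Subtype.ext ?_
        rw [MonoidHom.coe_iterate_restrictEnd]
        exact (hmem g).1 g.2

end HasDecompLE

/-- The real Hilbert space of square summable functions. -/
abbrev L2 (X : Type) : Type := lp (fun _ : X => ℝ) 2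

namespace L2
variable {X Y Z : Type}

open Classical in
/-- The standard orthonormal basis. -/
noncomputable def delta (x : X) : L2 X := lp.single 2 x 1

lemma inner_delta (x : X) (a : L2 X) : inner ℝ (delta x) a = a x := by
  classical
  rw [delta, lp.inner_single_left]
  simp

lemma inner_delta' (x : X) (a : L2 X) : inner ℝ a (delta x) = a x := by
  rw [real_inner_comm, inner_delta]

open Classical in
lemma delta_apply (x y : X) : delta x y = if x = y then 1 else 0 := by
  rw [delta, lp.single_apply, Pi.single_apply]
  simp only [eq_comm]

lemma summable_sq (a : L2 X) : Summable fun x => a x ^ 2 := by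
  have := lp.summable_inner (𝕜 := ℝ) a a
  simpa [sq] using this

lemma inner_eq (a b : L2 X) : inner ℝ a b = ∑' x, a x * b x := by
  rw [lp.inner_eq_tsum]
  refine tsum_congr (fun x => ?_)
  simp [mul_comm]

lemma summable_mul (a b : L2 X) : Summable fun x => a x * b x := by
  have := lp.summable_inner (𝕜 := ℝ) a b
  simpa [mul_comm] using this

lemma clm_ext {F : Type*} [NormedAddCommGroup F] [NormedSpace ℝ F] {S T : L2 X →L[ℝ] F}
    (h : ∀ x, S (delta x) = T (delta x)) : S = T := by
  classical
  ext a
  have ha := lp.hasSum_single (p := 2) (by simp) a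
  have h1 := ha.mapL S
  have h2 := ha.mapL T
  refine h1.unique ?_
  convert h2 using 2 with x
  have : lp.single 2 x (a x) = a x • (delta x : L2 X) := by
    rw [delta, ← lp.single_smul]
    simp
  rw [this, map_smul, map_smul, h]

/-- Restriction of functions along an injective map. -/
noncomputable def pull (f : X ↪ Y) : L2 Y →L[ℝ] L2 X :=
  LinearMap.mkContinuous
    { toFun := fun b => ⟨fun x => b (f x), by
        refine memℓp_gen ?_
        refine ((summable_sq b).comp_injective f.injective).congr (fun x => ?_)
        simp⟩
      map_add' := fun _ _ => rfl
      map_smul' := fun _ _ => rfl } 1 (fun b => by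
        rw [one_mul]
        refine lp.norm_le_of_tsum_le (by simp) (norm_nonneg b) ?_
        rw [lp.norm_rpow_eq_tsum (by simp)]
        have h1 := summable_sq b
        have : Summable fun y => ‖b y‖ ^ (2 : ENNReal).toReal := by simpa using h1
        exact tsum_comp_le_tsum_of_inj this (fun y => by positivity) f.injective)

@[simp] lemma pull_apply (f : X ↪ Y) (b : L2 Y) (x : X) : pull f b x = b (f x) := rfl

/-- Extension by zero of functions along an injective map. -/
noncomputable def push (f : X ↪ Y) : L2 X →L[ℝ] L2 Y := (pull f).adjoint

lemma inner_push (f : X ↪ Y) (a : L2 X) (b : L2 Y) :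
    inner ℝ (push f a) b = inner ℝ a (pull f b) :=
  ContinuousLinearMap.adjoint_inner_left _ _ _

@[simp] lemma push_delta (f : X ↪ Y) (x : X) : push f (delta x) = delta (f x) := by
  refine ext_inner_right ℝ (fun b => ?_)
  rw [inner_push, inner_delta, inner_delta, pull_apply]

lemma pull_delta (f : X ↪ Y) (x : X) : pull f (delta (f x)) = delta x := by
  classical
  ext x'
  rw [pull_apply, delta_apply, delta_apply]
  simp

lemma pull_delta_of_notMem (f : X ↪ Y) {y : Y} (hy : y ∉ Set.range f) : pull f (delta y) = 0 := by
  classical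
  ext x'
  rw [pull_apply, delta_apply, if_neg (fun h => hy ⟨x', h.symm⟩)]
  rfl

@[simp] lemma pull_push (f : X ↪ Y) (a : L2 X) : pull f (push f a) = a := by
  have : (pull f).comp (push f) = ContinuousLinearMap.id ℝ (L2 X) :=
    clm_ext (fun x => by simp [pull_delta])
  exact DFunLike.congr_fun this a

lemma inner_push_push (f : X ↪ Y) (a b : L2 X) :
    inner ℝ (push f a) (push f b) = inner ℝ a b := by
  rw [inner_push, pull_push]

end L2

namespace L2
open FreeTree (act actEquiv)
variable {X Y Z : Type}

lemma comp_delta_apply (S : L2 Y →L[ℝ] L2 Z) (T : L2 X →L[ℝ] L2 Y) (x : X) (z : Z) :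
    S (T (delta x)) z = ∑' y, T (delta x) y * S (delta y) z := by
  rw [← inner_delta, ← ContinuousLinearMap.adjoint_inner_left, real_inner_comm, inner_eq]
  refine tsum_congr (fun y => ?_)
  rw [← inner_delta y (ContinuousLinearMap.adjoint S (delta z)),
    ContinuousLinearMap.adjoint_inner_right, inner_delta']

lemma summable_comp_delta (S : L2 Y →L[ℝ] L2 Z) (T : L2 X →L[ℝ] L2 Y) (x : X) (z : Z) :
    Summable fun y => T (delta x) y * S (delta y) z := by
  refine (summable_mul (T (delta x)) (ContinuousLinearMap.adjoint S (delta z))).congr (fun y => ?_)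
  rw [← inner_delta y (ContinuousLinearMap.adjoint S (delta z)),
    ContinuousLinearMap.adjoint_inner_right, inner_delta']

lemma adjoint_delta_apply (T : L2 X →L[ℝ] L2 Y) (x : X) (y : Y) :
    ContinuousLinearMap.adjoint T (delta y) x = T (delta x) y := by
  rw [← inner_delta x, ContinuousLinearMap.adjoint_inner_right, inner_delta']

variable {Γ α β δ : Type} [Group Γ]

/-- The matrix coefficients of an operator are invariant under translations. -/
def IsEquivariant (T : L2 (Γ × α) →L[ℝ] L2 (Γ × β)) : Prop :=
  ∀ (g : Γ) p q, T (delta (act g p)) (act g q) = T (delta p) q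

lemma IsEquivariant.comp {S : L2 (Γ × β) →L[ℝ] L2 (Γ × δ)} {T : L2 (Γ × α) →L[ℝ] L2 (Γ × β)}
    (hS : IsEquivariant S) (hT : IsEquivariant T) : IsEquivariant (S.comp T) := by
  intro g p q
  rw [ContinuousLinearMap.comp_apply, ContinuousLinearMap.comp_apply, comp_delta_apply,
    comp_delta_apply, ← (actEquiv g).tsum_eq]
  refine tsum_congr (fun y => ?_)
  change T (delta (act g p)) (act g y) * S (delta (act g y)) (act g q) = _
  rw [hS, hT]

lemma IsEquivariant.adjoint {T : L2 (Γ × α) →L[ℝ] L2 (Γ × β)} (hT : IsEquivariant T) :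
    IsEquivariant (ContinuousLinearMap.adjoint T) := by
  intro g p q
  rw [adjoint_delta_apply, adjoint_delta_apply, hT]

lemma IsEquivariant.add {S T : L2 (Γ × α) →L[ℝ] L2 (Γ × β)} (hS : IsEquivariant S)
    (hT : IsEquivariant T) : IsEquivariant (S + T) := by
  intro g p q
  change S _ _ + T _ _ = S _ _ + T _ _
  rw [hS, hT]

lemma IsEquivariant.sub {S T : L2 (Γ × α) →L[ℝ] L2 (Γ × β)} (hS : IsEquivariant S)
    (hT : IsEquivariant T) : IsEquivariant (S - T) := by
  intro g p q
  change S _ _ - T _ _ = S _ _ - T _ _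
  rw [hS, hT]

lemma IsEquivariant.smul (t : ℝ) {T : L2 (Γ × α) →L[ℝ] L2 (Γ × β)}
    (hT : IsEquivariant T) : IsEquivariant (t • T) := by
  intro g p q
  change t * T _ _ = t * T _ _
  rw [hT]

lemma isEquivariant_zero : IsEquivariant (0 : L2 (Γ × α) →L[ℝ] L2 (Γ × β)) :=
  fun _ _ _ => rfl

/-- The von Neumann trace. -/
noncomputable def trace [Fintype α] (T : L2 (Γ × α) →L[ℝ] L2 (Γ × α)) : ℝ :=
  ∑ j, T (delta (1, j)) (1, j)

lemma trace_sub [Fintype α] (S T : L2 (Γ × α) →L[ℝ] L2 (Γ × α)) :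
    trace (S - T) = trace S - trace T := by
  rw [trace, trace, trace, ← Finset.sum_sub_distrib]
  rfl

lemma trace_one [Fintype α] : trace (1 : L2 (Γ × α) →L[ℝ] L2 (Γ × α)) = Fintype.card α := by
  classical
  simp [trace, delta_apply]

lemma trace_comp_comm [Fintype α] [Fintype β] {S : L2 (Γ × β) →L[ℝ] L2 (Γ × α)}
    {T : L2 (Γ × α) →L[ℝ] L2 (Γ × β)} (hS : IsEquivariant S) (hT : IsEquivariant T) :
    trace (S.comp T) = trace (T.comp S) := by
  have key : ∀ {α β : Type} [Fintype α] [Fintype β] (S : L2 (Γ × β) →L[ℝ] L2 (Γ × α))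
      (T : L2 (Γ × α) →L[ℝ] L2 (Γ × β)), trace (S.comp T) =
      ∑ j, ∑ i, ∑' γ : Γ, T (delta (1, j)) (γ, i) * S (delta (γ, i)) (1, j) := by
    intro α β _ _ S T
    refine Finset.sum_congr rfl (fun j _ => ?_)
    rw [ContinuousLinearMap.comp_apply, comp_delta_apply]
    have hs := summable_comp_delta S T (1, j) (1, j)
    rw [← (Equiv.prodComm β Γ).tsum_eq]
    have hs' := (Equiv.prodComm β Γ).summable_iff.mpr hs
    exact hs'.tsum_prod.trans (tsum_fintype _)
  rw [key, key, Finset.sum_comm]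
  refine Finset.sum_congr rfl (fun i _ => Finset.sum_congr rfl (fun j _ => ?_))
  rw [← (Equiv.inv Γ).tsum_eq]
  refine tsum_congr (fun γ => ?_)
  have h1 := hT γ (1, j) (γ⁻¹, i)
  have h2 := hS γ (γ⁻¹, i) (1, j)
  simp only [act, mul_one, mul_inv_cancel] at h1 h2
  rw [Equiv.inv_apply, ← h1, ← h2, mul_comm]

lemma IsEquivariant.exists_contraction [Fintype α] [Fintype β] {R : L2 (Γ × α) →L[ℝ] L2 (Γ × β)}
    (hR : IsEquivariant R) (hlt : Fintype.card β < Fintype.card α) :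
    ∃ T : L2 (Γ × α) →L[ℝ] L2 (Γ × α), ‖T‖ ≤ 1 ∧ (∀ x, T x = x → R x = 0) ∧
      ∀ k : ℕ, 1 ≤ trace (T ^ k) := by
  obtain ⟨t, ht, htR⟩ : ∃ t : ℝ, 0 < t ∧ t * ‖R‖ ^ 2 ≤ 1 := by
    refine ⟨1 / (‖R‖ ^ 2 + 1), by positivity, ?_⟩
    rw [div_mul_eq_mul_div, div_le_one (by positivity)]
    linarith
  let R' := ContinuousLinearMap.adjoint R
  let S : L2 (Γ × α) →L[ℝ] L2 (Γ × α) := 1 - t • R'.comp R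
  let S' : L2 (Γ × β) →L[ℝ] L2 (Γ × β) := 1 - t • R.comp R'
  have hC : ∀ N : ℕ, ∃ C : L2 (Γ × β) →L[ℝ] L2 (Γ × α), IsEquivariant C ∧
      S ^ N = 1 - C.comp R ∧ S' ^ N = 1 - R.comp C := by
    intro N
    induction N with
    | zero => exact ⟨0, isEquivariant_zero, by simp, by simp⟩
    | succ N ih =>
      obtain ⟨C, h0, h1, h2⟩ := ih
      refine ⟨C + t • R' - t • R'.comp (R.comp C),
        (h0.add (hR.adjoint.smul t)).sub ((hR.adjoint.comp (hR.comp h0)).smul t), ?_, ?_⟩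
      · rw [pow_succ', h1]
        ext x : 1
        simp [S, sub_eq_add_neg, smul_add]
        abel
      · rw [pow_succ', h2]
        ext x : 1
        simp [S', sub_eq_add_neg, smul_add]
        abel
  have hS' : ∀ x y, inner ℝ (S' x) y = inner ℝ x (S' y) := by
    intro x y
    simp [S', R', inner_sub_left, inner_sub_right, real_inner_smul_left, real_inner_smul_right]
    rw [← ContinuousLinearMap.adjoint_inner_left, ← ContinuousLinearMap.adjoint_inner_right]
    simp [ContinuousLinearMap.adjoint_inner_left]
  have hS'k : ∀ (k : ℕ) x y, inner ℝ ((S' ^ k) x) y = inner ℝ x ((S' ^ k) y) := by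
    intro k
    induction k with
    | zero => simp
    | succ k ih =>
      intro x y
      rw [pow_succ, mul_apply_eq_comp, ih, hS', ← mul_apply_eq_comp,
        ← pow_succ', ← pow_succ]
  have htr : ∀ k : ℕ, (1 : ℝ) ≤ trace ((S ^ 2) ^ k) := by
    intro k
    rw [← pow_mul]
    obtain ⟨C, h0, h1, h2⟩ := hC (2 * k)
    have h3 : 0 ≤ trace (S' ^ (2 * k)) := by
      refine Finset.sum_nonneg (fun j _ => ?_)
      rw [← inner_delta, two_mul, pow_add, mul_apply_eq_comp, ← hS'k]
      exact real_inner_self_nonneg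
    have h4 : trace (S ^ (2 * k)) = trace (S' ^ (2 * k)) + Fintype.card α - Fintype.card β := by
      rw [h1, h2, trace_sub, trace_sub, trace_one, trace_one, trace_comp_comm h0 hR]
      ring
    have h5 : (Fintype.card β : ℝ) + 1 ≤ Fintype.card α := by exact_mod_cast hlt
    linarith
  have hSx : ∀ x, ‖S x‖ ^ 2 ≤ ‖x‖ ^ 2 - t * ‖R x‖ ^ 2 := by
    intro x
    have h1 : S x = x - t • R' (R x) := rfl
    have h2 : inner ℝ x (R' (R x)) = ‖R x‖ ^ 2 := by
      rw [ContinuousLinearMap.adjoint_inner_right, real_inner_self_eq_norm_sq]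
    have h3 : ‖R' (R x)‖ ≤ ‖R‖ * ‖R x‖ := by
      refine (R'.le_opNorm _).trans_eq ?_
      rw [LinearIsometryEquiv.norm_map]
    have h4 : ‖R' (R x)‖ ^ 2 ≤ ‖R‖ ^ 2 * ‖R x‖ ^ 2 := by
      rw [← mul_pow]
      gcongr
    have h5 : t ^ 2 * ‖R' (R x)‖ ^ 2 ≤ t * ‖R x‖ ^ 2 :=
      calc t ^ 2 * ‖R' (R x)‖ ^ 2 ≤ t ^ 2 * (‖R‖ ^ 2 * ‖R x‖ ^ 2) := by gcongr
        _ = t * ‖R‖ ^ 2 * (t * ‖R x‖ ^ 2) := by ring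
        _ ≤ 1 * (t * ‖R x‖ ^ 2) := by gcongr
        _ = _ := one_mul _
    rw [h1, norm_sub_sq_real, real_inner_smul_right, h2, norm_smul, mul_pow, Real.norm_eq_abs,
      sq_abs]
    linarith
  have hSle : ∀ x, ‖S x‖ ≤ ‖x‖ := by
    intro x
    have := hSx x
    have h1 : 0 ≤ t * ‖R x‖ ^ 2 := by positivity
    exact le_of_sq_le_sq (by linarith) (norm_nonneg _)
  have hT : ‖S ^ 2‖ ≤ 1 := by
    refine ContinuousLinearMap.opNorm_le_bound _ zero_le_one (fun x => ?_)
    rw [one_mul, sq, mul_apply_eq_comp]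
    exact (hSle _).trans (hSle _)
  have hker : ∀ x, (S ^ 2) x = x → R x = 0 := by
    intro x hx
    rw [sq, mul_apply_eq_comp] at hx
    have h1 := hSle (S x)
    rw [hx] at h1
    have h2 := hSx x
    have h3 : ‖x‖ ^ 2 ≤ ‖S x‖ ^ 2 := by gcongr
    have h4 : ‖R x‖ ^ 2 ≤ 0 := by
      by_contra h
      push Not at h
      have := mul_pos ht h
      linarith
    simpa using le_antisymm h4 (by positivity)
  exact ⟨S ^ 2, hT, hker, htr⟩

/-- An equivariant operator to a space of smaller dimension has nonzero kernel. -/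
theorem IsEquivariant.exists_ker [Fintype α] [Fintype β] {R : L2 (Γ × α) →L[ℝ] L2 (Γ × β)}
    (hR : IsEquivariant R) (hlt : Fintype.card β < Fintype.card α) :
    ∃ y, R y = 0 ∧ ∃ j, y (1, j) ≠ 0 := by
  by_contra hcon
  push Not at hcon
  obtain ⟨T, hT, hker, htr⟩ := hR.exists_contraction hlt
  have hlim : ∀ x, ∃ z, T z = z ∧
      Filter.Tendsto (birkhoffAverage ℝ T _root_.id · x) Filter.atTop (nhds z) := fun x =>
    ⟨_, LinearMap.mem_eqLocus.mp (Subtype.prop _),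
      ContinuousLinearMap.tendsto_birkhoffAverage_orthogonalProjection T hT x⟩
  choose z hz hlim using hlim
  have hsum : Filter.Tendsto (fun N => ∑ j, inner ℝ (delta ((1 : Γ), j))
      (birkhoffAverage ℝ T _root_.id N (delta ((1 : Γ), j)))) Filter.atTop (nhds 0) := by
    have h0 : (0 : ℝ) = ∑ j : α, inner ℝ (delta ((1 : Γ), j))
        (z (delta ((1 : Γ), j))) := by
      refine (Finset.sum_eq_zero (fun j _ => ?_)).symm
      rw [inner_delta]
      exact hcon _ (hker _ (hz _)) j
    rw [h0]
    exact tendsto_finsetSum _ (fun j _ => tendsto_const_nhds.inner (hlim _))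
  have hge : ∀ᶠ N : ℕ in Filter.atTop, (1 : ℝ) ≤ ∑ j, inner ℝ (delta ((1 : Γ), j))
      (birkhoffAverage ℝ T _root_.id N (delta ((1 : Γ), j))) := by
    filter_upwards [Filter.eventually_gt_atTop 0] with N hN
    have h1 : ∑ j, inner ℝ (delta ((1 : Γ), j))
      (birkhoffAverage ℝ T _root_.id N (delta ((1 : Γ), j))) =
        (N : ℝ)⁻¹ * ∑ k ∈ Finset.range N, trace (T ^ k) := by
      simp only [trace, birkhoffAverage, birkhoffSum, inner_smul_right, inner_sum]
      rw [← Finset.mul_sum, Finset.sum_comm]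
      congr 1
      refine Finset.sum_congr rfl (fun k _ => Finset.sum_congr rfl (fun j _ => ?_))
      rw [inner_delta, FunLike.coe_pow_eq_iterate]
      rfl
    rw [h1]
    have h2 : (N : ℝ) ≤ ∑ k ∈ Finset.range N, trace (T ^ k) := by
      calc (N : ℝ) = ∑ k ∈ Finset.range N, (1 : ℝ) := by simp
        _ ≤ _ := Finset.sum_le_sum (fun k _ => htr k)
    rw [inv_mul_eq_div, one_le_div (by exact_mod_cast hN)]
    exact h2
  exact absurd (ge_of_tendsto hsum hge) (by norm_num)

end L2

namespace L2
open FreeTree (act actEquiv chainAct)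
variable {X Γ α β : Type} [Group Γ]

/-- The square summable function given by an integral chain. -/
noncomputable def ofChain : (X →₀ ℤ) →+ L2 X :=
  Finsupp.liftAddHom fun e => zmultiplesHom (L2 X) (delta e)

@[simp] lemma ofChain_single (e : X) (n : ℤ) :
    ofChain (Finsupp.single e n) = n • (delta e : L2 X) := by
  simp [ofChain]

lemma ofChain_apply (a : X →₀ ℤ) (e : X) : ofChain a e = (a e : ℝ) := by
  classical
  induction a using Finsupp.induction_linear with
  | zero => simp
  | add a b ha hb =>
    rw [map_add]
    change ofChain a e + ofChain b e = _
    rw [ha, hb]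
    simp
  | single e' n =>
    rw [ofChain_single, Finsupp.single_apply]
    change n • (delta e' : L2 X) e = _
    rw [delta_apply]
    split_ifs <;> simp

/-- Right translation. -/
def rightMul (e : Γ × β) : Γ ↪ Γ × β where
  toFun γ := act γ e
  inj' a b h := by simpa [act] using h

/-- The inclusion of a summand. -/
def summand (j : α) : Γ ↪ Γ × α where
  toFun γ := (γ, j)
  inj' a b h := by simpa using h

/-- The equivariant operator taking basis elements to given chains. -/
noncomputable def conv [Fintype α] (c : α → (Γ × β →₀ ℤ)) :
    L2 (Γ × α) →L[ℝ] L2 (Γ × β) :=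
  ∑ j, ((c j).sum fun e n => n • push (rightMul e)).comp (pull (summand j))

lemma ofChain_chainAct (q : Γ) (a : Γ × β →₀ ℤ) :
    ofChain (chainAct q a) = a.sum fun e n => n • (delta (act q e) : L2 (Γ × β)) := by
  induction a using Finsupp.induction_linear with
  | zero => simp
  | add a b ha hb =>
    rw [map_add, map_add, ha, hb, Finsupp.sum_add_index' (by simp) (by intros; rw [add_smul])]
  | single e n => rw [FreeTree.chainAct_single, ofChain_single, Finsupp.sum_single_index (by simp)]

lemma conv_delta [Fintype α] (c : α → (Γ × β →₀ ℤ)) (q : Γ) (j : α) :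
    conv c (delta (q, j)) = ofChain (chainAct q (c j)) := by
  classical
  rw [conv, sum_apply, Finset.sum_eq_single j, ofChain_chainAct,
    ContinuousLinearMap.comp_apply]
  · have h1 : pull (summand j) (delta (q, j)) = delta q := pull_delta (summand j) q
    rw [h1, Finsupp.sum, Finsupp.sum, sum_apply]
    refine Finset.sum_congr rfl (fun e _ => ?_)
    change (c j e) • push (rightMul e) (delta q) = _
    rw [push_delta]
    rfl
  · intro j' _ hj
    rw [ContinuousLinearMap.comp_apply, pull_delta_of_notMem, map_zero]
    rintro ⟨γ, hγ⟩
    exact hj (Prod.ext_iff.mp hγ).2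
  · simp

lemma isEquivariant_conv [Fintype α] (c : α → (Γ × β →₀ ℤ)) : IsEquivariant (conv c) := by
  rintro g ⟨q, j⟩ p
  change conv c (delta (g * q, j)) _ = _
  rw [conv_delta, conv_delta, ofChain_apply, ofChain_apply, FreeTree.chainAct_mul]
  simp [FreeTree.chainAct_apply]

lemma inner_conv [Fintype α] (c : α → (Γ × β →₀ ℤ)) (x : L2 (Γ × α)) (t : L2 (Γ × β)) :
    inner ℝ (conv c x) t =
      ∑ j, (c j).sum fun e n => (n : ℝ) * ∑' γ, x (γ, j) * t (act γ e) := by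
  rw [conv, sum_apply, sum_inner]
  refine Finset.sum_congr rfl (fun j _ => ?_)
  rw [ContinuousLinearMap.comp_apply, Finsupp.sum, Finsupp.sum, sum_apply, sum_inner]
  refine Finset.sum_congr rfl (fun e _ => ?_)
  change inner ℝ ((c j e) • push (rightMul e) (pull (summand j) x)) t = _
  rw [← Int.cast_smul_eq_zsmul ℝ, real_inner_smul_left, inner_push, inner_eq]
  rfl

/-- The map induced by a self-embedding. -/
def mapFst (f : Γ ↪ Γ) (α : Type) : Γ × α ↪ Γ × α := f.prodMap (Function.Embedding.refl α)

lemma eq_zero_of_infinite (a : L2 X) (f : ℕ → X) (hf : Function.Injective f) (C : ℝ)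
    (h : ∀ n, a (f n) = C) : C = 0 := by
  have h1 := (summable_sq a).comp_injective hf
  have h2 := h1.tendsto_atTop_zero
  have h3 : Filter.Tendsto (fun _ : ℕ => C ^ 2) Filter.atTop (nhds 0) :=
    h2.congr (fun n => by simp [h])
  have := tendsto_nhds_unique h3 tendsto_const_nhds
  simpa using this.symm

/-- Chains in a space of smaller dimension satisfy a relation whose coefficients are supported on
the periodic points of a compatible injective endomorphism. -/
theorem exists_invariant_relation [Fintype α] [Fintype β] (hlt : Fintype.card β < Fintype.card α)
    (φ : Γ →* Γ) (hφ : Function.Injective φ) (y : α → (Γ × β →₀ ℤ)) (b : β → (Γ × β →₀ ℤ))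
    (hy : ∀ j, y j = (y j).sum fun e n => n • chainAct (φ e.1) (b e.2)) :
    ∃ x : L2 (Γ × α), (∃ p, x p ≠ 0) ∧ conv y x = 0 ∧ (∀ γ j, x (φ γ, j) = x (γ, j)) ∧
      ∀ γ j, x (γ, j) ≠ 0 → ∃ M, 0 < M ∧ φ^[M] γ = γ := by
  obtain ⟨z, hz, j, hj⟩ := (isEquivariant_conv y).exists_ker hlt
  let V := push (mapFst ⟨φ, hφ⟩ α)
  let V' := push (mapFst ⟨φ, hφ⟩ β)
  have hVd : ∀ q j, V (delta (q, j)) = delta (φ q, j) := fun q j => push_delta _ _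
  have hV'd : ∀ q j, V' (delta (q, j)) = delta (φ q, j) := fun q j => push_delta _ _
  have hchain : ∀ q (a : Γ × β →₀ ℤ), conv b (V' (ofChain (chainAct q a))) =
      ofChain (chainAct (φ q) (a.sum fun e n => n • chainAct (φ e.1) (b e.2))) := by
    intro q a
    induction a using Finsupp.induction_linear with
    | zero => simp
    | add a b ha hb =>
      rw [map_add, map_add, map_add, map_add, ha, hb,
        Finsupp.sum_add_index' (by simp) (by intros; rw [add_smul]), map_add, map_add]
    | single e n =>
      rw [FreeTree.chainAct_single, ofChain_single, map_zsmul, map_zsmul,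
        Finsupp.sum_single_index (by simp), map_zsmul, map_zsmul]
      change n • conv b (V' (delta (q * e.1, e.2))) = _
      rw [hV'd, conv_delta, map_mul, FreeTree.chainAct_mul]
  have hVV : ∀ x, conv y (V x) = conv b (V' (conv y x)) := by
    have : (conv y).comp V = (conv b).comp (V'.comp (conv y)) := by
      refine clm_ext (fun ⟨q, j⟩ => ?_)
      rw [ContinuousLinearMap.comp_apply, ContinuousLinearMap.comp_apply,
        ContinuousLinearMap.comp_apply, hVd, conv_delta, conv_delta, hchain, ← hy]
    exact fun x => DFunLike.congr_fun this x
  let K : Submodule ℝ (L2 (Γ × α)) := (conv y).ker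
  have : CompleteSpace K := (conv y).isClosed_ker.completeSpace_coe
  let e : L2 (Γ × α) := delta (1, j)
  let x : L2 (Γ × α) := K.starProjection e
  have hxK : x ∈ K := K.starProjection_apply_mem e
  have hin : ∀ k ∈ K, inner ℝ x k = inner ℝ e k := by
    intro k hk
    have := K.starProjection_inner_eq_zero e k hk
    rw [inner_sub_left] at this
    linarith
  have hxk : conv y x = 0 := hxK
  have hVx : V x = x := by
    have hVxK : V x ∈ K := by
      change conv y (V x) = 0
      rw [hVV, hxk, map_zero, map_zero]
    have hVe : V e = e := by
      rw [hVd, map_one]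
    have h1 : inner ℝ (V x) (V x) = inner ℝ x x := inner_push_push _ _ _
    have h2 : inner ℝ x (V x) = inner ℝ x x := by
      rw [hin _ hVxK, ← hVe, inner_push_push, hin _ hxK]
    have h3 : inner ℝ (V x - x) (V x - x) = (0 : ℝ) := by
      rw [inner_sub_left, inner_sub_right, inner_sub_right, h1, h2, real_inner_comm x (V x), h2]
      ring
    exact sub_eq_zero.mp (inner_self_eq_zero.mp h3)
  have hinv : ∀ γ j, x (φ γ, j) = x (γ, j) := by
    intro γ j
    have : pull (mapFst ⟨φ, hφ⟩ α) x = x := by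
      conv_lhs => rw [← hVx]
      exact pull_push _ _
    exact congrArg (fun a : L2 (Γ × α) => a (γ, j)) this
  refine ⟨x, ?_, hxk, hinv, ?_⟩
  · by_contra h0
    push Not at h0
    have h1 : x = 0 := by
      ext p
      exact h0 p
    have h2 := hin z hz
    rw [h1, inner_zero_left, inner_delta] at h2
    exact hj h2.symm
  · intro γ j hne
    by_contra hper
    push Not at hper
    refine hne (eq_zero_of_infinite x (fun n => (φ^[n] γ, j)) ?_ _ ?_)
    · have key : ∀ m n : ℕ, m < n → φ^[m] γ ≠ φ^[n] γ := by
        intro m n hmn h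
        obtain ⟨d, rfl⟩ := Nat.exists_eq_add_of_lt hmn
        rw [add_assoc, Function.iterate_add_apply] at h
        exact hper (d + 1) (by omega) ((hφ.iterate m) h).symm
      intro m n h
      have h : φ^[m] γ = φ^[n] γ := (Prod.ext_iff.mp h).1
      rcases lt_trichotomy m n with hmn | hmn | hmn
      · exact absurd h (key m n hmn)
      · exact hmn
      · exact absurd h.symm (key n m hmn)
    · intro n
      induction n with
      | zero => rfl
      | succ n ih =>
        rw [Function.iterate_succ_apply', hinv, ih]

end L2

section Periodic
variable {G : Type} [Group G]

/-- The subgroup of periodic points of an endomorphism. -/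
def periodicSubgroup (φ : G →* G) : Subgroup G where
  carrier := {g | ∃ M, 0 < M ∧ φ^[M] g = g}
  one_mem' := ⟨1, one_pos, map_one φ⟩
  mul_mem' := by
    rintro a b ⟨M, hM, ha⟩ ⟨N, hN, hb⟩
    refine ⟨M * N, by positivity, ?_⟩
    have h1 : φ^[M * N] a = a := by rw [Function.iterate_mul, Function.iterate_fixed ha]
    have h2 : φ^[M * N] b = b := by rw [mul_comm, Function.iterate_mul, Function.iterate_fixed hb]
    rw [iterate_map_mul, h1, h2]
  inv_mem' := by
    rintro a ⟨M, hM, ha⟩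
    exact ⟨M, hM, by rw [iterate_map_inv, ha]⟩

lemma mem_periodicSubgroup {φ : G →* G} {g : G} :
    g ∈ periodicSubgroup φ ↔ ∃ M, 0 < M ∧ φ^[M] g = g := Iff.rfl

/-- The elements killed by some power of an endomorphism. -/
def eventualKer (φ : G →* G) : Subgroup G where
  carrier := {g | ∃ k, φ^[k] g = 1}
  one_mem' := ⟨0, rfl⟩
  mul_mem' := by
    rintro a b ⟨M, ha⟩ ⟨N, hb⟩
    refine ⟨M + N, ?_⟩
    rw [iterate_map_mul, add_comm, Function.iterate_add_apply, ha, add_comm,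
      Function.iterate_add_apply, hb, iterate_map_one, iterate_map_one, one_mul]
  inv_mem' := by
    rintro a ⟨M, ha⟩
    exact ⟨M, by rw [iterate_map_inv, ha, inv_one]⟩

lemma mem_eventualKer {φ : G →* G} {g : G} : g ∈ eventualKer φ ↔ ∃ k, φ^[k] g = 1 := Iff.rfl

instance (φ : G →* G) : (eventualKer φ).Normal where
  conj_mem := by
    rintro a ⟨M, ha⟩ g
    exact ⟨M, by rw [iterate_map_mul, iterate_map_mul, ha, mul_one, ← iterate_map_mul,
      mul_inv_cancel, iterate_map_one]⟩

namespace eventualKer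
variable (φ : G →* G)

lemma mk_eq_iff {g h : G} : (g : G ⧸ eventualKer φ) = h ↔ ∃ k, φ^[k] g = φ^[k] h := by
  rw [QuotientGroup.eq, mem_eventualKer]
  refine exists_congr (fun k => ?_)
  rw [iterate_map_mul, iterate_map_inv, inv_mul_eq_one]

/-- The endomorphism of the quotient by the eventual kernel. -/
def quotientMap : G ⧸ eventualKer φ →* G ⧸ eventualKer φ :=
  QuotientGroup.map _ _ φ (by
    rintro g ⟨k, hk⟩
    exact ⟨k, by rw [← Function.iterate_succ_apply, Function.iterate_succ_apply', hk, map_one]⟩)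

lemma quotientMap_mk (g : G) : quotientMap φ (g : G ⧸ eventualKer φ) = (φ g : G) := rfl

lemma quotientMap_iterate_mk (k : ℕ) (g : G) :
    (quotientMap φ)^[k] (g : G ⧸ eventualKer φ) = (φ^[k] g : G) := by
  induction k with
  | zero => rfl
  | succ k ih => rw [Function.iterate_succ_apply', Function.iterate_succ_apply', ih]; rfl

lemma quotientMap_injective : Function.Injective (quotientMap φ) := by
  intro a b
  induction a using QuotientGroup.induction_on with | _ a
  induction b using QuotientGroup.induction_on with | _ b
  rw [quotientMap_mk, quotientMap_mk, mk_eq_iff, mk_eq_iff]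
  rintro ⟨k, hk⟩
  exact ⟨k + 1, hk⟩

lemma eq_of_iterate_eq {p q : G} (hp : p ∈ periodicSubgroup φ) (hq : q ∈ periodicSubgroup φ)
    {k : ℕ} (h : φ^[k] p = φ^[k] q) : p = q := by
  obtain ⟨M, hM, hr⟩ := (periodicSubgroup φ).mul_mem ((periodicSubgroup φ).inv_mem hp) hq
  have h1 : φ^[k] (p⁻¹ * q) = 1 := by
    rw [iterate_map_mul, iterate_map_inv, h, inv_mul_cancel]
  have h2 : φ^[M * k] (p⁻¹ * q) = 1 := by
    obtain ⟨l, hl⟩ := Nat.exists_eq_add_of_le (Nat.le_mul_of_pos_left k hM)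
    rw [hl, add_comm, Function.iterate_add_apply, h1, iterate_map_one]
  rw [Function.iterate_mul, Function.iterate_fixed hr] at h2
  exact inv_mul_eq_one.mp h2

lemma mk_injective {p q : G} (hp : p ∈ periodicSubgroup φ) (hq : q ∈ periodicSubgroup φ)
    (h : (p : G ⧸ eventualKer φ) = q) : p = q := by
  obtain ⟨k, hk⟩ := (mk_eq_iff φ).mp h
  exact eq_of_iterate_eq φ hp hq hk

lemma exists_lift {γ : G ⧸ eventualKer φ} {M : ℕ} (hM : 0 < M) (h : (quotientMap φ)^[M] γ = γ) :
    ∃ q ∈ periodicSubgroup φ, (q : G ⧸ eventualKer φ) = γ := by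
  induction γ using QuotientGroup.induction_on with | _ g
  have h' := h
  rw [quotientMap_iterate_mk, mk_eq_iff] at h
  obtain ⟨k, hk⟩ := h
  refine ⟨φ^[M * k] g, ⟨M, hM, ?_⟩, ?_⟩
  · obtain ⟨l, hl⟩ := Nat.exists_eq_add_of_le (Nat.le_mul_of_pos_left k hM)
    rw [← Function.iterate_add_apply, add_comm, Function.iterate_add_apply, hl, add_comm,
      Function.iterate_add_apply, hk, ← Function.iterate_add_apply]
  · rw [← quotientMap_iterate_mk, Function.iterate_mul, Function.iterate_fixed h']

lemma iterate_mem {q : G} (hq : q ∈ periodicSubgroup φ) (k : ℕ) :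
    φ^[k] q ∈ periodicSubgroup φ := by
  obtain ⟨M, hM, hr⟩ := hq
  exact ⟨M, hM, by rw [← Function.iterate_add_apply, add_comm, Function.iterate_add_apply, hr]⟩

/-- An iterate as a permutation of the periodic points. -/
noncomputable def iterateEquiv (k : ℕ) : periodicSubgroup φ ≃ periodicSubgroup φ :=
  Equiv.ofBijective (fun q => ⟨φ^[k] q, iterate_mem φ q.2 k⟩) (by
    refine ⟨fun p q h => Subtype.ext (eq_of_iterate_eq φ p.2 q.2 (congrArg Subtype.val h)), ?_⟩
    rintro ⟨q, M, hM, hq⟩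
    obtain ⟨l, hl⟩ := Nat.exists_eq_add_of_le (Nat.le_mul_of_pos_left k hM)
    refine ⟨⟨φ^[l] q, iterate_mem φ ⟨M, hM, hq⟩ l⟩, Subtype.ext ?_⟩
    change φ^[k] (φ^[l] q) = q
    rw [← Function.iterate_add_apply, ← hl, Function.iterate_mul, Function.iterate_fixed hq])

/-- Finitely many cosets of periodic points that agree in the quotient agree after some iterate. -/
lemma exists_uniform (S : Finset G) : ∃ k, ∀ g ∈ S, ∀ g' ∈ S, ∀ q ∈ periodicSubgroup φ,
    ∀ q' ∈ periodicSubgroup φ, ((q * g : G) : G ⧸ eventualKer φ) = (q' * g' : G) →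
      φ^[k] (q * g) = φ^[k] (q' * g') := by
  have key : ∀ g g', ∃ k0, ∀ k, k0 ≤ k → ∀ q ∈ periodicSubgroup φ, ∀ q' ∈ periodicSubgroup φ,
      ((q * g : G) : G ⧸ eventualKer φ) = (q' * g' : G) → φ^[k] (q * g) = φ^[k] (q' * g') := by
    intro g g'
    by_cases h : ∃ p ∈ periodicSubgroup φ, ((p * g : G) : G ⧸ eventualKer φ) = g'
    · obtain ⟨p, hp, h⟩ := h
      obtain ⟨k0, hk0⟩ := (mk_eq_iff φ).mp h
      refine ⟨k0, fun k hk q hq q' hq' heq => ?_⟩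
      have h1 : q'⁻¹ * q = p := by
        refine mk_injective φ (mul_mem (inv_mem hq') hq) hp ?_
        rw [QuotientGroup.mk_mul, QuotientGroup.mk_mul] at heq
        rw [QuotientGroup.mk_mul] at h
        rw [QuotientGroup.mk_mul, QuotientGroup.mk_inv, inv_mul_eq_iff_eq_mul]
        apply mul_right_cancel (b := (g : G ⧸ eventualKer φ))
        rw [heq, mul_assoc, h]
      obtain rfl : q = q' * p := by rw [← h1, mul_inv_cancel_left]
      obtain ⟨l, rfl⟩ := Nat.exists_eq_add_of_le hk
      rw [mul_assoc, iterate_map_mul, iterate_map_mul _ _ q', add_comm,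
        Function.iterate_add_apply _ _ _ (p * g), hk0, ← Function.iterate_add_apply]
    · refine ⟨0, fun k _ q hq q' hq' heq => absurd ⟨q'⁻¹ * q, mul_mem (inv_mem hq') hq, ?_⟩ h⟩
      rw [mul_assoc, QuotientGroup.mk_mul, heq, QuotientGroup.mk_mul, QuotientGroup.mk_inv,
        inv_mul_cancel_left]
  choose K hK using key
  refine ⟨S.sup fun g => S.sup (K g), fun g hg g' hg' => hK g g' _ ?_⟩
  exact (Finset.le_sup (f := K g) hg').trans (Finset.le_sup (f := fun g => S.sup (K g)) hg)

end eventualKer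
end Periodic

namespace FreeTree
variable {G W I : Type} [Group G] [MulAction G W] {τ : FreeTree G W I}

/-- Pushing a chain forward along a homomorphism of groups. -/
noncomputable def mapChain {Γ : Type} [Group Γ] (π : G →* Γ) : (G × I →₀ ℤ) →+ (Γ × I →₀ ℤ) :=
  Finsupp.mapDomain.addMonoidHom (Prod.map π id)

lemma mapChain_single {Γ : Type} [Group Γ] (π : G →* Γ) (e : G × I) (n : ℤ) :
    mapChain π (Finsupp.single e n) = Finsupp.single (π e.1, e.2) n :=
  Finsupp.mapDomain_single

lemma mapChain_chainAct {Γ : Type} [Group Γ] (π : G →* Γ) (g : G) (m : G × I →₀ ℤ) :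
    mapChain π (chainAct g m) = chainAct (π g) (mapChain π m) := by
  induction m using Finsupp.induction_linear with
  | zero => simp
  | add a b ha hb => rw [map_add, map_add, map_add, map_add, ha, hb]
  | single e n => simp [chainAct_single, mapChain_single, act]

lemma finite_support_path_inv (m : G × I →₀ ℤ) (e : G × I) :
    {η : G | m (act η⁻¹ e) ≠ 0}.Finite := by
  refine Set.Finite.preimage (f := fun η : G => act η⁻¹ e) ?_ m.support.finite_toSet |>.subset ?_
  · intro a _ b _ h
    simpa [act] using h
  · intro η hη
    simpa using hη

/-- If more vertices than there are orbits of edges are fixed by an equivariant map, then their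
chains satisfy a relation over the periodic subgroup. -/
theorem Equivariant.exists_relation {ψ : G →* G} {Ψ : W → W} (h : τ.Equivariant ψ Ψ)
    {α : Type} [Fintype α] [Fintype I] (hlt : Fintype.card I < Fintype.card α) (w : α → W)
    (hw : ∀ j, Ψ (w j) = w j) : ∃ c : α → periodicSubgroup ψ → ℝ, c ≠ 0 ∧
      ∀ e, ∑ j, ∑ᶠ q : periodicSubgroup ψ,
        c j q * (τ.path (w j) (act (q⁻¹ : G) e) : ℝ) = 0 := by
  classical
  let π := QuotientGroup.mk' (eventualKer ψ)
  let ψ' := eventualKer.quotientMap ψ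
  have hπ : ∀ g, π (ψ g) = ψ' (π g) := fun g => rfl
  obtain ⟨x, ⟨p, hp⟩, hx0, hxinv, hxper⟩ := L2.exists_invariant_relation hlt ψ'
    (eventualKer.quotientMap_injective ψ) (fun j => mapChain π (τ.path (w j)))
    (fun i => mapChain π (τ.path (Ψ (τ.tip i)))) (by
      intro j
      conv_lhs => rw [← hw j, h.path_eq, map_finsuppSum]
      change _ = (Finsupp.mapDomain _ _).sum _
      rw [Finsupp.sum_mapDomain_index (by simp) (by intros; rw [add_smul])]
      refine Finsupp.sum_congr (fun e _ => ?_)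
      rw [map_zsmul, mapChain_chainAct]
      rfl)
  have hxk : ∀ k γ j, x (ψ'^[k] γ, j) = x (γ, j) := by
    intro k γ j
    induction k with
    | zero => rfl
    | succ k ih => rw [Function.iterate_succ_apply', hxinv, ih]
  refine ⟨fun j q => x (π q, j), ?_, ?_⟩
  · intro h0
    obtain ⟨γ, j⟩ := p
    obtain ⟨M, hM, hγ⟩ := hxper γ j hp
    obtain ⟨q, hq, rfl⟩ := eventualKer.exists_lift ψ hM hγ
    exact hp (congrFun (congrFun h0 j) ⟨q, hq⟩)
  · intro e0
    let S : Finset G := Finset.univ.biUnion fun j => (τ.path (w j)).support.image Prod.fst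
    have hS : ∀ j, ∀ e ∈ (τ.path (w j)).support, e.1 ∈ S := fun j e he =>
      Finset.mem_biUnion.mpr ⟨j, Finset.mem_univ j, Finset.mem_image_of_mem _ he⟩
    obtain ⟨k, hk⟩ := eventualKer.exists_uniform ψ S
    let t : G → I → ℤ := fun η i => τ.path (Ψ^[k] (τ.tip i)) (act η⁻¹ e0)
    have htfin : ∀ i, {η | t η i ≠ 0}.Finite := fun i => finite_support_path_inv _ _
    have htfin' : ∀ g i, {q : periodicSubgroup ψ | t (ψ^[k] (q * g)) i ≠ 0}.Finite := by
      intro g i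
      refine Set.Finite.preimage (f := fun q : periodicSubgroup ψ => ψ^[k] (q * g)) ?_ (htfin i)
      intro a _ b _ hab
      beta_reduce at hab
      rw [iterate_map_mul, iterate_map_mul, mul_left_inj] at hab
      exact Subtype.ext (eventualKer.eq_of_iterate_eq ψ a.2 b.2 hab)
    have hpath : ∀ j (q : periodicSubgroup ψ), τ.path (w j) (act ((ψ^[k] q)⁻¹ : G) e0) =
        (τ.path (w j)).sum fun e n => n * t (ψ^[k] (q * e.1)) e.2 := by
      intro j q
      have h1 := (h.iterate k).path_eq (w j)
      rw [Function.iterate_fixed (hw j)] at h1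
      conv_lhs => rw [h1, Finsupp.sum_apply]
      refine Finset.sum_congr rfl (fun e _ => ?_)
      change (τ.path (w j) e) * chainAct _ _ _ = _
      rw [chainAct_apply, act_act, ← mul_inv_rev, iterHom_eq_iterate, ← iterate_map_mul]
    obtain ⟨t', ht'⟩ : ∃ t' : (G ⧸ eventualKer ψ) × I →₀ ℤ, ∀ q ∈ periodicSubgroup ψ, ∀ g ∈ S,
        ∀ i, t' (π (q * g), i) = t (ψ^[k] (q * g)) i := by
      let f : (G ⧸ eventualKer ψ) × I → ℤ := fun p =>
        if hp : ∃ q : periodicSubgroup ψ, ∃ g ∈ S, π (q * g) = p.1 then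
          t (ψ^[k] (hp.choose * hp.choose_spec.choose)) p.2 else 0
      have hf : ∀ q ∈ periodicSubgroup ψ, ∀ g ∈ S, ∀ i,
          f (π (q * g), i) = t (ψ^[k] (q * g)) i := by
        intro q hq g hg i
        have hp : ∃ q' : periodicSubgroup ψ, ∃ g' ∈ S, π (q' * g') = π (q * g) :=
          ⟨⟨q, hq⟩, g, hg, rfl⟩
        have h1 : f (π (q * g), i) = t (ψ^[k] (hp.choose * hp.choose_spec.choose)) i := dif_pos hp
        rw [h1, hk _ hp.choose_spec.choose_spec.1 g hg _ hp.choose.2 q hq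
          hp.choose_spec.choose_spec.2]
      have hfin : f.support.Finite := by
        refine Set.Finite.subset (s := ⋃ g ∈ S, ⋃ i : I, (fun q : periodicSubgroup ψ =>
          (π (q * g), i)) '' {q | t (ψ^[k] (q * g)) i ≠ 0}) ?_ ?_
        · exact S.finite_toSet.biUnion (fun g _ =>
            Set.finite_iUnion (fun i => (htfin' g i).image _))
        · rintro ⟨γ, i⟩ hp
          have hex : ∃ q : periodicSubgroup ψ, ∃ g ∈ S, π (q * g) = γ := by
            by_contra hn
            exact hp (dif_neg hn)
          obtain ⟨q, g, hg, rfl⟩ := hex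
          rw [Function.mem_support, hf q q.2 g hg] at hp
          simp only [Set.mem_iUnion]
          exact ⟨g, hg, i, q, hp, rfl⟩
      exact ⟨Finsupp.ofSupportFinite f hfin, hf⟩
    have hsum : ∀ j, ∑ᶠ q : periodicSubgroup ψ,
        x (π q, j) * (τ.path (w j) (act (q⁻¹ : G) e0) : ℝ) =
        (τ.path (w j)).sum fun e n => (n : ℝ) * ∑' γ, x (γ, j) * (t' (γ * π e.1, e.2) : ℝ) := by
      intro j
      have hre := (finsum_comp_equiv (eventualKer.iterateEquiv ψ k) (f := fun q : periodicSubgroup ψ =>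
        x (π q, j) * (τ.path (w j) (act (q⁻¹ : G) e0) : ℝ))).symm
      refine hre.trans ?_
      have hpull : ∀ q : periodicSubgroup ψ, x (π (ψ^[k] q), j) = x (π q, j) := fun q =>
        (congrArg (fun γ => x (γ, j)) (eventualKer.quotientMap_iterate_mk ψ k q).symm).trans
          (hxk k (π q) j)
      calc ∑ᶠ q : periodicSubgroup ψ, x (π (ψ^[k] q), j) *
            (τ.path (w j) (act ((ψ^[k] q)⁻¹ : G) e0) : ℝ)
          = ∑ᶠ q : periodicSubgroup ψ, ∑ e ∈ (τ.path (w j)).support, (τ.path (w j) e : ℝ) *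
              (x (π q, j) * (t (ψ^[k] (q * e.1)) e.2 : ℝ)) := by
            refine finsum_congr (fun q => ?_)
            rw [hpath, hpull, Finsupp.sum, Int.cast_sum, Finset.mul_sum]
            refine Finset.sum_congr rfl (fun e _ => ?_)
            push_cast
            ring
        _ = ∑ e ∈ (τ.path (w j)).support, (τ.path (w j) e : ℝ) * ∑ᶠ q : periodicSubgroup ψ,
              (x (π q, j) * (t (ψ^[k] (q * e.1)) e.2 : ℝ)) := by
            have hfs : ∀ e : G × I, (Function.support fun q : periodicSubgroup ψ =>
                x (π q, j) * (t (ψ^[k] (q * e.1)) e.2 : ℝ)).Finite := by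
              intro e
              refine (htfin' e.1 e.2).subset (fun q hq h0 => hq ?_)
              beta_reduce
              rw [h0, Int.cast_zero, mul_zero]
            rw [finsum_sum_comm]
            · exact Finset.sum_congr rfl (fun e _ => (mul_finsum _ _).symm)
            · intro e _
              exact (hfs e).subset (fun q hq h0 => hq (by beta_reduce at h0 ⊢; rw [h0, mul_zero]))
        _ = _ := by
            refine Finset.sum_congr rfl (fun e he => congrArg _ ?_)
            have hinj : Function.Injective fun q : periodicSubgroup ψ => π q :=
              fun a b hab => Subtype.ext (eventualKer.mk_injective ψ a.2 b.2 hab)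
            rw [← hinj.tsum_eq, tsum_eq_finsum]
            · refine finsum_congr (fun q => ?_)
              rw [← map_mul, ht' q q.2 _ (hS j e he)]
            · refine (htfin' e.1 e.2).subset (fun q hq h0 => hq ?_)
              beta_reduce
              rw [← map_mul, ht' q q.2 _ (hS j e he), h0, Int.cast_zero, mul_zero]
            · intro γ hγ
              have hne : x (γ, j) ≠ 0 := fun h0 => hγ (by beta_reduce; rw [h0, zero_mul])
              obtain ⟨M, hM, hγM⟩ := hxper γ j hne
              obtain ⟨q, hq, rfl⟩ := eventualKer.exists_lift ψ hM hγM
              exact ⟨⟨q, hq⟩, rfl⟩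
    have h0 : inner ℝ (L2.conv (fun j => mapChain π (τ.path (w j))) x) (L2.ofChain t') = (0 : ℝ) := by
      rw [hx0, inner_zero_left]
    rw [L2.inner_conv] at h0
    rw [← h0]
    refine Finset.sum_congr rfl (fun j _ => ?_)
    rw [hsum]
    change _ = (Finsupp.mapDomain _ _).sum _
    rw [Finsupp.sum_mapDomain_index (by simp) (by intros; push_cast; rw [add_mul])]
    refine Finsupp.sum_congr (fun e _ => ?_)
    simp only [L2.ofChain_apply]
    rfl

end FreeTree

lemma periodicSubgroup_iterHom {G : Type} [Group G] (φ : G →* G) {M : ℕ} (hM : 0 < M) :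
    periodicSubgroup (iterHom φ M) = periodicSubgroup φ := by
  ext g
  rw [mem_periodicSubgroup, mem_periodicSubgroup, iterHom_eq_iterate]
  constructor
  · rintro ⟨N, hN, h⟩
    exact ⟨M * N, by positivity, by rw [Function.iterate_mul, h]⟩
  · rintro ⟨N, hN, h⟩
    exact ⟨N, hN, by rw [← Function.iterate_mul, mul_comm, Function.iterate_mul,
      Function.iterate_fixed h]⟩

namespace IsDecomp
open FreeTree
variable {G ι κ : Type} [Group G] {A : ι → Subgroup G} {x : κ → G}

/-- The periodic subgroup of an endomorphism that is injective on the factors. -/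
theorem hasDecompLE_periodicSubgroup [Finite ι] [Finite κ] (hA : IsDecomp A x)
    (hN : ∀ i, IsNilpotentOrFinite (A i)) (hC : ∀ i, ¬ (IsCyclic (A i) ∧ Infinite (A i)))
    (φ : G →* G) (hφ : ∀ i, ∀ q ∈ A i, φ q = 1 → q = 1) {n : ℕ}
    (hn : Nat.card ι + Nat.card κ ≤ n) : HasDecompLE n (periodicSubgroup φ) := by
  obtain ⟨Φ, hΦ⟩ := hA.exists_equivariant_of_injOn φ hN hC hφ
  obtain ⟨J, w, E, rank, htri, hfix, hdec⟩ := hA.exists_triangular hN (periodicSubgroup φ)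
  suffices h : ∀ f : Fin (n + 1) → J, ¬ Function.Injective f by
    obtain ⟨h1, h2⟩ := finite_and_card_le h
    exact hdec n h1 h2
  intro f hf
  have hper : ∀ j, ∃ M, 0 < M ∧ Φ^[M] (w j) = w j := by
    intro j
    obtain ⟨h, ⟨M, hM, hh⟩, h1⟩ := hfix j
    have hh' : iterHom φ M h = h := by rw [iterHom_eq_iterate, hh]
    refine ⟨M, hM, ?_⟩
    rcases h1 with ⟨h1, h2⟩ | h1
    · exact (hΦ.iterate M).fixed hh' h1 h2
    · rw [h1, (hΦ.iterate M).fixed_smul_root hh']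
  choose P hP hfixP using hper
  let M := ∏ j, P (f j)
  have hM : 0 < M := Finset.prod_pos (fun j _ => hP (f j))
  have hwM : ∀ j, Φ^[M] (w (f j)) = w (f j) := by
    intro j
    obtain ⟨l, hl⟩ := Finset.dvd_prod_of_mem (fun j => P (f j)) (Finset.mem_univ j)
    change Φ^[∏ j, P (f j)] _ = _
    rw [hl, Function.iterate_mul, Function.iterate_fixed (hfixP (f j))]
  have := Fintype.ofFinite (ι ⊕ κ)
  obtain ⟨c, hc0, hc⟩ := (hΦ.iterate M).exists_relation (α := Fin (n + 1)) (by
    rw [Fintype.card_fin, ← Nat.card_eq_fintype_card, Nat.card_sum]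
    omega) (w ∘ f) hwM
  have htri' := htri.comp f hf
  rw [← periodicSubgroup_iterHom φ hM] at htri'
  exact hc0 (htri'.eq_zero c hc)

end IsDecomp

namespace IsDecomp
open FreeTree
variable {G ι κ : Type} [Group G] {A : ι → Subgroup G} {x : κ → G}

/-- A nilpotent or finite subgroup that is not infinite cyclic is conjugate into a factor. -/
lemma exists_conj_mem (hA : IsDecomp A x) (Q : Subgroup G) (hQ : IsNilpotentOrFinite Q)
    (hQ' : ¬ (IsCyclic Q ∧ Infinite Q)) (hne : Q ≠ ⊥) :
    ∃ i, ∃ g : G, ∀ q ∈ Q, g⁻¹ * q * g ∈ A i := by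
  obtain ⟨w | ⟨i, c⟩, hw⟩ := hA.tree.exists_fixed_vertex Q hQ hQ'
  · refine absurd ((Subgroup.eq_bot_iff_forall Q).2 (fun q hq => ?_)) hne
    have := hw q hq
    rw [smul_inl, Sum.inl.injEq] at this
    simpa using this
  · obtain ⟨g, rfl⟩ := QuotientGroup.mk_surjective c
    exact ⟨i, g, fun q hq => (smul_inr_eq_iff q g i).1 (hw q hq)⟩

/-- A free product is the free product of its factors. -/
lemma coprodI {ι : Type} (M : ι → Type) [∀ i, Group (M i)] :
    IsDecomp (fun i => factorSubgroup (M := M) i) (Fin.elim0 : Fin 0 → CoprodI M) where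
  gen K hK _ := by
    refine eq_top_iff.2 fun g _ => ?_
    exact CoprodI.induction_on g K.one_mem (fun i m => hK i ⟨m, rfl⟩) fun _ _ => K.mul_mem
  lift L _ f y := ⟨CoprodI.lift fun i => (f i).comp
      ((CoprodI.of (M := M) (i := i)).rangeRestrict : M i →* factorSubgroup (M := M) i), by
    rintro i ⟨_, q, rfl⟩
    rw [CoprodI.lift_of]
    rfl, fun j => j.elim0⟩

end IsDecomp

/-- An endomorphism has a power whose kernel meets each factor in the eventual kernel. -/
lemma exists_uniform_ker {ι : Type} [Finite ι] {M : ι → Type} [∀ i, Group (M i)]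
    (hM : ∀ i, IsSlender (M i)) (φ : CoprodI M →* CoprodI M) :
    ∃ k, 0 < k ∧ ∀ i (g : M i), CoprodI.of g ∈ eventualKer φ →
      iterHom φ k (CoprodI.of g) = 1 := by
  have key : ∀ i, ∃ k, ∀ g : M i, CoprodI.of g ∈ eventualKer φ → φ^[k] (CoprodI.of g) = 1 := by
    intro i
    obtain ⟨S, hS⟩ := hM i ((eventualKer φ).comap CoprodI.of)
    have hk : ∀ s : S, ∃ k, φ^[k] (CoprodI.of (s : M i)) = 1 := fun s => by
      have : (s : M i) ∈ (eventualKer φ).comap CoprodI.of := by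
        rw [← hS]; exact Subgroup.subset_closure s.2
      exact this
    choose k hk using hk
    refine ⟨∑ s, k s, fun g hg => ?_⟩
    have hle : (eventualKer φ).comap CoprodI.of ≤
        ((iterHom φ (∑ s, k s)).comp (CoprodI.of (i := i))).ker := by
      rw [← hS, Subgroup.closure_le]
      intro s hs
      obtain ⟨l, hl⟩ := Nat.exists_eq_add_of_le
        (Finset.single_le_sum (f := k) (fun _ _ => Nat.zero_le _) (Finset.mem_univ ⟨s, hs⟩))
      change iterHom φ _ _ = 1
      rw [iterHom_eq_iterate, hl, add_comm, Function.iterate_add_apply, hk, iterate_map_one]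
    have := hle hg
    rwa [← iterHom_eq_iterate]
  choose k hk using key
  have := Fintype.ofFinite ι
  refine ⟨(∑ i, k i) + 1, by omega, fun i g hg => ?_⟩
  obtain ⟨l, hl⟩ := Nat.exists_eq_add_of_le
    (Finset.single_le_sum (f := k) (fun _ _ => Nat.zero_le _) (Finset.mem_univ i))
  rw [iterHom_eq_iterate, hl, show k i + l + 1 = l + 1 + k i by ring, Function.iterate_add_apply,
    hk i g hg, iterate_map_one]

/-- Homomorphisms whose two composites have isomorphic periodic subgroups. -/
lemma nonempty_periodicSubgroup_mulEquiv {G K : Type} [Group G] [Group K] (π : G →* K)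
    (η : K →* G) :
    Nonempty (periodicSubgroup (π.comp η) ≃* periodicSubgroup (η.comp π)) := by
  have h1 : ∀ (G K : Type) [Group G] [Group K] (π : G →* K) (η : K →* G),
      ∀ g ∈ periodicSubgroup (π.comp η), η g ∈ periodicSubgroup (η.comp π) := by
    rintro G K _ _ π η g ⟨M, hM, hg⟩
    refine ⟨M, hM, ?_⟩
    have : Function.Semiconj η (π.comp η) (η.comp π) := fun _ => rfl
    rw [← (this.iterate_right M).eq, hg]
  let f : periodicSubgroup (π.comp η) →* periodicSubgroup (η.comp π) :=
    (η.comp (periodicSubgroup (π.comp η)).subtype).codRestrict _ (fun g => h1 _ _ π η g g.2)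
  refine ⟨MulEquiv.ofBijective f ⟨fun a b hab => ?_, fun b => ?_⟩⟩
  · have hab : η a = η b := congrArg Subtype.val hab
    refine Subtype.ext (eventualKer.eq_of_iterate_eq (π.comp η) a.2 b.2 (k := 1) ?_)
    exact congrArg π hab
  · obtain ⟨c, rfl⟩ := (eventualKer.iterateEquiv (η.comp π) 1).surjective b
    exact ⟨⟨π c, h1 _ _ η π c c.2⟩, Subtype.ext rfl⟩

/-- The periodic subgroup of an endomorphism of a free product of finite or nilpotent groups. -/
theorem hasDecompLE_periodicSubgroup_coprodI {n : ℕ} (M : Fin n → Type) [∀ i, Group (M i)]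
    (hM : ∀ i, IsNilpotentOrFinite (M i)) (φ : CoprodI M →* CoprodI M) :
    HasDecompLE n (periodicSubgroup φ) := by
  obtain ⟨k, hk0, hk⟩ := exists_uniform_ker (fun i => (hM i).isSlender) φ
  let ψ := iterHom φ k
  let Q : Fin n → Type := fun i => (ψ.comp (CoprodI.of (i := i))).range
  let π : CoprodI M →* CoprodI Q := CoprodI.lift fun i =>
    (CoprodI.of (M := Q) (i := i)).comp (ψ.comp (CoprodI.of (i := i))).rangeRestrict
  let η : CoprodI Q →* CoprodI M := CoprodI.lift fun i =>
    (ψ.comp (CoprodI.of (i := i))).range.subtype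
  have hηπ : η.comp π = ψ := by
    refine CoprodI.ext_hom _ _ (fun i => ?_)
    ext g
    simp only [η, π, MonoidHom.comp_apply, CoprodI.lift_of]
    rfl
  have hinj : ∀ i (q : Q i), π (η (CoprodI.of q)) = 1 → q = 1 := by
    rintro i ⟨_, g, rfl⟩ h
    have h1 : η (CoprodI.of (M := Q) (i := i) ⟨_, g, rfl⟩) = ψ (CoprodI.of g) := by
      simp only [η, CoprodI.lift_of]
      rfl
    rw [h1] at h
    have h2 : ψ (ψ (CoprodI.of g)) = 1 := by
      rw [← hηπ]
      change η (π (η.comp π _)) = 1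
      rw [hηπ, h, map_one]
    refine Subtype.ext (hk i g ⟨k + k, ?_⟩)
    rw [Function.iterate_add_apply, ← iterHom_eq_iterate]
    exact h2
  have hQ : ∀ i, IsNilpotentOrFinite (factorSubgroup (M := Q) i) := by
    intro i
    exact ((hM i).of_surjective _ (ψ.comp (CoprodI.of (i := i))).rangeRestrict_surjective
      ).of_surjective _ (CoprodI.of (M := Q) (i := i)).rangeRestrict_surjective
  obtain ⟨ι, κ, h1, h2, A, x, hA, hN, hC, hb, hc⟩ :=
    (IsDecomp.coprodI Q).hasDecompLE hQ
  have hper : HasDecompLE n (periodicSubgroup (π.comp η)) := by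
    refine hA.hasDecompLE_periodicSubgroup hN hC (π.comp η) ?_ (hc.trans (by simp))
    intro i q hq h
    obtain ⟨j, g, hg⟩ := (IsDecomp.coprodI Q).exists_conj_mem (A i) (hN i) (hC i) (hb i)
    obtain ⟨r, hr⟩ := hg q hq
    have h3 : π.comp η (g⁻¹ * q * g) = 1 := by
      rw [map_mul, map_mul, h, mul_one, ← map_mul, inv_mul_cancel, map_one]
    rw [← hr] at h3
    rw [hinj j r h3, map_one] at hr
    have h4 : g⁻¹ * q * g = 1 := hr.symm
    calc q = g * (g⁻¹ * q * g) * g⁻¹ := by group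
      _ = 1 := by rw [h4]; group
  obtain ⟨e⟩ := nonempty_periodicSubgroup_mulEquiv π η
  have := hper.of_equiv e
  rwa [hηπ, periodicSubgroup_iterHom φ hk0] at this

/-- An endomorphism under which all points are periodic has finite order on each finitely generated
subgroup. -/
lemma exists_period_of_fg {G : Type} [Group G] (α : G →* G) (hα : ∀ g, ∃ M, 0 < M ∧ α^[M] g = g)
    {H : Subgroup G} (hH : H.FG) : ∃ M, 0 < M ∧ ∀ g ∈ H, α^[M] g = g := by
  obtain ⟨S, rfl⟩ := hH
  choose P hP hfix using hα
  refine ⟨∏ s ∈ S, P s, Finset.prod_pos (fun s _ => hP s), fun g hg => ?_⟩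
  have : Subgroup.closure S ≤ fixedSubgroup (iterHom α (∏ s ∈ S, P s)) := by
    rw [Subgroup.closure_le]
    intro s hs
    obtain ⟨l, hl⟩ := Finset.dvd_prod_of_mem P hs
    change iterHom α _ s = s
    rw [iterHom_eq_iterate, hl, Function.iterate_mul, Function.iterate_fixed (hfix s)]
  have := this hg
  rwa [← iterHom_eq_iterate]

/-- If all points are periodic under an endomorphism of a free product, then it has finite order. -/
lemma HasDecompLE.exists_period {n : ℕ} {G : Type} [Group G] (hG : HasDecompLE n G) (α : G →* G)
    (hα : ∀ g, ∃ M, 0 < M ∧ α^[M] g = g) : ∃ M, 0 < M ∧ α^[M] = id := by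
  obtain ⟨ι, κ, h1, h2, A, x, hA, hN, -⟩ := hG
  have hfg : ∀ i, (A i).FG := fun i =>
    (Group.fg_iff_subgroup_fg _).1 (Group.fg_def.2 ((hN i).isSlender ⊤))
  choose P hP hPfix using fun i => exists_period_of_fg α hα (hfg i)
  choose R hR hRfix using fun j => hα (x j)
  have := Fintype.ofFinite ι
  have := Fintype.ofFinite κ
  refine ⟨(∏ i, P i) * ∏ j, R j, mul_pos (Finset.prod_pos fun i _ => hP i)
    (Finset.prod_pos fun j _ => hR j), ?_⟩
  have htop := hA.gen (fixedSubgroup (iterHom α ((∏ i, P i) * ∏ j, R j))) ?_ ?_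
  · funext g
    have : g ∈ fixedSubgroup (iterHom α ((∏ i, P i) * ∏ j, R j)) := by rw [htop]; trivial
    rw [← iterHom_eq_iterate]
    exact this
  · intro i q hq
    obtain ⟨l, hl⟩ := Finset.dvd_prod_of_mem P (Finset.mem_univ i)
    change iterHom α _ q = q
    rw [iterHom_eq_iterate, hl, mul_assoc, Function.iterate_mul,
      Function.iterate_fixed (hPfix i q hq)]
  · intro j
    obtain ⟨l, hl⟩ := Finset.dvd_prod_of_mem R (Finset.mem_univ j)
    change iterHom α _ (x j) = x j
    rw [iterHom_eq_iterate, hl, mul_left_comm, Function.iterate_mul,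
      Function.iterate_fixed (hRfix j)]

/-- The fixed subgroup of an endomorphism of a free product of finite or nilpotent groups. -/
theorem hasDecompLE_fixedSubgroup_coprodI {n : ℕ} (M : Fin n → Type) [∀ i, Group (M i)]
    (hM : ∀ i, IsNilpotentOrFinite (M i)) (φ : CoprodI M →* CoprodI M) :
    HasDecompLE n (fixedSubgroup φ) := by
  have hP := hasDecompLE_periodicSubgroup_coprodI M hM φ
  have hinv : ∀ g ∈ periodicSubgroup φ, φ g ∈ periodicSubgroup φ :=
    fun g hg => eventualKer.iterate_mem φ hg 1
  obtain ⟨N, hN, hα⟩ := hP.exists_period (φ.restrictEnd _ hinv) (by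
    rintro ⟨g, N, hN, hg⟩
    exact ⟨N, hN, Subtype.ext ((φ.coe_iterate_restrictEnd _ hinv N _).trans hg)⟩)
  exact HasDecompLE.of_restrictEnd (K := periodicSubgroup φ) (hK := hinv)
    (fun g hg => ⟨1, one_pos, hg⟩) (hP.fixedSubgroup_of_finite_order hN _ hα)

lemma mem_conjSubgroup {G : Type*} [Group G] {g q : G} {S : Subgroup G} :
    q ∈ conjSubgroup g S ↔ g⁻¹ * q * g ∈ S := by
  constructor
  · rintro ⟨s, hs, rfl⟩
    simpa [mul_assoc] using hs
  · intro h
    exact ⟨_, h, by simp [mul_assoc]⟩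

namespace IsDecomp
open FreeTree
variable {G ι κ : Type} [Group G] {A : ι → Subgroup G} {x : κ → G}

/-- A factor is maximal among the nilpotent or finite subgroups that are not infinite cyclic. -/
lemma le_of_le (hA : IsDecomp A x) {i : ι} {Q : Subgroup G} (hQ : IsNilpotentOrFinite Q)
    (hle : A i ≤ Q) (hi : ¬ (IsCyclic (A i) ∧ Infinite (A i))) (hb : A i ≠ ⊥) : Q ≤ A i := by
  obtain ⟨⟨p, hp⟩, hp1⟩ := Subgroup.ne_bot_iff_exists_ne_one.1 hb
  have hp1 : p ≠ 1 := fun h => hp1 (Subtype.ext h)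
  have hQ' : ¬ (IsCyclic Q ∧ Infinite Q) := by
    rintro ⟨hc, hinf⟩
    refine hi ⟨isCyclic_of_injective _ (Subgroup.inclusion_injective hle), ?_⟩
    by_contra hfin
    rw [not_infinite_iff_finite] at hfin
    obtain ⟨g, hg⟩ := hc
    obtain ⟨k, hk⟩ := Subgroup.mem_zpowers_iff.1 (hg ⟨p, hle hp⟩)
    obtain ⟨m, hm, hpm⟩ := isOfFinOrder_iff_pow_eq_one.1 (isOfFinOrder_of_finite (⟨p, hp⟩ : A i))
    have h1 : g ^ (k * m) = 1 := by
      rw [zpow_mul, hk, zpow_natCast]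
      have h2 : p ^ m = 1 := congrArg Subtype.val hpm
      exact Subtype.ext h2
    have h2 := orderOf_dvd_iff_zpow_eq_one.2 h1
    rw [Infinite.orderOf_eq_zero_of_forall_mem_zpowers hg, Nat.cast_zero, zero_dvd_iff] at h2
    obtain rfl : k = 0 := by
      rcases mul_eq_zero.1 h2 with h | h
      · exact h
      · omega
    exact hp1 (by simpa using (congrArg Subtype.val hk).symm)
  obtain ⟨j, g, hg⟩ := hA.exists_conj_mem Q hQ hQ' fun h => hb (le_bot_iff.1 (h ▸ hle))
  have hfix : ∀ q ∈ Q, q • (Sum.inr ⟨j, g⟩ : Vertex A) = Sum.inr ⟨j, g⟩ := fun q hq =>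
    (smul_inr_eq_iff q g j).2 (hg q hq)
  have heq : (Sum.inr ⟨j, g⟩ : Vertex A) = Sum.inr ⟨i, ((1 : G) : G ⧸ A i)⟩ := by
    by_contra hne
    exact hp1 (hA.tree.unique_fix hne (hfix p (hle hp))
      ((smul_inr_eq_iff _ 1 i).2 (by simpa using hp)))
  intro q hq
  have := hfix q hq
  rw [heq, smul_inr_eq_iff] at this
  simpa using this

/-- The isomorphism onto the abstract free product. -/
lemma exists_mulEquiv (hA : IsDecomp A x) {M : ι ⊕ κ → Type} [∀ k, Group (M k)]
    (u : ∀ i, M (.inl i) ≃* A i) (v : ∀ j, Multiplicative ℤ ≃* M (.inr j)) :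
    ∃ e : G ≃* CoprodI M, ∀ i (q : M (.inl i)), e.symm (CoprodI.of q) = u i q := by
  obtain ⟨F, hF, hFx⟩ := hA.lift (CoprodI M)
    (fun i => (CoprodI.of (M := M) (i := Sum.inl i)).comp (u i).symm.toMonoidHom)
    (fun j => CoprodI.of (v j (Multiplicative.ofAdd 1)))
  let b : ∀ k, M k →* G := fun k => match k with
    | .inl i => (A i).subtype.comp (u i).toMonoidHom
    | .inr j => (zpowersHom G (x j)).comp (v j).symm.toMonoidHom
  have hl : ∀ i (q : M (.inl i)), CoprodI.lift b (CoprodI.of q) = u i q :=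
    fun i q => CoprodI.lift_of _ _
  have hr : ∀ j z, CoprodI.lift b (CoprodI.of (v j (Multiplicative.ofAdd z))) = x j ^ z := by
    intro j z
    rw [CoprodI.lift_of]
    simp [b]
  refine ⟨MonoidHom.toMulEquiv F (CoprodI.lift b) ?_ ?_, hl⟩
  · refine hA.hom_ext (fun i q hq => ?_) (fun j => ?_)
    · have h1 := hF i ⟨q, hq⟩
      dsimp only at h1
      rw [MonoidHom.comp_apply, h1]
      exact (hl _ _).trans (congrArg Subtype.val ((u i).apply_symm_apply _))
    · rw [MonoidHom.comp_apply, hFx, hr, zpow_one]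
      rfl
  · refine CoprodI.ext_hom _ _ ?_
    rintro (i | j)
    · ext q
      rw [MonoidHom.comp_apply, MonoidHom.comp_apply, hl, hF]
      exact congrArg CoprodI.of ((u i).symm_apply_apply q)
    · ext q
      obtain ⟨z, rfl⟩ := (v j).surjective q
      obtain ⟨z, rfl⟩ := Multiplicative.ofAdd.surjective z
      rw [MonoidHom.comp_apply, MonoidHom.comp_apply, hr, map_zpow, hFx, ← map_zpow, ← map_zpow,
        ← ofAdd_zsmul]
      simp

/-- A decomposition may be indexed by any equivalent types. -/
lemma reindex (hA : IsDecomp A x) {ι' κ' : Type} (e : ι' ≃ ι) (f : κ' ≃ κ) :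
    IsDecomp (A ∘ e) (x ∘ f) where
  gen K h1 h2 := hA.gen K (fun i => by simpa using h1 (e.symm i))
    (fun j => by simpa using h2 (f.symm j))
  lift L _ g y := by
    obtain ⟨F, hF, hFx⟩ := hA.lift L
      (fun i => (g (e.symm i)).comp (Subgroup.inclusion (by simp)))
      (y ∘ f.symm)
    refine ⟨F, fun i q => ?_, fun j => by simpa using hFx (f j)⟩
    obtain ⟨i, rfl⟩ := e.symm.surjective i
    have := hF i ⟨q, by simpa using q.2⟩
    exact this

end IsDecomp

/-- A subgroup of a free product which is itself a free product of finite or nilpotent groups. -/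
theorem HasDecompLE.hasKuroshRankLE {ι : Type} {M : ι → Type} [∀ i, Group (M i)]
    (hM : ∀ i, IsNilpotentOrFinite (M i)) {H : Subgroup (CoprodI M)} {n : ℕ}
    (hH : HasDecompLE n H) : HasKuroshRankLE H n := by
  obtain ⟨ι₁, κ₁, h1, h2, A₁, x₁, hA₁, hN₁, hC₁, hb₁, hc⟩ := hH
  let e₁ := (Finite.equivFin ι₁).symm
  let f₁ := (Finite.equivFin κ₁).symm
  have hA := hA₁.reindex e₁ f₁
  set A := A₁ ∘ e₁
  have hN : ∀ i, IsNilpotentOrFinite (A i) := fun i => hN₁ _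
  have hC : ∀ i, ¬ (IsCyclic (A i) ∧ Infinite (A i)) := fun i => hC₁ _
  have hb : ∀ i, A i ≠ ⊥ := fun i => hb₁ _
  have key : ∀ i, ∃ j, ∃ g : CoprodI M,
      ((conjSubgroup g (factorSubgroup j)) ⊓ H).subgroupOf H = A i := by
    intro i
    have em := (A i).equivMapOfInjective H.subtype H.subtype_injective
    obtain ⟨j, g, hg⟩ := (IsDecomp.coprodI M).exists_conj_mem ((A i).map H.subtype)
      ((hN i).of_injective em.symm.toMonoidHom em.symm.injective)
      (fun ⟨h3, h4⟩ => hC i ⟨em.symm.isCyclic.1 h3, em.toEquiv.infinite_iff.2 h4⟩)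
      (by rw [Ne, Subgroup.map_eq_bot_iff_of_injective _ H.subtype_injective]; exact hb i)
    have hle : A i ≤ (conjSubgroup g (factorSubgroup j) ⊓ H).subgroupOf H := fun q hq =>
      ⟨mem_conjSubgroup.2 (hg q ⟨q, hq, rfl⟩), q.2⟩
    refine ⟨j, g, le_antisymm (hA.le_of_le ?_ hle (hC i) (hb i)) hle⟩
    have hf : IsNilpotentOrFinite (conjSubgroup g (factorSubgroup (M := M) j)) :=
      (hM j).of_surjective
        (((MulAut.conj g).toMonoidHom.subgroupMap _).comp
          ((CoprodI.of (M := M) (i := j)).rangeRestrict : M j →* factorSubgroup (M := M) j))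
        ((MonoidHom.subgroupMap_surjective _ _).comp (MonoidHom.rangeRestrict_surjective _))
    exact hf.of_injective
      ((H.subtype.comp (Subgroup.subtype _)).codRestrict _ (fun q => q.2.1))
      (fun a b hab => by
        have h3 := congrArg Subtype.val hab
        exact Subtype.ext (Subtype.ext h3))
  choose J g hJ using key
  let u : ∀ i, ↥(conjSubgroup (g i) (factorSubgroup (J i)) ⊓ H) ≃* A i := fun i =>
    (Subgroup.subgroupOfEquivOfLe inf_le_right).symm.trans (MulEquiv.subgroupCongr (hJ i))
  have hu : ∀ i q, (((u i q : A i) : H) : CoprodI M) = q := fun i q => rfl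
  obtain ⟨e, he⟩ := hA.exists_mulEquiv (M := Sum.elim
      (fun i => ↥(conjSubgroup (g i) (factorSubgroup (J i)) ⊓ H))
      (fun _ : Fin (Nat.card κ₁) => Multiplicative ℤ)) u (fun _ => MulEquiv.refl _)
  refine ⟨_, _, J, g, e, hc, fun i => ?_, fun i q => congrArg Subtype.val (he i q)⟩
  have := (Subgroup.nontrivial_iff_ne_bot (A i)).2 (hb i)
  exact (u i).toEquiv.nontrivial

/-- Theorem 3 of the paper. Let `G = G_1 * … * G_n` be a free product
in which each factor `G_i` is either a finitely generated nilpotent group or a finite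
group.  If `φ` is any endomorphism of `G`, then `Fix(φ)` has Kurosh rank at most `n`
with respect to this splitting of `G`. -/
theorem kurosh_rank_fixedSubgroup_of_nilpotent_or_finite_factors {n : ℕ}
    (Gf : Fin n → Type) [∀ i, Group (Gf i)]
    (hG : ∀ i, (Group.FG (Gf i) ∧ Group.IsNilpotent (Gf i)) ∨ Finite (Gf i))
    (φ : CoprodI Gf →* CoprodI Gf) :
    HasKuroshRankLE (fixedSubgroup φ) n := by
  have hM : ∀ i, IsNilpotentOrFinite (Gf i) := fun i => .of_fg (hG i)
  exact (hasDecompLE_fixedSubgroup_coprodI Gf hM φ).hasKuroshRankLE hM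
end

section
/- Every finitely generated residually finite group is Hopfian; that is, every surjective endomorphism of a finitely generated residually finite group is injective. -/
/-- A group is residually finite if every nontrivial element survives in some finite
quotient. -/
def ResiduallyFinite (G : Type*) [Group G] : Prop :=
  ∀ g : G, g ≠ 1 → ∃ (Γ : Type) (_ : Group Γ) (_ : Finite Γ) (π : G →* Γ), π g ≠ 1

/-- There are only finitely many homomorphisms from a finitely generated group to a finite
group. -/
theorem MonoidHom.finite_of_group_fg {G Γ : Type*} [Group G] [Group Γ] [Finite Γ]
    (hfg : Group.FG G) : Finite (G →* Γ) := by
  obtain ⟨S, hS, hfin⟩ := Group.fg_iff.mp hfg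
  have := hfin.to_subtype
  refine Finite.of_injective (fun (f : G →* Γ) (s : S) => f s) fun f g h => ?_
  exact MonoidHom.eq_of_eqOn_dense hS fun s hs => congrFun h ⟨s, hs⟩

/-- Every finitely generated residually finite group is Hopfian: every
surjective endomorphism is injective. -/
theorem hopfian_of_fg_residuallyFinite {G : Type*} [Group G]
    (hfg : Group.FG G) (hrf : ResiduallyFinite G)
    (φ : G →* G) (hsurj : Function.Surjective φ) :
    Function.Injective φ := by
  refine (injective_iff_map_eq_one φ).mpr fun g hg => ?_
  by_contra hne
  obtain ⟨Γ, _, _, π, hπ⟩ := hrf g hne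
  have : Finite (G →* Γ) := MonoidHom.finite_of_group_fg hfg
  have hinj : Function.Injective fun ψ : G →* Γ => ψ.comp φ :=
    fun _ _ h => (MonoidHom.cancel_right hsurj).mp h
  obtain ⟨ψ, rfl⟩ := Finite.surjective_of_injective hinj π
  exact hπ (by simp [hg])
end
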